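/- arXiv:2305.01745 — 2 statements merged into one kernel-verified Lean document; each statement's English description precedes it below -/
import Mathlib

section
/- Let q ≥ 1, s ≥ 0, and let Y_s ∈ 𝕐_s be given. Then for every integer p ≥ q+2 there exist a function f ∈ Δ^(q)(Y_s) (continuous on I) and a collection A_p = {α_i}_{i=1}^p of points with -1 ≤ α_p < ... < α_1 ≤ 1 such that for every n ∈ ℕ there is no polynomial p_n of degree ≤ n with p_n ∈ Δ^(q)(Y_s) and p_n(α) = f(α) for all α ∈ A_p. In other words, q-monotone polynomial approximation with interpolation at A_p is impossible for q ≥ 1. -/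
/-- The divided difference `[t 0, …, t q; f]` of `f` at `q+1` pairwise distinct points,
given by the explicit formula `∑ j, f (t j) / ∏_{i ≠ j} (t j - t i)`. -/
noncomputable def divDiff (f : ℝ → ℝ) {q : ℕ} (t : Fin (q + 1) → ℝ) : ℝ :=
  ∑ j : Fin (q + 1), f (t j) / ∏ i ∈ Finset.univ.erase j, (t j - t i)

/-- `f ∈ Δ^(q)(Y_s)` where the collection `Y_s` is encoded by the extended sequence
`y : Fin (s+2) → ℝ` with `y 0 = 1`, `y (s+1) = -1`:
for each `0 ≤ i ≤ s`, `(-1)^i f` is `q`-monotone on `[y (i+1), y i]`, i.e. all its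
divided differences over `q+1` distinct points of that interval are nonnegative. -/
def DeltaQY {s : ℕ} (q : ℕ) (y : Fin (s + 2) → ℝ) (f : ℝ → ℝ) : Prop :=
  ∀ i : Fin (s + 1), ∀ t : Fin (q + 1) → ℝ, Function.Injective t →
    (∀ j, t j ∈ Set.Icc (y i.succ) (y i.castSucc)) →
    0 ≤ (-1 : ℝ) ^ (i : ℕ) * divDiff f t

open Finset Polynomial in
theorem divDiff_eq_coeff_interpolate (f : ℝ → ℝ) {q : ℕ} {t : Fin (q + 1) → ℝ}
    (ht : Function.Injective t) :
    divDiff f t = (Lagrange.interpolate univ t (fun j => f (t j))).coeff q := by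
  have hL := Lagrange.degree_interpolate_lt (fun j => f (t j)) (s := univ) ht.injOn
  have hc := Lagrange.coeff_eq_sum (s := univ) ht.injOn hL
  rw [card_univ, Fintype.card_fin, Nat.add_sub_cancel] at hc
  rw [hc]
  exact sum_congr rfl fun j _ => by
    rw [Lagrange.eval_interpolate_at_node _ ht.injOn (mem_univ j)]

/-- Iterated Rolle theorem. -/
theorem exists_eq_zero_of_hasDerivAt_chain (n : ℕ) (g : ℕ → ℝ → ℝ)
    (hg : ∀ i < n, ∀ x, HasDerivAt (g i) (g (i + 1) x) x)
    (t : Fin (n + 1) → ℝ) (ht : StrictMono t) (h0 : ∀ j, g 0 (t j) = 0) :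
    ∃ ξ, g n ξ = 0 := by
  induction n generalizing g with
  | zero => exact ⟨t 0, h0 0⟩
  | succ n ih =>
    have key : ∀ j : Fin (n + 1), ∃ c ∈ Set.Ioo (t j.castSucc) (t j.succ), g 1 c = 0 :=
      fun j => exists_hasDerivAt_eq_zero (ht j.castSucc_lt_succ)
        (fun x _ => (hg 0 n.succ_pos x).continuousAt.continuousWithinAt)
        (by rw [h0, h0]) (fun x _ => hg 0 n.succ_pos x)
    choose u hu hu0 using key
    refine ih (fun i => g (i + 1)) (fun i hi => hg (i + 1) (by omega)) u ?_ hu0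
    rw [Fin.strictMono_iff_lt_succ]
    intro i
    refine (hu i.castSucc).2.trans ?_
    simpa using (hu i.succ).1

open Finset Polynomial in
/-- Mean value theorem for divided differences. -/
theorem exists_eq_factorial_mul_divDiff (q : ℕ) (g : ℕ → ℝ → ℝ)
    (hg : ∀ i < q, ∀ x, HasDerivAt (g i) (g (i + 1) x) x)
    (t : Fin (q + 1) → ℝ) (ht : Function.Injective t) :
    ∃ ξ, g q ξ = q.factorial * divDiff (g 0) t := by
  rw [divDiff_eq_coeff_interpolate _ ht]
  set L := Lagrange.interpolate univ t (fun j => g 0 (t j)) with hLdef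
  have hdeg : L.natDegree ≤ q := by
    have := Lagrange.degree_interpolate_le (fun j => g 0 (t j)) (s := univ) ht.injOn
    exact natDegree_le_of_degree_le (by
      rwa [card_univ, Fintype.card_fin, Nat.add_sub_cancel] at this)
  have hcard : (univ.image t).card = q + 1 := by simp [card_image_of_injective _ ht]
  obtain ⟨ξ, hξ⟩ := exists_eq_zero_of_hasDerivAt_chain q
    (fun i x => g i x - (derivative^[i] L).eval x)
    (fun i hi x => (hg i hi x).sub (by
      rw [Function.iterate_succ_apply']; exact Polynomial.hasDerivAt _ _))
    ((univ.image t).orderEmbOfFin hcard) (OrderEmbedding.strictMono _) (fun j => by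
      obtain ⟨k, -, hk⟩ := mem_image.1 ((univ.image t).orderEmbOfFin_mem hcard j)
      rw [← hk]
      rw [Function.iterate_zero_apply, hLdef,
        Lagrange.eval_interpolate_at_node _ ht.injOn (mem_univ k), sub_self])
  refine ⟨ξ, ?_⟩
  have hC : derivative^[q] L = C (q.factorial * L.coeff q) := by
    rw [eq_C_of_natDegree_le_zero
      ((natDegree_iterate_derivative L q).trans (Nat.sub_eq_zero_of_le hdeg).le),
      coeff_iterate_derivative]
    simp [Nat.descFactorial_self]
  rw [hC, eval_C] at hξ
  linarith

theorem hasDerivAt_max_sub_zero_pow (c : ℝ) (m : ℕ) (x : ℝ) :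
    HasDerivAt (fun x => max (x - c) 0 ^ (m + 2)) ((m + 2) * max (x - c) 0 ^ (m + 1)) x := by
  have hne : ∀ x ≠ c, HasDerivAt (fun x => max (x - c) 0 ^ (m + 2))
      ((m + 2) * max (x - c) 0 ^ (m + 1)) x := by
    intro x hx
    rcases hx.lt_or_gt with h | h
    · rw [max_eq_right (by linarith), zero_pow (by omega), mul_zero]
      refine (hasDerivAt_const x (0 : ℝ)).congr_of_eventuallyEq ?_
      filter_upwards [gt_mem_nhds h] with z hz
      simp [max_eq_right (show z - c ≤ 0 by linarith)]
    · rw [max_eq_left (by linarith)]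
      have := ((hasDerivAt_id x).sub_const c).pow (m + 2)
      refine HasDerivAt.congr_of_eventuallyEq (by simpa using this) ?_
      filter_upwards [lt_mem_nhds h] with z hz
      simp [max_eq_left (show 0 ≤ z - c by linarith)]
  rcases eq_or_ne x c with rfl | hx
  · exact hasDerivAt_of_hasDerivAt_of_ne hne (by fun_prop) (by fun_prop)
  · exact hne x hx

theorem divDiff_max_sub_zero_pow_nonneg (c : ℝ) {q : ℕ} {t : Fin (q + 1) → ℝ}
    (ht : Function.Injective t) : 0 ≤ divDiff (fun x => max (x - c) 0 ^ (q + 1)) t := by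
  obtain ⟨ξ, hξ⟩ := exists_eq_factorial_mul_divDiff q
    (fun i x => (q + 1).descFactorial i * max (x - c) 0 ^ (q + 1 - i)) (fun i hi x => by
      obtain ⟨m, rfl⟩ : ∃ m, q = i + 1 + m := ⟨q - (i + 1), by omega⟩
      have h := (hasDerivAt_max_sub_zero_pow c m x).const_mul
        ((i + 1 + m + 1).descFactorial i : ℝ)
      have e1 : i + 1 + m + 1 - i = m + 2 := by omega
      have e2 : i + 1 + m + 1 - (i + 1) = m + 1 := by omega
      rw [Nat.descFactorial_succ, e1, e2]
      refine h.congr_deriv ?_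
      push_cast
      ring) t ht
  simp only [Nat.descFactorial_zero, Nat.cast_one, one_mul, Nat.sub_zero] at hξ
  have h0 : 0 ≤ (q.factorial : ℝ) * divDiff (fun x => max (x - c) 0 ^ (q + 1)) t := by
    rw [← hξ]
    positivity
  exact nonneg_of_mul_nonneg_right h0 (by positivity)

theorem divDiff_eq_zero {f : ℝ → ℝ} {q : ℕ} {t : Fin (q + 1) → ℝ} (h : ∀ j, f (t j) = 0) :
    divDiff f t = 0 := by
  simp [divDiff, h]

open Finset in
theorem divDiff_update {f : ℝ → ℝ} {q : ℕ} {t : Fin (q + 1) → ℝ} (h : ∀ j, f (t j) = 0)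
    (k : Fin (q + 1)) (x : ℝ) :
    divDiff f (Function.update t k x) = f x / ∏ i ∈ univ.erase k, (x - t i) := by
  rw [divDiff, sum_eq_single k]
  · rw [Function.update_self]
    congr 1
    exact prod_congr rfl fun i hi => by rw [Function.update_of_ne (ne_of_mem_erase hi)]
  · intro j _ hj
    rw [Function.update_of_ne hj, h, zero_div]
  · simp

open Finset in
/-- A function with nonnegative divided differences over `q + 1` points and with `q + 1` zeros
vanishes strictly between any two of these zeros. -/
theorem eq_zero_of_divDiff_nonneg {f : ℝ → ℝ} {q : ℕ} {a b : ℝ}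
    (hf : ∀ t : Fin (q + 1) → ℝ, Function.Injective t → (∀ j, t j ∈ Set.Icc a b) →
      0 ≤ divDiff f t)
    {t : Fin (q + 1) → ℝ} (ht : Function.Injective t) (htab : ∀ j, t j ∈ Set.Icc a b)
    (h0 : ∀ j, f (t j) = 0) {k l : Fin (q + 1)} {x : ℝ} (hkx : t k < x) (hxl : x < t l) :
    f x = 0 := by
  by_cases hx : x ∈ Set.range t
  · obtain ⟨j, rfl⟩ := hx
    exact h0 j
  have hxt : ∀ j, x ≠ t j := fun j hj => hx ⟨j, hj.symm⟩
  have hkl : k ≠ l := by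
    rintro rfl
    exact (hkx.trans hxl).false
  have hnonneg : ∀ m, 0 ≤ f x / ∏ i ∈ univ.erase m, (x - t i) := by
    intro m
    rw [← divDiff_update h0]
    refine hf _ (fun i j hij => ?_) fun j => ?_
    · by_cases hi : i = m <;> by_cases hj : j = m
      · rw [hi, hj]
      · subst hi; simp [Function.update_of_ne hj, hxt] at hij
      · subst hj; simp [Function.update_of_ne hi, (hxt _).symm] at hij
      · rw [Function.update_of_ne hi, Function.update_of_ne hj] at hij
        exact ht hij
    · by_cases hj : j = m
      · subst hj
        rw [Function.update_self]
        exact ⟨(htab k).1.trans hkx.le, hxl.le.trans (htab l).2⟩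
      · rw [Function.update_of_ne hj]
        exact htab j
  have hk := hnonneg k
  have hl := hnonneg l
  rw [← mul_prod_erase _ _ (mem_erase.2 ⟨hkl.symm, mem_univ l⟩)] at hk
  rw [← mul_prod_erase _ _ (mem_erase.2 ⟨hkl, mem_univ k⟩), erase_right_comm] at hl
  set R := ∏ i ∈ (univ.erase k).erase l, (x - t i)
  have hR : R ≠ 0 := prod_ne_zero_iff.2 fun i _ => sub_ne_zero.2 (hxt i)
  have h1 : 0 < x - t k := by linarith
  have h2 : 0 < t l - x := by linarith
  have hk' : f x / R ≤ 0 := by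
    have : f x / R = -((t l - x) * (f x / ((x - t l) * R))) := by
      have : x - t l ≠ 0 := by linarith
      field_simp
      ring
    rw [this]
    exact neg_nonpos.2 (mul_nonneg h2.le hk)
  have hl' : 0 ≤ f x / R := by
    have : f x / R = (x - t k) * (f x / ((x - t k) * R)) := by field_simp
    rw [this]
    exact mul_nonneg h1.le hl
  exact (div_eq_zero_iff.1 (le_antisymm hk' hl')).resolve_right hR

theorem Polynomial.eq_zero_of_divDiff_nonneg {P : Polynomial ℝ} {q : ℕ} (hq : 1 ≤ q) {a b : ℝ}
    (hP : ∀ t : Fin (q + 1) → ℝ, Function.Injective t → (∀ j, t j ∈ Set.Icc a b) →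
      0 ≤ divDiff (fun x => P.eval x) t)
    {t : Fin (q + 1) → ℝ} (ht : Function.Injective t) (htab : ∀ j, t j ∈ Set.Icc a b)
    (h0 : ∀ j, P.eval (t j) = 0) : P = 0 := by
  obtain ⟨k, l, hkl⟩ : ∃ k l, t k < t l := by
    have hne : (0 : Fin (q + 1)) ≠ Fin.last q := by
      simp [Fin.ext_iff]
      omega
    rcases (ht.ne hne).lt_or_gt with h | h
    exacts [⟨_, _, h⟩, ⟨_, _, h⟩]
  exact P.eq_zero_of_infinite_isRoot ((Set.Ioo_infinite hkl).mono fun x hx =>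
    _root_.eq_zero_of_divDiff_nonneg hP ht htab h0 hx.1 hx.2)

/-- If `q ≥ 1`, then `q`-monotone polynomial approximation with general interpolatory
constraints is impossible: for any `Y_s` and any `p ≥ q + 2` there are
`f ∈ Δ^(q)(Y_s)` continuous on `[-1,1]` and interpolation points
`-1 ≤ α_p < ⋯ < α_1 ≤ 1` such that no polynomial of any degree `n` is simultaneously
in `Δ^(q)(Y_s)` and interpolates `f` at all the points `α_i`. -/
theorem statement0 (q s : ℕ) (hq : 1 ≤ q)
    (y : Fin (s + 2) → ℝ) (hy : StrictAnti y)
    (hy0 : y 0 = 1) (hylast : y (Fin.last (s + 1)) = -1)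
    (p : ℕ) (hp : q + 2 ≤ p) :
    ∃ (f : ℝ → ℝ) (α : Fin p → ℝ),
      ContinuousOn f (Set.Icc (-1 : ℝ) 1) ∧
      DeltaQY q y f ∧
      StrictAnti α ∧
      (∀ i, α i ∈ Set.Icc (-1 : ℝ) 1) ∧
      ∀ n : ℕ, ¬ ∃ P : Polynomial ℝ, P.natDegree ≤ n ∧
          DeltaQY q y (fun x => P.eval x) ∧
          (∀ i, P.eval (α i) = f (α i)) := by
  set a := y 1 with ha
  have ha1 : a < 1 := by
    rw [← hy0]
    exact hy (by simp)
  have ham : -1 ≤ a := by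
    rw [← hylast]
    exact hy.antitone (Fin.le_last _)
  have hp0 : (0 : ℝ) < p := by
    have : 0 < p := by omega
    exact_mod_cast this
  have hstep : 0 < (1 - a) / p := div_pos (by linarith) hp0
  let α : Fin p → ℝ := fun i => 1 - (1 - a) / p * (i : ℕ)
  have hα : StrictAnti α := fun i j hij => by
    have : ((i : ℕ) : ℝ) < (j : ℕ) := by exact_mod_cast hij
    exact sub_lt_sub_left (mul_lt_mul_of_pos_left this hstep) 1
  have hαa : ∀ i, a < α i := fun i => by
    have h1 : ((i : ℕ) : ℝ) < p := by exact_mod_cast i.2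
    have h2 : (1 - a) / p * (i : ℕ) < (1 - a) / p * p := mul_lt_mul_of_pos_left h1 hstep
    rw [div_mul_cancel₀ _ hp0.ne'] at h2
    simp only [α]
    linarith
  have hα1 : ∀ i, α i ≤ 1 := fun i => sub_le_self _ (by positivity)
  set c := α ⟨p - q - 1, by omega⟩ with hc
  refine ⟨fun x => max (x - c) 0 ^ (q + 1), α, by fun_prop, ?_, hα,
    fun i => ⟨ham.trans (hαa i).le, hα1 i⟩, ?_⟩
  · intro i t ht hti
    rcases eq_or_ne i 0 with rfl | hi
    · simpa using divDiff_max_sub_zero_pow_nonneg c ht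
    · rw [divDiff_eq_zero, mul_zero]
      intro j
      have h1 : y i.castSucc ≤ a := hy.antitone (by
        have : (i : ℕ) ≠ 0 := fun h => hi (Fin.ext h)
        simp [Fin.le_def]
        omega)
      have h2 : t j - c ≤ 0 := by
        have := hαa ⟨p - q - 1, by omega⟩
        linarith [(hti j).2]
      simp [max_eq_right h2]
  · rintro n ⟨P, -, hP, hPα⟩
    have hlt : ∀ j : Fin (q + 1), p - q - 1 + (j : ℕ) < p := fun j => by omega
    have hP0 : P = 0 := by
      refine Polynomial.eq_zero_of_divDiff_nonneg hq (a := a) (b := 1)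
        (t := fun j => α ⟨p - q - 1 + (j : ℕ), hlt j⟩) (fun t ht hta => ?_) ?_
        (fun j => ⟨(hαa _).le, hα1 _⟩) fun j => ?_
      · have := hP 0 t ht (by simpa [hy0] using hta)
        simpa using this
      · intro i j hij
        have := congrArg Fin.val (hα.injective hij)
        exact Fin.ext (by simpa using this)
      · have h : α ⟨p - q - 1 + (j : ℕ), hlt j⟩ ≤ c := hα.antitone (by simp [Fin.le_def])
        rw [hPα]
        beta_reduce
        rw [max_eq_right (sub_nonpos.2 h), zero_pow (by omega)]
    have h1 := hPα ⟨0, by omega⟩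
    have h2 : c < α ⟨0, by omega⟩ := hα (by simp [Fin.lt_def]; omega)
    rw [hP0, Polynomial.eval_zero] at h1
    exact (pow_pos (lt_max_of_lt_left (sub_pos.2 h2)) (q + 1)).ne h1
end

section
/- Let k, p, s ∈ ℕ and let (r, m₁, m₂, m₃) belong to the set {(2j, 2j-1, 2j-2, 2j-1) : j ∈ ℕ} ∪ {(2j+1, 2j-1, 2j, 2j) : j ∈ ℕ₀}. Then there exists a constant c > 0 depending only on k, r, s, p, and for every Y_s ∈ 𝕐_s and A_p ∈ 𝔸_p with Y_s ∩ A_p = ∅ there exists N ∈ ℕ depending only on d(Y_s, A_p), such that for every f ∈ C^r and every n ≥ N there exists a polynomial P_n of degree ≤ n satisfying: (1) P_n - f ∈ Δ^(0)(Y_s) (i.e. {P_n, f admits P_n as an intertwining majorant with respect to Y_s}); (2) if m₁ ≥ 0 then P_n^(i)(α) = f^(i)(α) for all α ∈ A_p and 0 ≤ i ≤ m₁ (no condition if m₁ = -1); (3) P_n^(i)(y) = f^(i)(y) for all y ∈ Y_s and 0 ≤ i ≤ m₂; (4) P_n^(i)(±1) = f^(i)(±1) for 0 ≤ i ≤ m₃;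 and (5) |f(x) - P_n(x)| ≤ c ρ_n^r(x) ω_k(f^(r), ρ_n(x)) for all x ∈ I. -/
/-- The `k`-th modulus of smoothness of `g` with step bound `t` on `[a,b]`:
`ω_k(g,t;[a,b]) = sup { |Δ_h^k g (x)| : 0 < h ≤ t, x, x + k h ∈ [a,b] }`. -/
noncomputable def omegaK (g : ℝ → ℝ) (k : ℕ) (t a b : ℝ) : ℝ :=
  sSup {v : ℝ | ∃ h x : ℝ, 0 < h ∧ h ≤ t ∧ a ≤ x ∧ x + (k : ℝ) * h ≤ b ∧
    v = |∑ i ∈ Finset.range (k + 1),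
      (-1 : ℝ) ^ (k - i) * (k.choose i : ℝ) * g (x + (i : ℝ) * h)|}

/-- `ρ_n(x) = n⁻¹ √(1 - x²) + n⁻²`. -/
noncomputable def rho (n : ℕ) (x : ℝ) : ℝ :=
  Real.sqrt (1 - x ^ 2) / n + 1 / (n : ℝ) ^ 2

/-- The smallest positive distance between two distinct points of `S`. -/
noncomputable def minGap (S : Set ℝ) : ℝ :=
  sInf {d : ℝ | ∃ u ∈ S, ∃ v ∈ S, u ≠ v ∧ d = |u - v|}

/-- `g ∈ Δ^(0)(Y_s)`, where `Y_s` is encoded by the extended decreasing sequence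
`y : Fin (s+2) → ℝ` with `y 0 = 1`, `y (s+1) = -1`:
`(-1)^i g ≥ 0` on `[y (i+1), y i]` for `0 ≤ i ≤ s`. -/
def Delta0 {s : ℕ} (y : Fin (s + 2) → ℝ) (g : ℝ → ℝ) : Prop :=
  ∀ i : Fin (s + 1), ∀ x ∈ Set.Icc (y i.succ) (y i.castSucc),
    0 ≤ (-1 : ℝ) ^ (i : ℕ) * g x

section

open Polynomial

/-- The `k`-th difference of `g` at `x` with signed step `v`. -/
noncomputable def stepDiff (g : ℝ → ℝ) (k : ℕ) (v x : ℝ) : ℝ :=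
  ∑ i ∈ Finset.range (k + 1), (-1 : ℝ) ^ (k - i) * (k.choose i : ℝ) * g (x + (i : ℝ) * v)

theorem stepDiff_eq_fwdDiff_iter (g : ℝ → ℝ) (k : ℕ) (v x : ℝ) :
    stepDiff g k v x = (fwdDiff v)^[k] g x := by
  rw [fwdDiff_iter_eq_sum_shift, stepDiff]
  refine Finset.sum_congr rfl fun i _ => ?_
  simp [nsmul_eq_mul]

theorem stepDiff_sub (f g : ℝ → ℝ) (k : ℕ) (v x : ℝ) :
    stepDiff (fun z => f z - g z) k v x = stepDiff f k v x - stepDiff g k v x := by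
  simp only [stepDiff, ← Finset.sum_sub_distrib]
  exact Finset.sum_congr rfl fun i _ => by ring

theorem stepDiff_neg (g : ℝ → ℝ) (k : ℕ) (v x : ℝ) :
    stepDiff g k (-v) x = (-1) ^ k * stepDiff g k v (x - k * v) := by
  unfold stepDiff
  rw [← Finset.sum_range_reflect, Finset.mul_sum]
  refine Finset.sum_congr rfl fun i hi => ?_
  have hi' : i ≤ k := by simpa [Nat.lt_succ_iff] using hi
  have h1 : k + 1 - 1 - i = k - i := by omega
  rw [h1, Nat.choose_symm hi', Nat.sub_sub_self hi', Nat.cast_sub hi']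
  have h2 : (-1 : ℝ) ^ k * (-1) ^ (k - i) = (-1) ^ i := by
    obtain ⟨l, rfl⟩ := Nat.exists_eq_add_of_le hi'
    rw [Nat.add_sub_cancel_left, pow_add, mul_assoc, ← mul_pow]
    simp
  rw [← mul_assoc, ← mul_assoc, h2]
  congr 2
  ring

theorem abs_stepDiff_le {g : ℝ → ℝ} {k : ℕ} {v x M : ℝ}
    (h : ∀ i ≤ k, |g (x + (i : ℝ) * v)| ≤ M) : |stepDiff g k v x| ≤ 2 ^ k * M := by
  have h2 : (2 : ℝ) ^ k = ∑ i ∈ Finset.range (k + 1), (k.choose i : ℝ) := by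
    exact_mod_cast (Nat.sum_range_choose k).symm
  rw [h2, Finset.sum_mul]
  refine (Finset.abs_sum_le_sum_abs _ _).trans (Finset.sum_le_sum fun i hi => ?_)
  have hi' : i ≤ k := by simpa [Nat.lt_succ_iff] using hi
  rw [abs_mul, abs_mul, abs_pow, abs_neg, abs_one, one_pow, one_mul, Nat.abs_cast]
  exact mul_le_mul_of_nonneg_left (h i hi') (Nat.cast_nonneg _)

theorem stepDiff_polynomial {q : ℝ[X]} {k : ℕ} (hq : q.natDegree < k) (v x : ℝ) :
    stepDiff (fun z => q.eval z) k v x = 0 := by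
  have h := congrFun (Polynomial.fwdDiff_iter_eq_zero_of_degree_lt
    (P := q.comp (C x + C v * X)) (n := k) ?_) 0
  · rw [fwdDiff_iter_eq_sum_shift] at h
    simp only [Pi.zero_apply] at h
    rw [stepDiff, ← h]
    refine Finset.sum_congr rfl fun i _ => ?_
    simp only [eval_comp, eval_add, eval_C, eval_mul, eval_X, nsmul_eq_mul, zero_add, mul_one,
      zsmul_eq_mul, Int.cast_mul, Int.cast_pow, Int.cast_neg, Int.cast_one, Int.cast_natCast]
    rw [mul_comm v]
  · refine lt_of_le_of_lt natDegree_comp_le (lt_of_le_of_lt ?_ hq)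
    have : (C x + C v * X : ℝ[X]).natDegree ≤ 1 := by compute_degree
    nlinarith

theorem add_nat_mul_mem_Icc {x v : ℝ} {k i : ℕ} (hi : i ≤ k) (hx : x ∈ Set.Icc (-1 : ℝ) 1)
    (hxk : x + k * v ∈ Set.Icc (-1 : ℝ) 1) : x + i * v ∈ Set.Icc (-1 : ℝ) 1 := by
  have hik : (i : ℝ) ≤ k := by exact_mod_cast hi
  have hi0 : (0 : ℝ) ≤ i := Nat.cast_nonneg _
  obtain ⟨h1, h2⟩ := hx
  obtain ⟨h3, h4⟩ := hxk
  rcases le_total 0 v with hv | hv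
  · constructor <;> nlinarith
  · constructor <;> nlinarith

theorem bddAbove_omegaK {g : ℝ → ℝ} (hg : ContinuousOn g (Set.Icc (-1 : ℝ) 1))
    (k : ℕ) (t : ℝ) :
    BddAbove {v : ℝ | ∃ h x : ℝ, 0 < h ∧ h ≤ t ∧ -1 ≤ x ∧ x + (k : ℝ) * h ≤ 1 ∧
      v = |∑ i ∈ Finset.range (k + 1),
        (-1 : ℝ) ^ (k - i) * (k.choose i : ℝ) * g (x + (i : ℝ) * h)|} := by
  obtain ⟨M, hM⟩ := isCompact_Icc.exists_bound_of_continuousOn hg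
  refine ⟨2 ^ k * M, ?_⟩
  rintro _ ⟨h, x, hh, -, hx, hxk, rfl⟩
  have hk : (0 : ℝ) ≤ k * h := by positivity
  exact abs_stepDiff_le fun i hi => hM _ (add_nat_mul_mem_Icc hi ⟨hx, by linarith⟩
    ⟨by linarith, hxk⟩)

theorem abs_stepDiff_le_omegaK {g : ℝ → ℝ} (hg : ContinuousOn g (Set.Icc (-1 : ℝ) 1))
    {k : ℕ} {t v x : ℝ} (hv : v ≠ 0) (hvt : |v| ≤ t)
    (hx : x ∈ Set.Icc (-1 : ℝ) 1) (hxk : x + k * v ∈ Set.Icc (-1 : ℝ) 1) :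
    |stepDiff g k v x| ≤ omegaK g k t (-1) 1 := by
  have key : ∀ {v x : ℝ}, 0 < v → v ≤ t → -1 ≤ x → x + k * v ≤ 1 →
      |stepDiff g k v x| ≤ omegaK g k t (-1) 1 := fun {v x} h1 h2 h3 h4 =>
    le_csSup (bddAbove_omegaK hg k t) ⟨v, x, h1, h2, h3, h4, rfl⟩
  rcases lt_or_gt_of_ne hv with h | h
  · have e : stepDiff g k v x = (-1) ^ k * stepDiff g k (-v) (x + k * v) := by
      have := stepDiff_neg g k (-v) x
      rw [neg_neg] at this
      rw [this]
      congr 2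
      ring
    rw [e, abs_mul, abs_pow, abs_neg, abs_one, one_pow, one_mul]
    rw [abs_of_neg h] at hvt
    exact key (by linarith) hvt hxk.1 (by linarith [hx.2])
  · rw [abs_of_pos h] at hvt
    exact key h hvt hx.1 hxk.2

theorem omegaK_nonneg (g : ℝ → ℝ) (k : ℕ) (t : ℝ) : 0 ≤ omegaK g k t (-1) 1 := by
  refine Real.sSup_nonneg ?_
  rintro _ ⟨h, x, -, -, -, -, rfl⟩
  exact abs_nonneg _

theorem omegaK_le {g : ℝ → ℝ} {k : ℕ} {t B : ℝ} (hB : 0 ≤ B)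
    (h : ∀ v x : ℝ, 0 < v → v ≤ t → x ∈ Set.Icc (-1 : ℝ) 1 → x + k * v ∈ Set.Icc (-1 : ℝ) 1 →
      |stepDiff g k v x| ≤ B) : omegaK g k t (-1) 1 ≤ B := by
  refine Real.sSup_le ?_ hB
  rintro _ ⟨v, x, hv, hvt, hx, hxk, rfl⟩
  have hk : (0 : ℝ) ≤ k * v := by positivity
  exact h v x hv hvt ⟨hx, by linarith⟩ ⟨by linarith, hxk⟩

/-- A sequence with `k` leading zeros and bounded `k`-th differences grows polynomially. -/
theorem abs_le_of_fwdDiff_iter_le {w : ℝ} (hw : 0 ≤ w) (k : ℕ) : ∀ (u : ℕ → ℝ) (L : ℕ),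
    (∀ i < k, u i = 0) → (∀ i, i + k ≤ L → |(fwdDiff 1)^[k] u i| ≤ w) →
    ∀ i ≤ L, |u i| ≤ w * (1 + i) ^ k := by
  induction k with
  | zero =>
    intro u L _ h i hi
    simpa using h i hi
  | succ k ih =>
    intro u L h0 h i hi
    have hd : ∀ j, j + 1 ≤ L → |fwdDiff 1 u j| ≤ w * (1 + j) ^ k := by
      intro j hj
      refine ih (fwdDiff 1 u) (L - 1) (fun l hl => ?_) (fun l hl => ?_) j (by omega)
      · simp [fwdDiff, h0 (l + 1) (by omega), h0 l (by omega)]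
      · rw [← Function.iterate_succ_apply]
        exact h l (by omega)
    have hs : u i = ∑ j ∈ Finset.range i, fwdDiff 1 u j := by
      have := Finset.sum_range_sub u i
      simp only [fwdDiff]
      rw [this, h0 0 (by omega), sub_zero]
    have hb : |u i| ≤ ∑ j ∈ Finset.range i, w * (1 + (i : ℝ)) ^ k := by
      rw [hs]
      refine (Finset.abs_sum_le_sum_abs _ _).trans (Finset.sum_le_sum fun j hj => ?_)
      have hj' : j < i := Finset.mem_range.1 hj
      refine (hd j (by omega)).trans ?_
      have : (j : ℝ) ≤ i := by exact_mod_cast hj'.le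
      gcongr
    rw [Finset.sum_const, Finset.card_range, nsmul_eq_mul] at hb
    refine hb.trans ?_
    rw [pow_succ]
    have : 0 ≤ w * (1 + (i : ℝ)) ^ k := by positivity
    nlinarith

/-- Grid version of the previous bound. -/
theorem abs_grid_le {e : ℝ → ℝ} {w : ℝ} (hw : 0 ≤ w) {k : ℕ} {b v : ℝ} {L : ℕ}
    (hb : b ∈ Set.Icc (-1 : ℝ) 1) (hL : b + L * v ∈ Set.Icc (-1 : ℝ) 1)
    (h0 : ∀ i < k, e (b + (i : ℝ) * v) = 0)
    (h : ∀ x ∈ Set.Icc (-1 : ℝ) 1, x + k * v ∈ Set.Icc (-1 : ℝ) 1 → |stepDiff e k v x| ≤ w) :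
    |e (b + L * v)| ≤ w * (1 + L) ^ k := by
  refine abs_le_of_fwdDiff_iter_le hw k (fun i : ℕ => e (b + (i : ℝ) * v)) L h0 ?_ L le_rfl
  intro i hi
  have e1 : (fwdDiff 1)^[k] (fun i : ℕ => e (b + (i : ℝ) * v)) i =
      stepDiff e k v (b + i * v) := by
    rw [fwdDiff_iter_eq_sum_shift, stepDiff]
    refine Finset.sum_congr rfl fun j _ => ?_
    simp only [zsmul_eq_mul, Int.cast_mul, Int.cast_pow, Int.cast_neg, Int.cast_one,
      Int.cast_natCast, smul_eq_mul, mul_one, Nat.cast_add]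
    congr 2
    ring
  rw [e1]
  have h3 : b + (i : ℝ) * v + k * v = b + ((i + k : ℕ) : ℝ) * v := by push_cast; ring
  refine h _ (add_nat_mul_mem_Icc (by omega) hb hL) ?_
  rw [h3]
  exact add_nat_mul_mem_Icc hi hb hL

theorem abs_sub_le_of_stepDiff_le {e : ℝ → ℝ} (he : Continuous e) {k : ℕ} {s x z w S : ℝ}
    (hs : s ≠ 0) (hx : ∀ v ∈ Set.uIoc 0 s, |stepDiff e k v x| ≤ w)
    (hz : ∀ v ∈ Set.uIoc 0 s, |stepDiff e k v z| ≤ w)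
    (hS : ∀ i ≤ k, ∀ y ∈ Set.uIcc (x + (i : ℝ) * s) (z + (i : ℝ) * s), |e y| ≤ S) :
    |e x - e z| ≤ 2 * w + 2 ^ (k + 1) * (|x - z| / |s|) * S := by
  have hS0 : 0 ≤ S := (abs_nonneg _).trans (hS 0 (Nat.zero_le _) _ Set.left_mem_uIcc)
  have hsp : 0 < |s| := abs_pos.2 hs
  set c : ℕ → ℝ := fun i => (-1 : ℝ) ^ (k - i) * (k.choose i : ℝ) with hc
  set I : ℕ → ℝ := fun i => ∫ v in (0 : ℝ)..s, (e (x + (i : ℝ) * v) - e (z + (i : ℝ) * v)) with hI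
  have hinterv : ∀ (y : ℝ) (i : ℕ), IntervalIntegrable (fun v => e (y + (i : ℝ) * v))
      MeasureTheory.volume 0 s := fun y i =>
    (he.comp (by fun_prop)).intervalIntegrable _ _
  have hD : ∫ v in (0 : ℝ)..s, (stepDiff e k v x - stepDiff e k v z) =
      ∑ i ∈ Finset.range (k + 1), c i * I i := by
    simp only [stepDiff, ← Finset.sum_sub_distrib, ← mul_sub]
    rw [intervalIntegral.integral_finsetSum]
    · refine Finset.sum_congr rfl fun i _ => ?_
      rw [intervalIntegral.integral_const_mul]
    · intro i _
      exact ((hinterv x i).sub (hinterv z i)).const_mul _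
  have hDle : |∫ v in (0 : ℝ)..s, (stepDiff e k v x - stepDiff e k v z)| ≤ 2 * w * |s| := by
    have := intervalIntegral.norm_integral_le_of_norm_le_const (a := 0) (b := s) (C := 2 * w)
      (f := fun v => stepDiff e k v x - stepDiff e k v z) (fun v hv => by
        have h1 := hx v hv
        have h2 := hz v hv
        rw [Real.norm_eq_abs]
        exact (abs_sub _ _).trans (by linarith))
    simpa [Real.norm_eq_abs] using this
  have hI0 : I 0 = s * (e x - e z) := by simp [hI, mul_sub]
  have hIi : ∀ i ∈ Finset.range k, |c (i + 1) * I (i + 1)| ≤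
      (k.choose (i + 1) : ℝ) * (2 * S * |x - z|) := by
    intro i hi
    have hik : i + 1 ≤ k := by simpa using hi
    have hne : ((i + 1 : ℕ) : ℝ) ≠ 0 := by positivity
    have hb : ∀ j ≤ k, |∫ y in (x + (j : ℝ) * s)..(z + (j : ℝ) * s), e y| ≤ S * |x - z| := by
      intro j hj
      have := intervalIntegral.norm_integral_le_of_norm_le_const (a := x + (j : ℝ) * s)
        (b := z + (j : ℝ) * s) (C := S) (f := e)
        (fun v hv => hS j hj v (Set.uIoc_subset_uIcc hv))
      rw [Real.norm_eq_abs] at this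
      convert this using 2
      rw [abs_sub_comm]
      congr 1
      ring
    have hII : I (i + 1) = (((i + 1 : ℕ) : ℝ))⁻¹ * ((∫ y in x..z, e y) -
        ∫ y in (x + ((i + 1 : ℕ) : ℝ) * s)..(z + ((i + 1 : ℕ) : ℝ) * s), e y) := by
      simp only [hI]
      rw [intervalIntegral.integral_sub (hinterv x _) (hinterv z _),
        intervalIntegral.integral_comp_add_mul _ hne, intervalIntegral.integral_comp_add_mul _ hne,
        smul_eq_mul, smul_eq_mul, ← mul_sub, mul_zero, add_zero, add_zero]
      congr 1
      exact intervalIntegral.integral_interval_sub_interval_comm (he.intervalIntegrable _ _)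
        (he.intervalIntegrable _ _) (he.intervalIntegrable _ _)
    have hci : |c (i + 1)| = (k.choose (i + 1) : ℝ) := by
      simp [hc, abs_mul]
    rw [abs_mul, hci]
    refine mul_le_mul_of_nonneg_left ?_ (Nat.cast_nonneg _)
    rw [hII, abs_mul, abs_inv, Nat.abs_cast]
    have h1 : (((i + 1 : ℕ) : ℝ))⁻¹ ≤ 1 :=
      inv_le_one_of_one_le₀ (by exact_mod_cast Nat.le_add_left 1 i)
    have h2 := hb 0 (Nat.zero_le _)
    have h3 := hb (i + 1) hik
    simp only [Nat.cast_zero, zero_mul, add_zero] at h2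
    have h4 := (abs_sub (∫ y in x..z, e y)
      (∫ y in (x + ((i + 1 : ℕ) : ℝ) * s)..(z + ((i + 1 : ℕ) : ℝ) * s), e y)).trans
      (add_le_add h2 h3)
    calc _ ≤ 1 * (S * |x - z| + S * |x - z|) := by gcongr
      _ = _ := by ring
  have hsum : |∑ i ∈ Finset.range k, c (i + 1) * I (i + 1)| ≤ 2 ^ k * (2 * S * |x - z|) := by
    have h2 : ∑ i ∈ Finset.range k, (k.choose (i + 1) : ℝ) ≤ 2 ^ k := by
      have : ∑ i ∈ Finset.range (k + 1), (k.choose i : ℝ) = 2 ^ k := by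
        exact_mod_cast Nat.sum_range_choose k
      rw [Finset.sum_range_succ'] at this
      have h0 : (0 : ℝ) ≤ (k.choose 0 : ℝ) := Nat.cast_nonneg _
      linarith
    calc _ ≤ ∑ i ∈ Finset.range k, |c (i + 1) * I (i + 1)| := Finset.abs_sum_le_sum_abs _ _
      _ ≤ ∑ i ∈ Finset.range k, (k.choose (i + 1) : ℝ) * (2 * S * |x - z|) :=
          Finset.sum_le_sum hIi
      _ = (∑ i ∈ Finset.range k, (k.choose (i + 1) : ℝ)) * (2 * S * |x - z|) := by
          rw [Finset.sum_mul]
      _ ≤ _ := by gcongr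
  have hmain : |s| * |e x - e z| ≤ 2 * w * |s| + 2 ^ k * (2 * S * |x - z|) := by
    have h1 : c 0 * I 0 = (∫ v in (0 : ℝ)..s, (stepDiff e k v x - stepDiff e k v z)) -
        ∑ i ∈ Finset.range k, c (i + 1) * I (i + 1) := by
      rw [hD, Finset.sum_range_succ']
      ring
    have h2 : |c 0 * I 0| = |s| * |e x - e z| := by
      rw [hI0, ← abs_mul, abs_mul (c 0)]
      simp [hc]
    rw [← h2, h1]
    exact (abs_sub _ _).trans (add_le_add hDle hsum)
  have : |e x - e z| ≤ (2 * w * |s| + 2 ^ k * (2 * S * |x - z|)) / |s| := by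
    rw [le_div_iff₀ hsp]
    linarith
  refine this.trans (le_of_eq ?_)
  field_simp
  ring

/-- Interpolation of `G` at `k` equidistant nodes. -/
theorem exists_interpolating_polynomial (G : ℝ → ℝ) {k : ℕ} (hk : 1 ≤ k) (a : ℝ) {v : ℝ}
    (hv : v ≠ 0) : ∃ q : ℝ[X], q.natDegree < k ∧
      ∀ i < k, q.eval (a + (i : ℝ) * v) = G (a + (i : ℝ) * v) := by
  set node : ℕ → ℝ := fun i => a + (i : ℝ) * v with hnode
  have hinj : Set.InjOn node (Finset.range k) := by
    intro i _ j _ h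
    simpa [hnode, hv] using h
  refine ⟨Lagrange.interpolate (Finset.range k) node (fun i => G (node i)), ?_, fun i hi => ?_⟩
  · have := Lagrange.degree_interpolate_lt (fun i => G (node i)) hinj
    rw [Finset.card_range] at this
    by_cases h0 : Lagrange.interpolate (Finset.range k) node (fun i => G (node i)) = 0
    · rw [h0, natDegree_zero]
      omega
    · exact (natDegree_lt_iff_degree_lt h0).2 this
  · exact Lagrange.eval_interpolate_at_node (fun i => G (node i)) hinj (Finset.mem_range.2 hi)

theorem stepDiff_congr {f g : ℝ → ℝ} {k : ℕ} {v x : ℝ} (hfg : Set.EqOn f g (Set.Icc (-1) 1))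
    (hx : x ∈ Set.Icc (-1 : ℝ) 1) (hxk : x + k * v ∈ Set.Icc (-1 : ℝ) 1) :
    stepDiff f k v x = stepDiff g k v x := by
  refine Finset.sum_congr rfl fun i hi => ?_
  rw [hfg (add_nat_mul_mem_Icc (by simpa [Nat.lt_succ_iff] using hi) hx hxk)]

theorem exists_near_grid_point {e : ℝ → ℝ} {w : ℝ} (hw : 0 ≤ w) {k : ℕ} {b v x : ℝ}
    (hb : b ∈ Set.Icc (-1 : ℝ) 1) (hx : x ∈ Set.Icc (-1 : ℝ) 1) (hv : v ≠ 0)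
    (hxv : 0 ≤ (x - b) / v) (h0 : ∀ i < k, e (b + (i : ℝ) * v) = 0)
    (h : ∀ y ∈ Set.Icc (-1 : ℝ) 1, y + k * v ∈ Set.Icc (-1 : ℝ) 1 → |stepDiff e k v y| ≤ w) :
    ∃ z ∈ Set.Icc (-1 : ℝ) 1, |x - z| ≤ |v| ∧ |e z| ≤ w * (1 + |x - b| / |v|) ^ k := by
  set t := (x - b) / v with ht
  have hxt : x = b + t * v := by rw [ht]; field_simp; ring
  have hL1 := Nat.floor_le hxv
  have hL2 := Nat.lt_floor_add_one t
  have hL0 : (0 : ℝ) ≤ (⌊t⌋₊ : ℝ) := Nat.cast_nonneg _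
  have hz : b + (⌊t⌋₊ : ℝ) * v ∈ Set.Icc (-1 : ℝ) 1 := by
    obtain ⟨h1, h2⟩ := hb
    rw [hxt] at hx
    obtain ⟨h3, h4⟩ := hx
    rcases le_total 0 v with hv | hv <;> constructor <;> nlinarith
  refine ⟨b + (⌊t⌋₊ : ℝ) * v, hz, ?_, ?_⟩
  · have : x - (b + (⌊t⌋₊ : ℝ) * v) = (t - ⌊t⌋₊) * v := by rw [hxt]; ring
    rw [this, abs_mul]
    have h5 : |t - ⌊t⌋₊| ≤ 1 := by rw [abs_le]; constructor <;> linarith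
    nlinarith [abs_nonneg v]
  · refine (abs_grid_le hw hb hz h0 h).trans ?_
    have : |x - b| / |v| = t := by rw [← abs_div, abs_of_nonneg hxv]
    rw [this]
    gcongr

theorem stepDiff_zero_step {k : ℕ} (hk : 1 ≤ k) (e : ℝ → ℝ) (y : ℝ) : stepDiff e k 0 y = 0 := by
  obtain ⟨l, rfl⟩ := Nat.exists_eq_add_of_le' hk
  have h6 : ∀ l, (fwdDiff (0 : ℝ))^[l] (fun _ : ℝ => (0 : ℝ)) = fun _ => 0 := by
    intro l
    induction l with
    | zero => rfl
    | succ l ih => rw [Function.iterate_succ_apply, fwdDiff_const, ih]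
  have h5 : fwdDiff 0 e = fun _ => 0 := by ext; simp [fwdDiff]
  rw [stepDiff_eq_fwdDiff_iter, Function.iterate_succ_apply, h5, h6]

/-- Polynomial growth on a sufficiently fine grid propagates to the whole interval. -/
theorem abs_le_of_grid_bound {k N : ℕ} (hk : 1 ≤ k) (hN : N = 2 ^ (k + 2) * (k + 2) ^ k)
    {e : ℝ → ℝ} (hec : Continuous e) {a h w K : ℝ} (ha : a ∈ Set.Icc (-1 : ℝ) 1) (hh : 0 < h)
    (hkh : (k + 1) * h ≤ 1 / 4) (hw0 : 0 ≤ w) (_hK : 0 ≤ K)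
    (hdiff : ∀ v x : ℝ, v ≠ 0 → |v| ≤ h → x ∈ Set.Icc (-1 : ℝ) 1 →
      x + k * v ∈ Set.Icc (-1 : ℝ) 1 → |stepDiff e k v x| ≤ w)
    (hgrid : ∀ x ∈ Set.Icc (-1 : ℝ) 1, ∃ z ∈ Set.Icc (-1 : ℝ) 1, |x - z| ≤ h / N ∧
      |e z| ≤ w * (K * (1 + |x - a| / h)) ^ k) :
    ∀ x ∈ Set.Icc (-1 : ℝ) 1, |e x| ≤ 2 * (K ^ k + 2) * (1 + |x - a| / h) ^ k * w := by
  have hN1 : (1 : ℝ) ≤ N := by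
    rw [hN]
    exact_mod_cast Nat.one_le_iff_ne_zero.2 (by positivity)
  have hk1 : (1 : ℝ) ≤ k := by exact_mod_cast hk
  have hkh' : (k : ℝ) * h ≤ 1 / 4 := by nlinarith
  have hh4 : h ≤ 1 / 4 := by nlinarith
  set η := h / N with hη
  have hη0 : 0 < η := by positivity
  have hηh : η ≤ h := div_le_self hh.le hN1
  set A : ℝ → ℝ := fun x => (1 + |x - a| / h) ^ k with hA
  have hApos : ∀ x, 0 < A x := fun x => by positivity
  have hA1 : ∀ x, 1 ≤ A x := fun x => one_le_pow₀ (by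
    have : 0 ≤ |x - a| / h := by positivity
    linarith)
  obtain ⟨x', hx', hmax⟩ := isCompact_Icc.exists_isMaxOn (s := Set.Icc (-1 : ℝ) 1)
    ⟨a, ha⟩ (f := fun x => |e x| / A x)
    (by
      have hAc : Continuous A := by simp only [hA]; fun_prop
      exact (hec.abs.div hAc fun x => (hApos x).ne').continuousOn)
  set M := |e x'| / A x' with hM
  have hM0 : 0 ≤ M := div_nonneg (abs_nonneg _) (hApos _).le
  have hMb : ∀ x ∈ Set.Icc (-1 : ℝ) 1, |e x| ≤ M * A x := fun x hx =>
    (div_le_iff₀ (hApos x)).1 (hmax hx)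
  have hMx : M * A x' = |e x'| := div_mul_cancel₀ _ (hApos x').ne'
  obtain ⟨z, hz, hxz, hez⟩ := hgrid x' hx'
  obtain ⟨s, hs, hsI⟩ : ∃ s : ℝ, |s| = h ∧ ∀ y : ℝ, y ∈ Set.Icc (-1 : ℝ) 1 → |x' - y| ≤ η →
      y + k * s ∈ Set.Icc (-1 : ℝ) 1 := by
    rcases le_total x' 0 with h0 | h0
    · refine ⟨h, abs_of_pos hh, fun y hy hxy => ?_⟩
      rw [abs_le] at hxy
      have : 0 ≤ (k : ℝ) * h := by positivity
      constructor <;> linarith [hy.1, hy.2]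
    · refine ⟨-h, by rw [abs_neg, abs_of_pos hh], fun y hy hxy => ?_⟩
      rw [abs_le] at hxy
      have : 0 ≤ (k : ℝ) * h := by positivity
      rw [mul_neg]
      constructor <;> linarith [hy.1, hy.2]
  have hs0 : s ≠ 0 := by rw [← abs_pos, hs]; exact hh
  have hsd : ∀ y : ℝ, y ∈ Set.Icc (-1 : ℝ) 1 → |x' - y| ≤ η → ∀ v ∈ Set.uIoc 0 s,
      |stepDiff e k v y| ≤ w := by
    intro y hy hxy v hv
    have h1 := hsI y hy hxy
    obtain ⟨hy1, hy2⟩ := hy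
    obtain ⟨h3, h4⟩ := h1
    rcases le_total 0 s with h0 | h0
    · rw [Set.uIoc_of_le h0] at hv
      rw [abs_of_nonneg h0] at hs
      refine hdiff v y hv.1.ne' (by rw [abs_of_pos hv.1]; linarith [hv.2]) ⟨hy1, hy2⟩ ⟨?_, ?_⟩
      · nlinarith [hv.1]
      · nlinarith [hv.2]
    · rw [Set.uIoc_of_ge h0] at hv
      have hv0 : v ≤ 0 := hv.2
      have hvs : s ≤ v := hv.1.le
      rw [abs_of_nonpos h0] at hs
      have hvne : v ≠ 0 ∨ v = 0 := (em (v = 0)).symm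
      rcases hvne with hvne | rfl
      · refine hdiff v y hvne (by rw [abs_of_nonpos hv0]; linarith) ⟨hy1, hy2⟩ ⟨?_, ?_⟩
        · nlinarith
        · nlinarith
      · rw [stepDiff_zero_step hk, abs_zero]
        exact hw0
  have hlip := abs_sub_le_of_stepDiff_le (S := M * ((k + 2) * (1 + |x' - a| / h)) ^ k) hec hs0
    (hsd x' hx' (by simpa using hη0.le)) (hsd z hz hxz) (by
      intro i hik y hy
      have hx'i := add_nat_mul_mem_Icc hik hx' (hsI x' hx' (by simpa using hη0.le))
      have hzi := add_nat_mul_mem_Icc hik hz (hsI z hz hxz)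
      have hyI : y ∈ Set.Icc (-1 : ℝ) 1 := (Set.uIcc_subset_Icc hx'i hzi) hy
      refine (hMb y hyI).trans ?_
      have h1 : |y - (x' + i * s)| ≤ η := by
        have := Set.abs_sub_left_of_mem_uIcc hy
        refine this.trans ?_
        rwa [show z + (i : ℝ) * s - (x' + i * s) = -(x' - z) by ring, abs_neg]
      have h2 : |y - a| ≤ |x' - a| + (k + 1) * h := by
        have e1 : y - a = (y - (x' + i * s)) + (x' - a) + i * s := by ring
        have e2 := abs_add_three (y - (x' + i * s)) (x' - a) (i * s)
        rw [← e1, abs_mul, Nat.abs_cast, hs] at e2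
        have e3 : (i : ℝ) * h ≤ k * h :=
          mul_le_mul_of_nonneg_right (by exact_mod_cast hik) hh.le
        linarith
      have h3 : 1 + |y - a| / h ≤ (k + 2) * (1 + |x' - a| / h) := by
        have h4 : |y - a| / h ≤ |x' - a| / h + (k + 1) := by
          rw [div_le_iff₀ hh]
          refine h2.trans (le_of_eq ?_)
          field_simp
        have h5 : 0 ≤ |x' - a| / h := by positivity
        nlinarith
      simp only [hA]
      gcongr)
  have hA' := hA1 x'
  have hfin : M ≤ 2 * (K ^ k + 2) * w := by
    have h1 : |e x'| ≤ |e z| + |e x' - e z| := by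
      have := abs_add_le (e z) (e x' - e z)
      simpa using this
    rw [mul_pow, show (1 + |x' - a| / h) ^ k = A x' from rfl] at hez hlip
    have h2 : (2 : ℝ) ^ (k + 1) * (|x' - z| / |s|) * (M * ((k + 2) ^ k * A x')) ≤
        M * A x' / 2 := by
      have h3 : |x' - z| / |s| ≤ 1 / N := by
        rw [hs, div_le_div_iff₀ hh (by positivity)]
        rw [hη, le_div_iff₀ (by positivity)] at hxz
        linarith
      have h4 : (2 : ℝ) ^ (k + 1) * (1 / N) * (M * ((k + 2) ^ k * A x')) = M * A x' / 2 := by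
        rw [hN]
        push_cast
        field_simp
        ring
      rw [← h4]
      have := (hApos x').le
      gcongr
    have h5 : M * A x' ≤ 2 * (K ^ k + 2) * w * A x' := by
      nlinarith
    exact le_of_mul_le_mul_right h5 (hApos x')
  intro x hx
  refine (hMb x hx).trans ?_
  calc M * A x ≤ 2 * (K ^ k + 2) * w * A x := by
        have := (hApos x).le
        gcongr
    _ = _ := by simp only [hA]; ring

/-- A Whitney type inequality with polynomial growth away from the base point. -/
theorem exists_polynomial_whitney {k : ℕ} (hk : 1 ≤ k) : ∃ C : ℝ, 0 < C ∧
    ∀ g : ℝ → ℝ, ContinuousOn g (Set.Icc (-1) 1) → ∀ a ∈ Set.Icc (-1 : ℝ) 1, ∀ h : ℝ,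
      0 < h → h ≤ 1 / (4 * (k + 1)) → ∃ q : ℝ[X], q.natDegree < k ∧
      ∀ x ∈ Set.Icc (-1 : ℝ) 1,
        |g x - q.eval x| ≤ C * (1 + |x - a| / h) ^ k * omegaK g k h (-1) 1 := by
  obtain ⟨N, hN⟩ : ∃ N : ℕ, N = 2 ^ (k + 2) * (k + 2) ^ k := ⟨_, rfl⟩
  have hN1 : (1 : ℝ) ≤ N := by
    rw [hN]
    exact_mod_cast Nat.one_le_iff_ne_zero.2 (by positivity)
  refine ⟨2 * ((N + k + 1 : ℝ) ^ k + 2), by positivity, ?_⟩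
  intro g hg a ha h hh hh0
  have hk1 : (1 : ℝ) ≤ k := by exact_mod_cast hk
  have hkh : (k + 1) * h ≤ 1 / 4 := by
    rw [le_div_iff₀ (by positivity)] at hh0
    nlinarith
  have hkh' : (k : ℝ) * h ≤ 1 / 4 := by nlinarith
  have hh4 : h ≤ 1 / 4 := by nlinarith
  set w := omegaK g k h (-1) 1 with hw
  have hw0 : 0 ≤ w := omegaK_nonneg g k h
  set η := h / N with hη
  have hη0 : 0 < η := by positivity
  have hηh : η ≤ h := div_le_self hh.le hN1
  obtain ⟨v₀, hv₀, hv₀a⟩ : ∃ v₀ : ℝ, |v₀| = η ∧ ∀ i : ℕ, i ≤ k →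
      a + (i : ℝ) * v₀ ∈ Set.Icc (-1 : ℝ) 1 := by
    have hi : ∀ i : ℕ, i ≤ k → (i : ℝ) * η ≤ 1 / 4 := fun i hi => by
      have : (i : ℝ) ≤ k := by exact_mod_cast hi
      nlinarith
    have hi0 : ∀ i : ℕ, 0 ≤ (i : ℝ) * η := fun i => by positivity
    obtain ⟨ha1, ha2⟩ := ha
    rcases le_total a 0 with h0 | h0
    · refine ⟨η, abs_of_pos hη0, fun i hik => ⟨?_, ?_⟩⟩ <;> linarith [hi i hik, hi0 i]
    · refine ⟨-η, by rw [abs_neg, abs_of_pos hη0], fun i hik => ⟨?_, ?_⟩⟩ <;>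
        rw [mul_neg] <;> linarith [hi i hik, hi0 i]
  have hv₀0 : v₀ ≠ 0 := by rw [← abs_pos, hv₀]; exact hη0
  set G : ℝ → ℝ := Set.IccExtend (by norm_num : (-1 : ℝ) ≤ 1) (Set.domRestrict (Set.Icc (-1) 1) g)
    with hG
  have hGc : Continuous G := (continuousOn_iff_continuous_domRestrict.1 hg).Icc_extend'
  have hGg : Set.EqOn G g (Set.Icc (-1) 1) := fun x hx => by
    rw [hG, Set.IccExtend_of_mem _ _ hx]
    rfl
  obtain ⟨q, hq, hqi⟩ := exists_interpolating_polynomial G hk a hv₀0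
  refine ⟨q, hq, ?_⟩
  set e : ℝ → ℝ := fun x => G x - q.eval x with he
  have hec : Continuous e := hGc.sub q.continuous
  have hdiff : ∀ v x : ℝ, v ≠ 0 → |v| ≤ h → x ∈ Set.Icc (-1 : ℝ) 1 →
      x + k * v ∈ Set.Icc (-1 : ℝ) 1 → |stepDiff e k v x| ≤ w := by
    intro v x hv hvh hx hxk
    rw [he, stepDiff_sub, stepDiff_polynomial hq, sub_zero, stepDiff_congr hGg hx hxk]
    exact abs_stepDiff_le_omegaK hg hv hvh hx hxk
  have hzero : ∀ i < k, e (a + (i : ℝ) * v₀) = 0 := fun i hi => by simp [he, hqi i hi]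
  have hgrid : ∀ x ∈ Set.Icc (-1 : ℝ) 1, ∃ z ∈ Set.Icc (-1 : ℝ) 1, |x - z| ≤ η ∧
      |e z| ≤ w * ((N + k + 1) * (1 + |x - a| / h)) ^ k := by
    intro x hx
    have hbound : ∀ b : ℝ, |x - b| ≤ |x - a| + k * η →
        1 + |x - b| / η ≤ (N + k + 1) * (1 + |x - a| / h) := by
      intro b hb
      have h1 : |x - b| / η ≤ N * (|x - a| / h) + k := by
        rw [div_le_iff₀ hη0]
        refine hb.trans (le_of_eq ?_)
        rw [hη]
        field_simp
      have h2 : 0 ≤ |x - a| / h := by positivity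
      nlinarith
    rcases le_total 0 ((x - a) / v₀) with hs | hs
    · obtain ⟨z, hz, hxz, hez⟩ := exists_near_grid_point hw0 ha hx hv₀0 hs hzero
        (fun y hy hyk => hdiff v₀ y hv₀0 (hv₀.trans_le hηh) hy hyk)
      rw [hv₀] at hxz hez
      refine ⟨z, hz, hxz, hez.trans ?_⟩
      have := hbound a (by linarith [mul_nonneg (Nat.cast_nonneg k) hη0.le])
      gcongr
    · have hkk : ((k - 1 : ℕ) : ℝ) = k - 1 := by rw [Nat.cast_sub hk, Nat.cast_one]
      obtain ⟨z, hz, hxz, hez⟩ := exists_near_grid_point (b := a + ((k - 1 : ℕ) : ℝ) * v₀)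
        (v := -v₀) hw0 (hv₀a (k - 1) (Nat.sub_le _ _)) hx (neg_ne_zero.2 hv₀0) (by
          have : (x - (a + ((k - 1 : ℕ) : ℝ) * v₀)) / -v₀ = -((x - a) / v₀) + (k - 1) := by
            rw [hkk]
            field_simp
            ring
          rw [this]
          linarith) (fun i hi => by
          have := hzero (k - 1 - i) (by omega)
          rw [Nat.cast_sub (by omega)] at this
          rw [← this]
          congr 1
          ring)
        (fun y hy hyk => hdiff (-v₀) y (neg_ne_zero.2 hv₀0)
          (by rw [abs_neg]; exact hv₀.trans_le hηh) hy hyk)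
      rw [abs_neg, hv₀] at hxz hez
      refine ⟨z, hz, hxz, hez.trans ?_⟩
      have := hbound (a + ((k - 1 : ℕ) : ℝ) * v₀) (by
        have h1 : x - (a + ((k - 1 : ℕ) : ℝ) * v₀) = (x - a) - ((k - 1 : ℕ) : ℝ) * v₀ := by ring
        rw [h1]
        refine (abs_sub _ _).trans ?_
        rw [abs_mul, hv₀, Nat.abs_cast, hkk]
        nlinarith)
      gcongr
  intro x hx
  rw [← hGg hx]
  exact abs_le_of_grid_bound hk hN hec ha hh hkh hw0 (by positivity) hdiff hgrid x hx

theorem omegaK_le_mul {k : ℕ} (hk : 1 ≤ k) : ∃ C : ℝ, 0 < C ∧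
    ∀ g : ℝ → ℝ, ContinuousOn g (Set.Icc (-1) 1) → ∀ h t l : ℝ,
      0 < h → h ≤ 1 / (4 * (k + 1)) → 1 ≤ l → t ≤ l * h →
      omegaK g k t (-1) 1 ≤ C * l ^ k * omegaK g k h (-1) 1 := by
  obtain ⟨C, hC, H⟩ := exists_polynomial_whitney hk
  refine ⟨2 ^ k * (C * (k + 1) ^ k), by positivity, ?_⟩
  intro g hg h t l hh hh0 hl ht
  have hw := omegaK_nonneg g k h
  refine omegaK_le (by positivity) fun v x hv hvt hx hxk => ?_
  obtain ⟨q, hq, hqg⟩ := H g hg x hx h hh hh0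
  have h1 : stepDiff g k v x = stepDiff (fun z => g z - q.eval z) k v x := by
    rw [stepDiff_sub, stepDiff_polynomial hq, sub_zero]
  rw [h1]
  refine (abs_stepDiff_le (M := C * ((k + 1) * l) ^ k * omegaK g k h (-1) 1)
    fun i hi => ?_).trans (le_of_eq (by rw [mul_pow]; ring))
  refine (hqg _ (add_nat_mul_mem_Icc hi hx hxk)).trans ?_
  have h2 : 1 + |x + i * v - x| / h ≤ (k + 1) * l := by
    have h3 : |x + i * v - x| / h ≤ k * l := by
      rw [add_sub_cancel_left, abs_mul, Nat.abs_cast, abs_of_pos hv, div_le_iff₀ hh, mul_assoc]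
      have : (i : ℝ) ≤ k := by exact_mod_cast hi
      have : v ≤ l * h := hvt.trans ht
      gcongr
    linarith
  gcongr

theorem exists_derivative_eq (q : ℝ[X]) :
    ∃ p : ℝ[X], derivative p = q ∧ p.natDegree ≤ q.natDegree + 1 := by
  refine ⟨∑ i ∈ Finset.range (q.natDegree + 1), C (q.coeff i / (i + 1)) * X ^ (i + 1), ?_, ?_⟩
  · conv_rhs => rw [q.as_sum_range_C_mul_X_pow]
    rw [derivative_sum]
    refine Finset.sum_congr rfl fun i _ => ?_
    rw [derivative_C_mul_X_pow, Nat.add_sub_cancel]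
    congr 2
    push_cast
    field_simp
  · refine natDegree_sum_le_of_forall_le _ _ fun i hi => ?_
    refine (natDegree_C_mul_X_pow_le _ _).trans ?_
    have := Finset.mem_range.1 hi
    omega

/-- Integrating an approximation of the `r`-th derivative `r` times from the point `a`. -/
theorem exists_polynomial_of_iteratedDerivWithin {a : ℝ} (ha : a ∈ Set.Icc (-1 : ℝ) 1) (q : ℝ[X])
    (r : ℕ) : ∀ f : ℝ → ℝ, ContDiffOn ℝ r f (Set.Icc (-1) 1) →
      ∃ L : ℝ[X], L.natDegree ≤ q.natDegree + r ∧ ∀ E : ℝ → ℝ, MonotoneOn E (Set.Ici 0) →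
        (∀ x ∈ Set.Icc (-1 : ℝ) 1,
          |iteratedDerivWithin r f (Set.Icc (-1) 1) x - q.eval x| ≤ E |x - a|) →
        ∀ x ∈ Set.Icc (-1 : ℝ) 1, |f x - L.eval x| ≤ |x - a| ^ r * E |x - a| := by
  induction r with
  | zero =>
    intro f _
    refine ⟨q, le_rfl, fun E _ h x hx => ?_⟩
    simpa using h x hx
  | succ r ih =>
    intro f hf
    have hu : UniqueDiffOn ℝ (Set.Icc (-1 : ℝ) 1) := uniqueDiffOn_Icc (by norm_num)
    have hf' : ContDiffOn ℝ r (derivWithin f (Set.Icc (-1) 1)) (Set.Icc (-1) 1) :=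
      hf.derivWithin hu (by norm_cast)
    have hd : DifferentiableOn ℝ f (Set.Icc (-1) 1) := hf.differentiableOn (by simp)
    obtain ⟨L', hL', H⟩ := ih _ hf'
    obtain ⟨p, hp, hpd⟩ := exists_derivative_eq L'
    refine ⟨p + C (f a - p.eval a), ?_, fun E hE h x hx => ?_⟩
    · rw [natDegree_add_C]
      omega
    · have hsub : Set.uIcc a x ⊆ Set.Icc (-1 : ℝ) 1 := Set.uIcc_subset_Icc ha hx
      have h1 := H E hE (fun y hy => by
        have := h y hy
        rwa [iteratedDerivWithin_succ'] at this)
      have hder : ∀ y ∈ Set.uIcc a x, HasDerivWithinAt (fun z => f z - p.eval z)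
          (derivWithin f (Set.Icc (-1) 1) y - L'.eval y) (Set.uIcc a x) y := by
        intro y hy
        refine ((hd y (hsub hy)).hasDerivWithinAt.mono hsub).sub ?_
        rw [← hp]
        exact (p.hasDerivAt y).hasDerivWithinAt
      have h2 := (convex_uIcc a x).norm_image_sub_le_of_norm_hasDerivWithin_le
        (C := |x - a| ^ r * E |x - a|) hder (fun y hy => by
          rw [Real.norm_eq_abs]
          refine (h1 y (hsub hy)).trans ?_
          have h3 : |y - a| ≤ |x - a| := Set.abs_sub_left_of_mem_uIcc hy
          have h4 : E |y - a| ≤ E |x - a| :=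
            hE (Set.mem_Ici.2 (abs_nonneg _)) (Set.mem_Ici.2 (abs_nonneg _)) h3
          have h5 : 0 ≤ E |y - a| := (abs_nonneg _).trans (h y (hsub hy))
          gcongr) Set.left_mem_uIcc Set.right_mem_uIcc
      rw [Real.norm_eq_abs, Real.norm_eq_abs] at h2
      rw [eval_add, eval_C]
      calc |f x - (p.eval x + (f a - p.eval a))| = |f x - p.eval x - (f a - p.eval a)| := by
            congr 1
            ring
        _ ≤ _ := h2
        _ = _ := by ring

/-- Local polynomial approximation, exact to order `r` at the base point. -/
theorem exists_local_polynomial {k : ℕ} (hk : 1 ≤ k) (r : ℕ) : ∃ C : ℝ, 0 < C ∧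
    ∀ f : ℝ → ℝ, ContDiffOn ℝ r f (Set.Icc (-1) 1) → ∀ a ∈ Set.Icc (-1 : ℝ) 1, ∀ h : ℝ,
      0 < h → h ≤ 1 / (4 * (k + 1)) → ∃ L : ℝ[X], L.natDegree ≤ k + r ∧
      ∀ x ∈ Set.Icc (-1 : ℝ) 1, |f x - L.eval x| ≤ |x - a| ^ r * (C * (1 + |x - a| / h) ^ k *
        omegaK (iteratedDerivWithin r f (Set.Icc (-1) 1)) k h (-1) 1) := by
  obtain ⟨C, hC, H⟩ := exists_polynomial_whitney hk
  refine ⟨C, hC, fun f hf a ha h hh hh0 => ?_⟩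
  have hu : UniqueDiffOn ℝ (Set.Icc (-1 : ℝ) 1) := uniqueDiffOn_Icc (by norm_num)
  obtain ⟨q, hq, hqb⟩ := H _ (hf.continuousOn_iteratedDerivWithin le_rfl hu) a ha h hh hh0
  obtain ⟨L, hL, hLb⟩ := exists_polynomial_of_iteratedDerivWithin ha q r f hf
  refine ⟨L, by omega, fun x hx => hLb (fun t => C * (1 + t / h) ^ k *
    omegaK (iteratedDerivWithin r f (Set.Icc (-1) 1)) k h (-1) 1) ?_ hqb x hx⟩
  intro s hs t ht hst
  have := omegaK_nonneg (iteratedDerivWithin r f (Set.Icc (-1) 1)) k h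
  have hs' : (0 : ℝ) ≤ s := hs
  simp only
  gcongr

/-- A `C^r` function that is `O(|x - a|^μ)` with `μ ≤ r` has vanishing derivatives of order
less than `μ` at `a`. -/
theorem iteratedDerivWithin_eq_zero_of_abs_le {r μ : ℕ} (hμ : μ ≤ r) {g : ℝ → ℝ}
    (hg : ContDiffOn ℝ r g (Set.Icc (-1) 1)) {a K : ℝ} (ha : a ∈ Set.Icc (-1 : ℝ) 1)
    (hK : ∀ x ∈ Set.Icc (-1 : ℝ) 1, |g x| ≤ K * |x - a| ^ μ) :
    ∀ i < μ, iteratedDerivWithin i g (Set.Icc (-1) 1) a = 0 := by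
  intro i
  induction i using Nat.strong_induction_on with
  | _ i ih =>
  intro hi
  set I := Set.Icc (-1 : ℝ) 1 with hI
  have ht := taylor_isLittleO (n := i) (convex_Icc (-1 : ℝ) 1) ha
    (hg.of_le (by exact_mod_cast (hi.le.trans hμ)))
  have hte : ∀ x, taylorWithinEval g i I a x =
      ((i.factorial : ℝ)⁻¹ * iteratedDerivWithin i g I a) * (x - a) ^ i := by
    intro x
    rw [taylor_within_apply, Finset.sum_range_succ, Finset.sum_eq_zero, zero_add]
    · simp only [smul_eq_mul]
      ring
    · intro j hj
      have hj' := Finset.mem_range.1 hj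
      rw [ih j hj' (hj'.trans hi), smul_zero]
  set c := (i.factorial : ℝ)⁻¹ * iteratedDerivWithin i g I a with hc
  have hgo : g =o[nhdsWithin a I] fun x => (x - a) ^ i := by
    have h1 : g =O[nhdsWithin a I] fun x => (x - a) ^ μ := by
      refine Asymptotics.IsBigO.of_bound K ?_
      filter_upwards [self_mem_nhdsWithin] with x hx
      simpa using hK x hx
    refine h1.trans_isLittleO ?_
    have h2 : (fun x : ℝ => x ^ μ) =o[nhds 0] fun x => x ^ i := Asymptotics.isLittleO_pow_pow hi
    have h3 : Filter.Tendsto (fun x : ℝ => x - a) (nhdsWithin a I) (nhds 0) := by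
      have : Filter.Tendsto (fun x : ℝ => x - a) (nhds a) (nhds (a - a)) :=
        (continuous_id.sub continuous_const).tendsto a
      rw [sub_self] at this
      exact this.mono_left nhdsWithin_le_nhds
    exact h2.comp_tendsto h3
  have hco : (fun x => c * (x - a) ^ i) =o[nhdsWithin a I] fun x => (x - a) ^ i := by
    have := hgo.sub ht
    refine this.congr_left fun x => ?_
    rw [hte]
    ring
  have hc0 : c = 0 := by
    by_contra hne
    have h1 := (Asymptotics.isLittleO_const_mul_left_iff hne).1 hco
    have h2 : ∀ᶠ x in nhdsWithin a I, (x - a) ^ i = 0 := by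
      have := (Asymptotics.isLittleO_irrefl' (l := nhdsWithin a I)
        (f' := fun x : ℝ => (x - a) ^ i)).mt (not_not.2 h1)
      rw [Filter.not_frequently] at this
      filter_upwards [this] with x hx
      simpa using hx
    have hacc : (nhdsWithin a (I \ {a})).NeBot := by
      rw [← mem_closure_iff_nhdsWithin_neBot]
      have h4 : a ∈ closure (Set.Ioo (-1 : ℝ) 1 \ {a}) := by
        have hd : Dense ({a}ᶜ : Set ℝ) := dense_compl_singleton a
        refine closure_minimal (hd.open_subset_closure_inter isOpen_Ioo) isClosed_closure ?_
        rw [closure_Ioo (by norm_num)]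
        exact ha
      exact closure_mono (Set.sdiff_subset_sdiff_left Set.Ioo_subset_Icc_self) h4
    have h3 : ∀ᶠ x in nhdsWithin a (I \ {a}), False := by
      filter_upwards [nhdsWithin_mono a Set.sdiff_subset h2, self_mem_nhdsWithin] with x hx hx'
      exact hx'.2 (by simpa [sub_eq_zero] using eq_zero_of_pow_eq_zero hx)
    exact hacc.ne (Filter.eventually_false_iff_eq_bot.1 h3)
  rw [hc] at hc0
  exact (mul_eq_zero.1 hc0).resolve_left (by positivity)

/-- Even trigonometric polynomials of degree at most `D` with nonnegative coefficients. -/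
inductive PosCosPoly (D : ℕ) : (ℝ → ℝ) → Prop
  | cos (l : ℕ) (hl : l ≤ D) : PosCosPoly D fun θ => Real.cos (l * θ)
  | zero : PosCosPoly D fun _ => 0
  | add {f g : ℝ → ℝ} (hf : PosCosPoly D f) (hg : PosCosPoly D g) :
      PosCosPoly D fun θ => f θ + g θ
  | smul {f : ℝ → ℝ} (c : ℝ) (hc : 0 ≤ c) (hf : PosCosPoly D f) : PosCosPoly D fun θ => c * f θ

namespace PosCosPoly

theorem one : PosCosPoly 0 fun _ => 1 := by
  simpa using PosCosPoly.cos (D := 0) 0 le_rfl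

theorem sum {ι : Type*} {D : ℕ} (s : Finset ι) (f : ι → ℝ → ℝ)
    (h : ∀ i ∈ s, PosCosPoly D (f i)) : PosCosPoly D fun θ => ∑ i ∈ s, f i θ := by
  classical
  induction s using Finset.induction_on with
  | empty => simpa using PosCosPoly.zero
  | insert a s ha ih =>
    simp only [Finset.sum_insert ha]
    exact (h a (Finset.mem_insert_self _ _)).add
      (ih fun i hi => h i (Finset.mem_insert_of_mem hi))

theorem cos_mul {D l : ℕ} (hl : l ≤ D) {D' : ℕ} {g : ℝ → ℝ} (hg : PosCosPoly D' g) :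
    PosCosPoly (D + D') fun θ => Real.cos (l * θ) * g θ := by
  induction hg with
  | cos j hj =>
    have h1 := (PosCosPoly.cos (D := D + D') (l + j) (by omega)).add
      (PosCosPoly.cos ((l : ℤ) - j).natAbs (by omega))
    have h2 := h1.smul (1 / 2) (by norm_num)
    refine (congrArg (PosCosPoly (D + D')) (funext fun θ => ?_)).mp h2
    have h3 : Real.cos ((((l : ℤ) - j).natAbs : ℝ) * θ) = Real.cos (l * θ - j * θ) := by
      rw [Nat.cast_natAbs, Int.cast_abs]
      push_cast
      rcases abs_choice ((l : ℝ) - j) with h | h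
      · rw [h, sub_mul]
      · rw [h, neg_mul, Real.cos_neg, sub_mul]
    rw [h3, Real.cos_sub]
    push_cast
    rw [add_mul, Real.cos_add]
    ring
  | zero => simpa using PosCosPoly.zero
  | add _ _ h1 h2 => simpa only [mul_add] using h1.add h2
  | smul c hc _ h1 => simpa only [mul_left_comm] using h1.smul c hc

theorem mul {D D' : ℕ} {f g : ℝ → ℝ} (hf : PosCosPoly D f) (hg : PosCosPoly D' g) :
    PosCosPoly (D + D') fun θ => f θ * g θ := by
  induction hf with
  | cos l hl => exact cos_mul hl hg
  | zero => simpa using PosCosPoly.zero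
  | add _ _ h1 h2 => simpa only [add_mul] using h1.add h2
  | smul c hc _ h1 => simpa only [mul_assoc] using h1.smul c hc

theorem pow {D : ℕ} {f : ℝ → ℝ} (hf : PosCosPoly D f) (b : ℕ) :
    PosCosPoly (b * D) fun θ => f θ ^ b := by
  induction b with
  | zero => simpa using one
  | succ b ih => simpa only [pow_succ, Nat.succ_mul] using ih.mul hf

variable {D : ℕ} {K : ℝ → ℝ}

theorem even (hK : PosCosPoly D K) (θ : ℝ) : K (-θ) = K θ := by
  induction hK with
  | cos l hl => simp
  | zero => rfl
  | add _ _ h1 h2 => simp only [h1, h2]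
  | smul c _ _ h => simp only [h]

theorem exists_polynomial (hK : PosCosPoly D K) :
    ∃ κ : ℝ → ℝ[X], (∀ u, (κ u).natDegree ≤ D) ∧
      ∀ u t, (κ u).eval (Real.cos t) = (K (t - u) + K (t + u)) / 2 := by
  induction hK with
  | cos l hl =>
    refine ⟨fun u => C (Real.cos (l * u)) * Chebyshev.T ℝ l, fun u => ?_, fun u t => ?_⟩
    · refine (natDegree_C_mul_le _ _).trans ?_
      rw [Chebyshev.natDegree_T]
      simpa using hl
    · have := Chebyshev.T_real_cos t l
      simp only [eval_mul, eval_C, this, mul_sub, mul_add, Real.cos_sub, Real.cos_add,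
        Int.cast_natCast]
      ring
  | zero => exact ⟨fun _ => 0, by simp, by simp⟩
  | add _ _ h1 h2 =>
    obtain ⟨κ, hκ, h1⟩ := h1
    obtain ⟨κ', hκ', h2⟩ := h2
    refine ⟨fun u => κ u + κ' u, fun u => (natDegree_add_le _ _).trans (max_le (hκ u) (hκ' u)),
      fun u t => ?_⟩
    rw [eval_add, h1, h2]
    ring
  | smul c _ _ h1 =>
    obtain ⟨κ, hκ, h1⟩ := h1
    refine ⟨fun u => C c * κ u, fun u => (natDegree_C_mul_le _ _).trans (hκ u), fun u t => ?_⟩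
    rw [eval_mul, eval_C, h1]
    ring

theorem abs_sub_le (hK : PosCosPoly D K) {t u B : ℝ}
    (hB : ∀ l ≤ D, |Real.cos (l * t) - Real.cos (l * u)| ≤ B) :
    |(K (t - u) + K (t + u)) / 2 - (K (u - u) + K (u + u)) / 2| ≤ K 0 * B := by
  induction hK with
  | cos l hl =>
    have h1 : (Real.cos (l * (t - u)) + Real.cos (l * (t + u))) / 2 -
        (Real.cos (l * (u - u)) + Real.cos (l * (u + u))) / 2 =
        Real.cos (l * u) * (Real.cos (l * t) - Real.cos (l * u)) := by
      simp only [mul_sub, mul_add, Real.cos_sub, Real.cos_add]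
      ring
    simp only [h1, abs_mul, mul_zero, Real.cos_zero]
    exact mul_le_mul (Real.abs_cos_le_one _) (hB l hl) (abs_nonneg _) zero_le_one
  | zero => simp
  | @add f g _ _ h1 h2 =>
    refine le_trans (le_of_eq ?_) ((abs_add_le _ _).trans ((add_le_add h1 h2).trans_eq ?_))
    · congr 1
      ring
    · ring
  | @smul f c hc _ h1 =>
    have h2 : (c * f (t - u) + c * f (t + u)) / 2 - (c * f (u - u) + c * f (u + u)) / 2 =
        c * ((f (t - u) + f (t + u)) / 2 - (f (u - u) + f (u + u)) / 2) := by ring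
    rw [h2, abs_mul, abs_of_nonneg hc, mul_assoc]
    exact mul_le_mul_of_nonneg_left h1 hc

end PosCosPoly

theorem sum_cos_equispaced {l M : ℕ} (hl : 0 < l) (hlM : l < M) (t : ℝ) :
    ∑ j ∈ Finset.range M, Real.cos (l * (t - 2 * Real.pi * j / M)) = 0 := by
  have hM : (M : ℝ) ≠ 0 := by exact_mod_cast (by omega : M ≠ 0)
  have hMc : (M : ℂ) ≠ 0 := by exact_mod_cast (by omega : M ≠ 0)
  set ζ : ℂ := Complex.exp (2 * Real.pi * Complex.I * (-(l : ℂ) / M)) with hζ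
  have hζM : ζ ^ M = 1 := by
    rw [hζ, ← Complex.exp_nat_mul]
    refine Complex.exp_eq_one_iff.2 ⟨-l, ?_⟩
    push_cast
    field_simp
  have hζ1 : ζ ≠ 1 := by
    intro h
    obtain ⟨n, hn⟩ := Complex.exp_eq_one_iff.1 h
    have hpi : (2 * Real.pi * Complex.I : ℂ) ≠ 0 := Complex.two_pi_I_ne_zero
    rw [mul_comm (n : ℂ)] at hn
    have h1 := mul_left_cancel₀ hpi hn
    rw [div_eq_iff hMc] at h1
    have h2 : -(l : ℤ) = n * M := by exact_mod_cast h1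
    have h3 : (M : ℤ) ∣ l := by
      rw [← dvd_neg]
      exact ⟨n, by rw [h2, mul_comm]⟩
    have := Nat.le_of_dvd hl (by exact_mod_cast h3)
    omega
  have hsum : ∑ j ∈ Finset.range M, ζ ^ j = 0 := by
    rw [geom_sum_eq hζ1, hζM, sub_self, zero_div]
  have : ∀ j : ℕ, Real.cos (l * (t - 2 * Real.pi * j / M)) =
      (Complex.exp (l * t * Complex.I) * ζ ^ j).re := by
    intro j
    rw [hζ, ← Complex.exp_nat_mul, ← Complex.exp_add, ← Complex.exp_ofReal_mul_I_re]
    congr 2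
    push_cast
    field_simp
    ring
  simp only [this]
  rw [← Complex.re_sum, ← Finset.mul_sum, hsum, mul_zero, Complex.zero_re]

theorem PosCosPoly.exists_sum_eq {D : ℕ} {K : ℝ → ℝ} (hK : PosCosPoly D K) {M : ℕ} (hM : D < M) :
    ∃ S : ℝ, ∀ t, ∑ j ∈ Finset.range M, K (t - 2 * Real.pi * j / M) = S := by
  induction hK with
  | cos l hl =>
    rcases Nat.eq_zero_or_pos l with rfl | h
    · exact ⟨M, fun t => by simp⟩
    · exact ⟨0, fun t => sum_cos_equispaced h (hl.trans_lt hM) t⟩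
  | zero => exact ⟨0, fun t => by simp⟩
  | add _ _ h1 h2 =>
    obtain ⟨S, h1⟩ := h1
    obtain ⟨S', h2⟩ := h2
    exact ⟨S + S', fun t => by rw [Finset.sum_add_distrib, h1, h2]⟩
  | smul c _ _ h1 =>
    obtain ⟨S, h1⟩ := h1
    exact ⟨c * S, fun t => by rw [← Finset.mul_sum, h1]⟩

/-- The Fejér kernel, normalized to have the value `1` at the origin. -/
noncomputable def fejer (m : ℕ) (θ : ℝ) : ℝ :=
  (1 / (m : ℝ) ^ 2) * ∑ i ∈ Finset.range m, ∑ j ∈ Finset.range m, Real.cos (((i : ℝ) - j) * θ)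

theorem fejer_eq (m : ℕ) (θ : ℝ) : fejer m θ =
    (1 / (m : ℝ) ^ 2) * ‖∑ i ∈ Finset.range m, Complex.exp (Complex.I * θ) ^ i‖ ^ 2 := by
  rw [fejer, ← Complex.normSq_eq_norm_sq, Complex.normSq_apply, Complex.re_sum, Complex.im_sum,
    Finset.sum_mul_sum, Finset.sum_mul_sum, ← Finset.sum_add_distrib]
  congr 1
  refine Finset.sum_congr rfl fun i _ => ?_
  rw [← Finset.sum_add_distrib]
  refine Finset.sum_congr rfl fun j _ => ?_
  have h : ∀ i : ℕ, Complex.exp (Complex.I * θ) ^ i = Complex.exp ((i * θ : ℝ) * Complex.I) := by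
    intro i
    rw [← Complex.exp_nat_mul]
    congr 1
    push_cast
    ring
  rw [h, h, Complex.exp_ofReal_mul_I_re, Complex.exp_ofReal_mul_I_re,
    Complex.exp_ofReal_mul_I_im, Complex.exp_ofReal_mul_I_im, sub_mul, Real.cos_sub]

theorem fejer_nonneg (m : ℕ) (θ : ℝ) : 0 ≤ fejer m θ := by
  rw [fejer_eq]
  positivity

theorem fejer_zero {m : ℕ} (hm : 1 ≤ m) : fejer m 0 = 1 := by
  have : (m : ℝ) ≠ 0 := by exact_mod_cast (by omega : m ≠ 0)
  simp only [fejer, mul_zero, Real.cos_zero, Finset.sum_const, Finset.card_range, nsmul_eq_mul,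
    mul_one]
  field_simp

theorem fejer_le_one {m : ℕ} (hm : 1 ≤ m) (θ : ℝ) : fejer m θ ≤ 1 := by
  rw [← fejer_zero hm, fejer, fejer]
  gcongr
  rw [mul_zero, Real.cos_zero]
  exact Real.cos_le_one _

theorem half_le_fejer {m : ℕ} (hm : 1 ≤ m) {θ : ℝ} (hθ : m * |θ| ≤ 1) : 1 / 2 ≤ fejer m θ := by
  have hm0 : (m : ℝ) ≠ 0 := by exact_mod_cast (by omega : m ≠ 0)
  have h1 : ∀ i ∈ Finset.range m, ∀ j ∈ Finset.range m,
      (1 / 2 : ℝ) ≤ Real.cos (((i : ℝ) - j) * θ) := by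
    intro i hi j hj
    refine le_trans ?_ (Real.one_sub_sq_div_two_le_cos)
    have hi' : (i : ℝ) ≤ m := by exact_mod_cast (Finset.mem_range.1 hi).le
    have hj' : (j : ℝ) ≤ m := by exact_mod_cast (Finset.mem_range.1 hj).le
    have h2 : |((i : ℝ) - j) * θ| ≤ 1 := by
      rw [abs_mul]
      refine le_trans ?_ hθ
      gcongr
      rw [abs_le]
      constructor <;> linarith [Nat.cast_nonneg (α := ℝ) i, Nat.cast_nonneg (α := ℝ) j]
    have h3 := (sq_le_one_iff_abs_le_one _).2 h2
    linarith
  have h2 := Finset.sum_le_sum fun i hi => Finset.sum_le_sum (h1 i hi)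
  rw [fejer]
  simp only [Finset.sum_const, Finset.card_range, nsmul_eq_mul] at h2
  calc (1 / 2 : ℝ) = 1 / (m : ℝ) ^ 2 * (m * (m * (1 / 2))) := by field_simp
    _ ≤ _ := mul_le_mul_of_nonneg_left h2 (by positivity)

theorem fejer_mul_sin_sq_le {m : ℕ} (hm : 1 ≤ m) (θ : ℝ) :
    (m : ℝ) ^ 2 * Real.sin (θ / 2) ^ 2 * fejer m θ ≤ 1 := by
  have hm0 : (m : ℝ) ≠ 0 := by exact_mod_cast (by omega : m ≠ 0)
  have h1 := Complex.norm_exp_I_mul_ofReal_sub_one θ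
  have h2 := congrArg norm (geom_sum_mul (Complex.exp (Complex.I * θ)) m)
  rw [norm_mul, h1] at h2
  have h3 : ‖Complex.exp (Complex.I * θ) ^ m - 1‖ ≤ 2 := by
    refine (norm_sub_le _ _).trans ?_
    rw [norm_pow, mul_comm, Complex.norm_exp_ofReal_mul_I]
    norm_num
  rw [← h2] at h3
  rw [fejer_eq]
  set N := ‖∑ i ∈ Finset.range m, Complex.exp (Complex.I * θ) ^ i‖
  have h4 : (m : ℝ) ^ 2 * Real.sin (θ / 2) ^ 2 * (1 / (m : ℝ) ^ 2 * N ^ 2) =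
      (N * ‖2 * Real.sin (θ / 2)‖ / 2) ^ 2 := by
    rw [div_pow, mul_pow, Real.norm_eq_abs, sq_abs]
    field_simp
  rw [h4]
  exact pow_le_one₀ (by positivity) (by linarith)

theorem fejer_posCosPoly (m : ℕ) : PosCosPoly (m - 1) (fejer m) := by
  refine PosCosPoly.smul _ (by positivity) (PosCosPoly.sum _ _ fun i hi =>
    PosCosPoly.sum _ _ fun j hj => ?_)
  have hi' := Finset.mem_range.1 hi
  have hj' := Finset.mem_range.1 hj
  refine (congrArg (PosCosPoly (m - 1)) (funext fun θ => ?_)).mp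
    (PosCosPoly.cos ((i : ℤ) - j).natAbs (by omega))
  rw [Nat.cast_natAbs, Int.cast_abs]
  push_cast
  rcases abs_choice ((i : ℝ) - j) with h | h
  · rw [h]
  · rw [h, neg_mul, Real.cos_neg]

theorem sum_fejer_equispaced {m M : ℕ} (hm : 1 ≤ m) (hM : m ≤ M) (t : ℝ) :
    ∑ j ∈ Finset.range M, fejer m (t - 2 * Real.pi * j / M) = M / m := by
  have hm0 : (m : ℝ) ≠ 0 := by exact_mod_cast (by omega : m ≠ 0)
  have key : ∀ i ∈ Finset.range m, ∀ j ∈ Finset.range m,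
      ∑ ν ∈ Finset.range M, Real.cos (((i : ℝ) - j) * (t - 2 * Real.pi * ν / M)) =
        if i = j then (M : ℝ) else 0 := by
    intro i hi j hj
    have hi' := Finset.mem_range.1 hi
    have hj' := Finset.mem_range.1 hj
    split_ifs with h
    · simp [h]
    · rw [← sum_cos_equispaced (l := ((i : ℤ) - j).natAbs) (by omega) (by omega : _ < M) t]
      refine Finset.sum_congr rfl fun ν _ => ?_
      rw [Nat.cast_natAbs, Int.cast_abs]
      push_cast
      rcases abs_choice ((i : ℝ) - j) with h | h
      · rw [h]
      · rw [h, neg_mul, Real.cos_neg]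
  simp only [fejer]
  rw [← Finset.mul_sum, Finset.sum_comm]
  have : ∀ i ∈ Finset.range m, ∑ ν ∈ Finset.range M, ∑ j ∈ Finset.range m,
      Real.cos (((i : ℝ) - j) * (t - 2 * Real.pi * ν / M)) = M := by
    intro i hi
    rw [Finset.sum_comm, Finset.sum_congr rfl (key i hi), Finset.sum_ite_eq, if_pos hi]
  rw [Finset.sum_congr rfl this]
  simp only [Finset.sum_const, Finset.card_range, nsmul_eq_mul]
  field_simp

/-- The weight `1 + m |arccos x - arccos a|`. -/
noncomputable def angleWeight (m : ℕ) (x a : ℝ) : ℝ :=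
  1 + m * |Real.arccos x - Real.arccos a|

theorem one_le_angleWeight (m : ℕ) (x a : ℝ) : 1 ≤ angleWeight m x a :=
  le_add_of_nonneg_right (by positivity)

theorem angleWeight_pos (m : ℕ) (x a : ℝ) : 0 < angleWeight m x a :=
  zero_lt_one.trans_le (one_le_angleWeight m x a)

theorem angleWeight_comm (m : ℕ) (x a : ℝ) : angleWeight m x a = angleWeight m a x := by
  rw [angleWeight, angleWeight, abs_sub_comm]

theorem rho_pos {m : ℕ} (hm : 1 ≤ m) (x : ℝ) : 0 < rho m x := by
  have : (0 : ℝ) < m := by exact_mod_cast hm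
  unfold rho
  positivity

theorem rho_le_two_div {m : ℕ} (hm : 1 ≤ m) (x : ℝ) : rho m x ≤ 2 / m := by
  have hm' : (1 : ℝ) ≤ m := by exact_mod_cast hm
  have h1 : √(1 - x ^ 2) ≤ 1 := Real.sqrt_le_one.2 (by nlinarith [sq_nonneg x])
  have h2 : 1 / (m : ℝ) ^ 2 ≤ 1 / m := by
    gcongr
    nlinarith
  calc rho m x ≤ 1 / m + 1 / m := by
        unfold rho
        gcongr
    _ = 2 / m := by ring

theorem rho_le_mul_angleWeight {m : ℕ} (hm : 1 ≤ m) (x a : ℝ) :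
    rho m x ≤ rho m a * angleWeight m x a := by
  have hm' : (0 : ℝ) < m := by exact_mod_cast hm
  simp only [rho, angleWeight, ← Real.sin_arccos]
  set t := Real.arccos x
  set τ := Real.arccos a
  have hs : 0 ≤ Real.sin τ := Real.sin_arccos a ▸ Real.sqrt_nonneg _
  have h1 : Real.sin t ≤ Real.sin τ + |t - τ| := by
    have := (abs_le.1 (Real.abs_sin_sub_sin_le t τ)).2
    linarith
  have h2 : 0 ≤ Real.sin τ / m * (m * |t - τ|) := by positivity
  calc Real.sin t / m + 1 / (m : ℝ) ^ 2
      ≤ (Real.sin τ + |t - τ|) / m + 1 / (m : ℝ) ^ 2 := by gcongr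
    _ = Real.sin τ / m + 1 / (m : ℝ) ^ 2 + 1 / (m : ℝ) ^ 2 * (m * |t - τ|) := by
        field_simp
        ring
    _ ≤ _ := by nlinarith

theorem abs_sub_le_mul_angleWeight_sq {m : ℕ} (hm : 1 ≤ m) {x a : ℝ}
    (hx : x ∈ Set.Icc (-1 : ℝ) 1) (ha : a ∈ Set.Icc (-1 : ℝ) 1) :
    |x - a| ≤ rho m a * angleWeight m x a ^ 2 := by
  have hm' : (0 : ℝ) < m := by exact_mod_cast hm
  have hxe := Real.cos_arccos hx.1 hx.2
  have hae := Real.cos_arccos ha.1 ha.2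
  rw [show |x - a| = |Real.cos (Real.arccos x) - Real.cos (Real.arccos a)| by rw [hxe, hae]]
  simp only [rho, angleWeight, ← Real.sin_arccos]
  set t := Real.arccos x
  set τ := Real.arccos a
  have hs : 0 ≤ Real.sin τ := Real.sin_arccos a ▸ Real.sqrt_nonneg _
  have h1 : |Real.sin ((t + τ) / 2)| ≤ Real.sin τ + |t - τ| := by
    have h2 := Real.abs_sin_sub_sin_le ((t + τ) / 2) τ
    have h3 : (t + τ) / 2 - τ = (t - τ) / 2 := by ring
    rw [h3, abs_div, abs_two] at h2
    have h4 := abs_add_le (Real.sin ((t + τ) / 2) - Real.sin τ) (Real.sin τ)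
    rw [sub_add_cancel, abs_of_nonneg hs] at h4
    linarith [abs_nonneg (t - τ)]
  have h2 : |Real.sin ((t - τ) / 2)| ≤ |t - τ| / 2 := by
    refine Real.abs_sin_le_abs.trans_eq ?_
    rw [abs_div, abs_two]
  rw [Real.cos_sub_cos, abs_mul, abs_mul, abs_neg, abs_two]
  set δ := |t - τ|
  have hδ : 0 ≤ δ := abs_nonneg _
  have h3 : 1 + m * δ ≤ (1 + m * δ) ^ 2 := by nlinarith [mul_nonneg hm'.le hδ]
  calc 2 * |Real.sin ((t + τ) / 2)| * |Real.sin ((t - τ) / 2)|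
      ≤ 2 * (Real.sin τ + δ) * (δ / 2) := by gcongr
    _ = Real.sin τ / m * (m * δ) + 1 / (m : ℝ) ^ 2 * (m * δ) ^ 2 := by
        field_simp
    _ ≤ Real.sin τ / m * (1 + m * δ) ^ 2 + 1 / (m : ℝ) ^ 2 * (1 + m * δ) ^ 2 := by
        gcongr
        · linarith
        · linarith
    _ = _ := by ring

theorem sin_sq_half_arccos_le {t : ℝ} (ht : 0 ≤ Real.sin t) (u : ℝ) :
    Real.sin ((t - Real.arccos (Real.cos u)) / 2) ^ 2 ≤ Real.sin ((t - u) / 2) ^ 2 := by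
  have h : ∀ θ, Real.sin (θ / 2) ^ 2 = (1 - Real.cos θ) / 2 := by
    intro θ
    rw [Real.sin_sq_eq_half_sub, mul_div_cancel₀ _ two_ne_zero]
    ring
  have h1 : Real.sin (Real.arccos (Real.cos u)) = |Real.sin u| := by
    rw [Real.sin_arccos, ← Real.sin_sq, Real.sqrt_sq_eq_abs]
  rw [h, h, Real.cos_sub, Real.cos_sub, Real.cos_arccos (Real.neg_one_le_cos u) (Real.cos_le_one u),
    h1]
  have := mul_le_mul_of_nonneg_left (le_abs_self (Real.sin u)) ht
  linarith

theorem abs_sub_arccos_le {t : ℝ} (ht : t ∈ Set.Icc 0 Real.pi) (u : ℝ) :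
    |t - Real.arccos (Real.cos u)| ≤ Real.pi * |Real.sin ((t - u) / 2)| := by
  have h0 := Real.arccos_nonneg (Real.cos u)
  have h1 := Real.arccos_le_pi (Real.cos u)
  have h2 := sq_le_sq.1
    (sin_sq_half_arccos_le (Real.sin_nonneg_of_mem_Icc ht) u)
  set τ := Real.arccos (Real.cos u)
  have h3 := Real.mul_abs_le_abs_sin (x := (t - τ) / 2) (by
    rw [abs_le]
    constructor <;> linarith [ht.1, ht.2])
  rw [abs_div, abs_two] at h3
  have hpi := Real.pi_pos
  calc |t - τ| = Real.pi * (2 / Real.pi * (|t - τ| / 2)) := by field_simp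
    _ ≤ _ := by
      gcongr
      linarith

theorem fejer_mul_angleWeight_le {m : ℕ} (hm : 1 ≤ m) {x : ℝ} (u : ℝ) :
    fejer m (Real.arccos x - u) * angleWeight m x (Real.cos u) ≤ 22 := by
  have h1 := abs_sub_arccos_le ⟨Real.arccos_nonneg x, Real.arccos_le_pi x⟩ u
  rw [angleWeight]
  set F := fejer m (Real.arccos x - u)
  have hF := fejer_nonneg m (Real.arccos x - u)
  have hF1 := fejer_le_one hm (Real.arccos x - u)
  have hs := fejer_mul_sin_sq_le hm (Real.arccos x - u)
  rw [← sq_abs (Real.sin _)] at hs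
  set σ := |Real.sin ((Real.arccos x - u) / 2)|
  have hσ : 0 ≤ σ := abs_nonneg _
  have hpi := Real.pi_lt_four
  have h2 : m * |Real.arccos x - Real.arccos (Real.cos u)| ≤ 4 * (m * σ) := by
    calc _ ≤ m * (Real.pi * σ) := by gcongr
      _ ≤ m * (4 * σ) := by gcongr
      _ = _ := by ring
  have h3 : m * |Real.arccos x - Real.arccos (Real.cos u)| ≤ 2 + 2 * (m * σ) ^ 2 := by
    nlinarith [sq_nonneg (m * σ - 1)]
  have h4 : F * (1 + m * |Real.arccos x - Real.arccos (Real.cos u)|) ≤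
      F * (1 + (2 + 2 * (m * σ) ^ 2)) := by
    apply mul_le_mul_of_nonneg_left _ hF
    linarith
  have h5 : F * (m * σ) ^ 2 ≤ 1 := by
    rw [mul_pow]
    linarith
  nlinarith

theorem fejer_pow_mul_angleWeight_le {m : ℕ} (hm : 1 ≤ m) {x : ℝ} (u : ℝ) (B : ℕ) :
    fejer m (Real.arccos x - u) ^ B * angleWeight m x (Real.cos u) ^ B ≤ 22 ^ B := by
  rw [← mul_pow]
  exact pow_le_pow_left₀ (mul_nonneg (fejer_nonneg _ _) (angleWeight_pos _ _ _).le)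
    (fejer_mul_angleWeight_le hm u) B

/-- A nonnegative, well-localized polynomial partition of unity. -/
theorem exists_kernel (B : ℕ) : ∃ C : ℝ, 0 < C ∧ ∃ E : ℕ, ∀ m : ℕ, 1 ≤ m →
    ∃ (M : ℕ) (a : ℕ → ℝ) (κ : ℕ → ℝ[X]), (∀ j, a j ∈ Set.Icc (-1 : ℝ) 1) ∧
      (∀ j, (κ j).natDegree ≤ E * m) ∧
      ∀ x ∈ Set.Icc (-1 : ℝ) 1, (∀ j, 0 ≤ (κ j).eval x) ∧
        ∑ j ∈ Finset.range M, (κ j).eval x = 1 ∧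
        ∑ j ∈ Finset.range M, (κ j).eval x * angleWeight m x (a j) ^ B ≤ C ∧
        ∃ j ∈ Finset.range M, 1 ≤ C * (κ j).eval x ∧ angleWeight m x (a j) ≤ C := by
  refine ⟨22 ^ B * 4 ^ (B + 3) * (B + 8), by positivity, B + 1, fun m hm => ?_⟩
  have hm' : (0 : ℝ) < m := by exact_mod_cast hm
  set M := (B + 8) * m with hM
  have hM0 : 1 ≤ M := by
    rw [hM]
    nlinarith
  have hM' : (0 : ℝ) < M := by exact_mod_cast hM0
  have hMm : (M : ℝ) / m = B + 8 := by
    rw [hM]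
    push_cast
    field_simp
  have hK := (fejer_posCosPoly m).pow (B + 1)
  obtain ⟨κ, hκd, hκ⟩ := hK.exists_polynomial
  obtain ⟨S, hS⟩ := hK.exists_sum_eq (M := M) (by
    rw [hM]
    exact Nat.mul_lt_mul_of_lt_of_le (by omega) (Nat.sub_le _ _) (by omega))
  have hS1 : 1 ≤ S := by
    rw [← hS 0]
    refine le_trans (le_of_eq ?_) (Finset.single_le_sum (f := fun j : ℕ =>
      fejer m (0 - 2 * Real.pi * j / M) ^ (B + 1)) (fun j _ => pow_nonneg (fejer_nonneg _ _) _)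
      (Finset.mem_range.2 hM0))
    simp [fejer_zero hm]
  have hSle : S ≤ B + 8 := by
    rw [← hS 0, ← hMm, ← sum_fejer_equispaced hm (by rw [hM]; nlinarith) 0]
    refine Finset.sum_le_sum fun j _ => ?_
    exact pow_le_of_le_one (fejer_nonneg _ _) (fejer_le_one hm _) (by omega)
  have hS0 : 0 < S := by linarith
  set u : ℕ → ℝ := fun j => 2 * Real.pi * j / M with hu
  have heval : ∀ x ∈ Set.Icc (-1 : ℝ) 1, ∀ j, (C S⁻¹ * κ (u j)).eval x =
      (fejer m (Real.arccos x - u j) ^ (B + 1) + fejer m (Real.arccos x + u j) ^ (B + 1)) / 2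
        / S := by
    intro x hx j
    have := hκ (u j) (Real.arccos x)
    rw [Real.cos_arccos hx.1 hx.2] at this
    rw [eval_mul, eval_C, this]
    field_simp
  have hplus : ∀ t : ℝ, ∀ j, fejer m (t + u j) = fejer m (-t - u j) := by
    intro t j
    rw [← (fejer_posCosPoly m).even]
    congr 1
    ring
  refine ⟨M, fun j => Real.cos (u j), fun j => C S⁻¹ * κ (u j),
    fun j => ⟨Real.neg_one_le_cos _, Real.cos_le_one _⟩,
    fun j => (natDegree_C_mul_le _ _).trans
      ((hκd _).trans (Nat.mul_le_mul_left _ (Nat.sub_le _ _))),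
    fun x hx => ⟨fun j => ?_, ?_, ?_, ?_⟩⟩
  · rw [heval x hx]
    have h1 := pow_nonneg (fejer_nonneg m (Real.arccos x - u j)) (B + 1)
    have h2 := pow_nonneg (fejer_nonneg m (Real.arccos x + u j)) (B + 1)
    positivity
  · simp only [heval x hx, hplus]
    rw [← Finset.sum_div, ← Finset.sum_div, Finset.sum_add_distrib, hS, hS]
    field_simp
    norm_num
  · simp only [heval x hx]
    have h1 : ∀ j, (fejer m (Real.arccos x - u j) ^ (B + 1) +
        fejer m (Real.arccos x + u j) ^ (B + 1)) / 2 / S * angleWeight m x (Real.cos (u j)) ^ B ≤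
        22 ^ B * ((fejer m (Real.arccos x - u j) + fejer m (-Real.arccos x - u j)) / 2) := by
      intro j
      have h2 := fejer_pow_mul_angleWeight_le hm (x := x) (u j) B
      have h3 := fejer_pow_mul_angleWeight_le hm (x := x) (-u j) B
      rw [Real.cos_neg, sub_neg_eq_add] at h3
      rw [← hplus]
      have h4 := mul_le_mul_of_nonneg_left h2 (fejer_nonneg m (Real.arccos x - u j))
      have h5 := mul_le_mul_of_nonneg_left h3 (fejer_nonneg m (Real.arccos x + u j))
      have h6 : 0 ≤ (fejer m (Real.arccos x - u j) ^ (B + 1) +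
        fejer m (Real.arccos x + u j) ^ (B + 1)) / 2 := by
        have h1 := pow_nonneg (fejer_nonneg m (Real.arccos x - u j)) (B + 1)
        have h2 := pow_nonneg (fejer_nonneg m (Real.arccos x + u j)) (B + 1)
        positivity
      have h7 := mul_le_mul_of_nonneg_right (div_le_self h6 hS1)
        (pow_nonneg (angleWeight_pos m x (Real.cos (u j))).le B)
      refine h7.trans (le_trans (le_of_eq ?_) (div_le_div_of_nonneg_right (add_le_add h4 h5)
        zero_le_two) |>.trans_eq ?_)
      · ring
      · ring
    refine (Finset.sum_le_sum fun j _ => h1 j).trans ?_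
    rw [← Finset.mul_sum, ← Finset.sum_div, Finset.sum_add_distrib,
      sum_fejer_equispaced hm (by rw [hM]; nlinarith),
      sum_fejer_equispaced hm (by rw [hM]; nlinarith), hMm, mul_assoc]
    have : (1 : ℝ) ≤ 4 ^ (B + 3) := one_le_pow₀ (by norm_num)
    gcongr
    nlinarith
  · have hpi := Real.pi_pos
    have hpi4 := Real.pi_lt_four
    have ht0 := Real.arccos_nonneg x
    have htpi := Real.arccos_le_pi x
    set t := Real.arccos x with ht
    set j := ⌊t * M / (2 * Real.pi)⌋₊ with hj
    have hj1 : (j : ℝ) ≤ t * M / (2 * Real.pi) := Nat.floor_le (by positivity)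
    have hj2 : t * M / (2 * Real.pi) < j + 1 := Nat.lt_floor_add_one _
    rw [le_div_iff₀ (by positivity)] at hj1
    rw [div_lt_iff₀ (by positivity)] at hj2
    have hjM : j < M := by
      have : (j : ℝ) < M := by nlinarith
      exact_mod_cast this
    have htu : m * |t - u j| ≤ 1 := by
      have h1 : t - u j = (t * M - j * (2 * Real.pi)) / M := by
        rw [hu]
        field_simp
      have h2 : |t - u j| ≤ 2 * Real.pi / M := by
        rw [h1, abs_div, abs_of_nonneg (by linarith), abs_of_pos hM']
        gcongr
        linarith
      have h3 : (8 : ℝ) * m ≤ M := by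
        rw [hM]
        push_cast
        nlinarith [Nat.cast_nonneg (α := ℝ) B]
      calc m * |t - u j| ≤ m * (2 * Real.pi / M) := by gcongr
        _ ≤ 1 := by
          rw [← mul_div_assoc, div_le_one hM']
          nlinarith
    have hbig : (1 : ℝ) ≤ 22 ^ B := one_le_pow₀ (by norm_num)
    have hB8 : (8 : ℝ) ≤ B + 8 := by linarith [Nat.cast_nonneg (α := ℝ) B]
    have h4B : (1 : ℝ) ≤ 4 ^ (B + 3) := one_le_pow₀ (by norm_num)
    refine ⟨j, Finset.mem_range.2 hjM, ?_, ?_⟩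
    · have hF := half_le_fejer hm htu
      rw [heval x hx]
      have h1 := pow_le_pow_left₀ (by norm_num) hF (B + 1)
      have h2 := pow_nonneg (fejer_nonneg m (t + u j)) (B + 1)
      have h3 : (1 / 2 : ℝ) ^ (B + 2) ≤
          (fejer m (t - u j) ^ (B + 1) + fejer m (t + u j) ^ (B + 1)) / 2 := by
        rw [pow_succ]
        linarith
      have h5 : (1 / 2 : ℝ) ^ (B + 2) / (B + 8) ≤
          (fejer m (t - u j) ^ (B + 1) + fejer m (t + u j) ^ (B + 1)) / 2 / S :=
        div_le_div₀ (le_trans (by positivity) h3) h3 hS0 hSle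
      calc (1 : ℝ) ≤ 1 * (2 : ℝ) ^ (B + 4) * (B + 8) * ((1 / 2 : ℝ) ^ (B + 2) / (B + 8)) := by
            rw [one_div, inv_pow, pow_add, pow_add]
            field_simp
            norm_num
        _ ≤ 22 ^ B * 4 ^ (B + 3) * (B + 8) * ((1 / 2 : ℝ) ^ (B + 2) / (B + 8)) := by
            gcongr
            calc (2 : ℝ) ^ (B + 4) = 2 ^ (B + 3) * 2 := by rw [pow_succ]
              _ ≤ 2 ^ (B + 3) * 2 ^ (B + 3) := by
                gcongr
                exact le_self_pow₀ (by norm_num) (by omega)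
              _ = 4 ^ (B + 3) := by
                rw [← mul_pow]
                norm_num
        _ ≤ _ := by gcongr
    · have h1 := abs_sub_arccos_le ⟨ht0, htpi⟩ (u j)
      have h2 : |Real.sin ((t - u j) / 2)| ≤ |t - u j| / 2 := by
        refine Real.abs_sin_le_abs.trans_eq ?_
        rw [abs_div, abs_two]
      have h3 : m * |t - Real.arccos (Real.cos (u j))| ≤ 2 := by
        calc _ ≤ m * (4 * (|t - u j| / 2)) := by
              gcongr
              refine h1.trans ?_
              gcongr
          _ ≤ 2 := by linarith
      rw [angleWeight, ← ht]
      have : (8 : ℝ) ≤ 22 ^ B * 4 ^ (B + 3) * (B + 8) := by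
        calc (8 : ℝ) = 1 * 1 * 8 := by norm_num
          _ ≤ _ := by gcongr
      linarith

theorem abs_sin_natCast_mul_le (l : ℕ) (θ : ℝ) : |Real.sin (l * θ)| ≤ l * |Real.sin θ| := by
  induction l with
  | zero => simp
  | succ l ih =>
    push_cast
    rw [add_mul, one_mul, Real.sin_add]
    refine (abs_add_le _ _).trans ?_
    rw [abs_mul, abs_mul, add_mul, one_mul]
    refine add_le_add ((mul_le_of_le_one_right (abs_nonneg _) (Real.abs_cos_le_one _)).trans ih) ?_
    exact mul_le_of_le_one_left (abs_nonneg _) (Real.abs_cos_le_one _)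

theorem abs_cos_mul_sub_cos_mul_le {m B l : ℕ} (hm : 1 ≤ m) (hl : l ≤ B * m) {x a : ℝ}
    (hx : x ∈ Set.Icc (-1 : ℝ) 1) (ha : a ∈ Set.Icc (-1 : ℝ) 1) :
    |Real.cos (l * Real.arccos x) - Real.cos (l * Real.arccos a)| ≤
      (2 * B + B ^ 2) * (|x - a| / rho m x) := by
  have hm' : (0 : ℝ) < m := by exact_mod_cast hm
  have hl' : (l : ℝ) ≤ B * m := by exact_mod_cast hl
  rw [← mul_div_assoc, le_div_iff₀ (rho_pos hm x)]
  have hxe := Real.cos_arccos hx.1 hx.2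
  have hae := Real.cos_arccos ha.1 ha.2
  rw [show |x - a| = |Real.cos (Real.arccos x) - Real.cos (Real.arccos a)| by rw [hxe, hae],
    rho, ← Real.sin_arccos]
  have ht := Real.arccos_nonneg x
  have htpi := Real.arccos_le_pi x
  have hτ := Real.arccos_nonneg a
  have hτpi := Real.arccos_le_pi a
  set t := Real.arccos x
  set τ := Real.arccos a
  have hst : 0 ≤ Real.sin t := Real.sin_nonneg_of_mem_Icc ⟨ht, htpi⟩
  have hsin := abs_sin_natCast_mul_le l
  have hsum : Real.sin t ≤ 2 * |Real.sin ((t + τ) / 2)| := by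
    have h1 : Real.sin t = Real.sin ((t + τ) / 2) * Real.cos ((t - τ) / 2) +
        Real.cos ((t + τ) / 2) * Real.sin ((t - τ) / 2) := by
      rw [← Real.sin_add]
      congr 1
      ring
    have h2 : |Real.sin ((t - τ) / 2)| ≤ |Real.sin ((t + τ) / 2)| := by
      refine sq_le_sq.1 ?_
      rw [Real.sin_sq_eq_half_sub, Real.sin_sq_eq_half_sub, mul_div_cancel₀ _ two_ne_zero,
        mul_div_cancel₀ _ two_ne_zero, Real.cos_sub, Real.cos_add]
      linarith [mul_nonneg hst (Real.sin_nonneg_of_mem_Icc ⟨hτ, hτpi⟩)]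
    calc Real.sin t ≤ |Real.sin t| := le_abs_self _
      _ ≤ |Real.sin ((t + τ) / 2)| * |Real.cos ((t - τ) / 2)| +
          |Real.cos ((t + τ) / 2)| * |Real.sin ((t - τ) / 2)| := by
        rw [h1, ← abs_mul, ← abs_mul]
        exact abs_add_le _ _
      _ ≤ |Real.sin ((t + τ) / 2)| * 1 + 1 * |Real.sin ((t + τ) / 2)| := by
        gcongr
        · exact Real.abs_cos_le_one _
        · exact Real.abs_cos_le_one _
      _ = _ := by ring
  rw [Real.cos_sub_cos, Real.cos_sub_cos, ← mul_add, ← mul_sub, mul_div_assoc, mul_div_assoc]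
  simp only [abs_mul, abs_neg, abs_two]
  set p := |Real.sin ((t + τ) / 2)|
  set q := |Real.sin ((t - τ) / 2)|
  set p' := |Real.sin (l * ((t + τ) / 2))|
  set q' := |Real.sin (l * ((t - τ) / 2))|
  have hp : 0 ≤ p := abs_nonneg _
  have hq : 0 ≤ q := abs_nonneg _
  have hp'1 : p' ≤ 1 := Real.abs_sin_le_one _
  have hp' : p' ≤ B * m * p := (hsin _).trans (by gcongr)
  have hq' : q' ≤ B * m * q := (hsin _).trans (by gcongr)
  have h1 : 2 * p' * q' * (Real.sin t / m) ≤ 2 * 1 * (B * m * q) * (2 * p / m) := by gcongr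
  have h2 : 2 * p' * q' * (1 / (m : ℝ) ^ 2) ≤
      2 * (B * m * p) * (B * m * q) * (1 / (m : ℝ) ^ 2) := by gcongr
  calc _ ≤ 2 * 1 * (B * m * q) * (2 * p / m) +
        2 * (B * m * p) * (B * m * q) * (1 / (m : ℝ) ^ 2) := by linarith
    _ = _ := by
      field_simp

/-- Localized polynomial bumps. -/
theorem exists_bump (B : ℕ) : ∃ c : ℝ, 0 < c ∧ ∀ m : ℕ, 1 ≤ m → ∀ a ∈ Set.Icc (-1 : ℝ) 1,
    ∃ D : ℝ[X], D.natDegree ≤ B * m ∧ D.eval a = 1 ∧ ∀ x ∈ Set.Icc (-1 : ℝ) 1,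
      |D.eval x| * angleWeight m x a ^ B ≤ c ∧ |1 - D.eval x| ≤ c * (|x - a| / rho m x) := by
  refine ⟨2 * 22 ^ B + 2 * (2 * B + B ^ 2), by positivity, fun m hm a ha => ?_⟩
  have hK := (fejer_posCosPoly m).pow B
  obtain ⟨κ, hκd, hκ⟩ := hK.exists_polynomial
  set u := Real.arccos a with hu
  have hcu : Real.cos u = a := Real.cos_arccos ha.1 ha.2
  have hκa := hκ u u
  rw [hcu, sub_self, fejer_zero hm, one_pow] at hκa
  have hκa2 : 1 / 2 ≤ (κ u).eval a := by
    rw [hκa]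
    linarith [pow_nonneg (fejer_nonneg m (u + u)) B]
  have hκ0 : 0 < (κ u).eval a := by linarith
  set s := (κ u).eval a with hs
  have hs2 : s⁻¹ ≤ 2 := by
    rw [inv_le_comm₀ hκ0 two_pos]
    linarith
  refine ⟨C s⁻¹ * κ u, (natDegree_C_mul_le _ _).trans ((hκd _).trans
    (Nat.mul_le_mul_left _ (Nat.sub_le _ _))), ?_, fun x hx => ⟨?_, ?_⟩⟩
  · rw [eval_mul, eval_C, inv_mul_cancel₀ hκ0.ne']
  · have h1 := hκ u (Real.arccos x)
    rw [Real.cos_arccos hx.1 hx.2] at h1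
    have h2 := fejer_pow_mul_angleWeight_le hm (x := x) u B
    have h3 := fejer_pow_mul_angleWeight_le hm (x := x) (-u) B
    rw [Real.cos_neg, sub_neg_eq_add] at h3
    rw [hcu] at h2 h3
    have h4 := pow_nonneg (fejer_nonneg m (Real.arccos x - u)) B
    have h5 := pow_nonneg (fejer_nonneg m (Real.arccos x + u)) B
    rw [eval_mul, eval_C, h1, abs_mul, abs_of_pos (inv_pos.2 hκ0), abs_of_nonneg (by positivity),
      mul_assoc]
    have h6 : (fejer m (Real.arccos x - u) ^ B + fejer m (Real.arccos x + u) ^ B) / 2 *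
        angleWeight m x a ^ B ≤ 22 ^ B := by linarith
    have h7 := (angleWeight_pos m x a).le
    calc _ ≤ 2 * (22 ^ B : ℝ) := by gcongr
      _ ≤ _ := le_add_of_nonneg_right (by positivity)
  · have h1 := hκ u (Real.arccos x)
    rw [Real.cos_arccos hx.1 hx.2] at h1
    have h2 := hκ u u
    rw [hcu] at h2
    have h3 := hK.abs_sub_le (t := Real.arccos x) (u := u)
      (B := (2 * B + B ^ 2) * (|x - a| / rho m x)) fun l hl =>
      abs_cos_mul_sub_cos_mul_le hm (hl.trans (Nat.mul_le_mul_left _ (Nat.sub_le _ _))) hx ha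
    rw [← h1, ← h2, ← hs, fejer_zero hm, one_pow, one_mul] at h3
    have h4 : 1 - (C s⁻¹ * κ u).eval x = -(s⁻¹ * ((κ u).eval x - s)) := by
      rw [eval_mul, eval_C, mul_sub, inv_mul_cancel₀ hκ0.ne']
      ring
    rw [h4, abs_neg, abs_mul, abs_of_pos (inv_pos.2 hκ0)]
    have hρ := rho_pos hm x
    calc _ ≤ 2 * ((2 * B + B ^ 2) * (|x - a| / rho m x)) := by gcongr
      _ = 2 * (2 * B + B ^ 2) * (|x - a| / rho m x) := by ring
      _ ≤ _ := by
        gcongr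
        exact le_add_of_nonneg_left (by positivity)

/-- The local approximation rate `ρ_m(x)^r ω_k(g, ρ_m(x))`. -/
noncomputable def rate (g : ℝ → ℝ) (k r m : ℕ) (x : ℝ) : ℝ :=
  rho m x ^ r * omegaK g k (rho m x) (-1) 1

theorem rate_nonneg (g : ℝ → ℝ) (k r : ℕ) {m : ℕ} (hm : 1 ≤ m) (x : ℝ) : 0 ≤ rate g k r m x :=
  mul_nonneg (pow_nonneg (rho_pos hm x).le _) (omegaK_nonneg _ _ _)

theorem rho_le_of_le {k m : ℕ} (hm : 8 * (k + 1) ≤ m) (x : ℝ) : rho m x ≤ 1 / (4 * (k + 1)) := by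
  have hm' : (8 : ℝ) * (k + 1) ≤ m := by exact_mod_cast hm
  have hm0 : (0 : ℝ) < m := lt_of_lt_of_le (by positivity) hm'
  refine (rho_le_two_div (by omega) x).trans ?_
  rw [div_le_div_iff₀ hm0 (by positivity)]
  linarith

theorem exists_omegaK_rho_le {k : ℕ} (hk : 1 ≤ k) : ∃ C : ℝ, 0 < C ∧
    ∀ g : ℝ → ℝ, ContinuousOn g (Set.Icc (-1) 1) → ∀ m : ℕ, 8 * (k + 1) ≤ m → ∀ x a : ℝ,
      omegaK g k (rho m a) (-1) 1 ≤ C * angleWeight m x a ^ k * omegaK g k (rho m x) (-1) 1 := by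
  obtain ⟨C, hC, H⟩ := omegaK_le_mul hk
  refine ⟨C, hC, fun g hg m hm x a => H g hg _ _ _ (rho_pos (by omega) x) (rho_le_of_le hm x)
    (one_le_angleWeight m x a) ?_⟩
  rw [angleWeight_comm, mul_comm]
  exact rho_le_mul_angleWeight (by omega) a x

theorem exists_rate_le {k : ℕ} (hk : 1 ≤ k) (r : ℕ) : ∃ C : ℝ, 0 < C ∧
    ∀ g : ℝ → ℝ, ContinuousOn g (Set.Icc (-1) 1) → ∀ m : ℕ, 8 * (k + 1) ≤ m → ∀ x a : ℝ,
      rate g k r m a ≤ C * angleWeight m x a ^ (k + r) * rate g k r m x := by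
  obtain ⟨C, hC, H⟩ := exists_omegaK_rho_le hk
  refine ⟨C, hC, fun g hg m hm x a => ?_⟩
  have h1 := rho_le_mul_angleWeight (m := m) (by omega) a x
  rw [angleWeight_comm] at h1
  have h2 := (rho_pos (m := m) (by omega) a).le
  have h3 := omegaK_nonneg g k (rho m a)
  have h4 := (rho_pos (m := m) (by omega) x).le
  have h5 := (angleWeight_pos m x a).le
  calc rate g k r m a ≤ (rho m x * angleWeight m x a) ^ r *
        (C * angleWeight m x a ^ k * omegaK g k (rho m x) (-1) 1) := by
        unfold rate
        gcongr
        exact H g hg m hm x a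
    _ = _ := by
      rw [rate, mul_pow, pow_add]
      ring

/-- The quantity `|x - a| / (|x - a| + ρ_m(x))`. -/
noncomputable def relDist (m : ℕ) (x a : ℝ) : ℝ :=
  |x - a| / (|x - a| + rho m x)

theorem relDist_nonneg {m : ℕ} (hm : 1 ≤ m) (x a : ℝ) : 0 ≤ relDist m x a :=
  div_nonneg (abs_nonneg _) (add_nonneg (abs_nonneg _) (rho_pos hm x).le)

theorem relDist_le_one {m : ℕ} (hm : 1 ≤ m) (x a : ℝ) : relDist m x a ≤ 1 :=
  div_le_one_of_le₀ (le_add_of_nonneg_right (rho_pos hm x).le)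
    (add_nonneg (abs_nonneg _) (rho_pos hm x).le)

theorem relDist_mul {m : ℕ} (hm : 1 ≤ m) (x a : ℝ) :
    relDist m x a * (|x - a| + rho m x) = |x - a| :=
  div_mul_cancel₀ _ (add_pos_of_nonneg_of_pos (abs_nonneg _) (rho_pos hm x)).ne'

theorem half_le_relDist {m : ℕ} (hm : 1 ≤ m) (x a : ℝ) (h : rho m x ≤ |x - a|) :
    1 / 2 ≤ relDist m x a := by
  have := rho_pos hm x
  rw [relDist, div_le_div_iff₀ two_pos (by linarith)]
  linarith

theorem abs_sub_div_rho_le {m : ℕ} (hm : 1 ≤ m) (x a : ℝ) (h : |x - a| ≤ rho m x) :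
    |x - a| / rho m x ≤ 2 * relDist m x a := by
  have h1 := rho_pos hm x
  have h2 := relDist_mul hm x a
  have h3 := relDist_nonneg hm x a
  rw [div_le_iff₀ h1]
  nlinarith

theorem exists_local_polynomial_rate {k : ℕ} (hk : 1 ≤ k) (r : ℕ) : ∃ C : ℝ, 0 < C ∧
    ∀ f : ℝ → ℝ, ContDiffOn ℝ r f (Set.Icc (-1) 1) → ∀ m : ℕ, 8 * (k + 1) ≤ m →
      ∀ a ∈ Set.Icc (-1 : ℝ) 1, ∃ L : ℝ[X], L.natDegree ≤ k + r ∧ ∀ x ∈ Set.Icc (-1 : ℝ) 1,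
        |f x - L.eval x| ≤ C * angleWeight m x a ^ (3 * k + 2 * r) * relDist m x a ^ r *
          rate (iteratedDerivWithin r f (Set.Icc (-1) 1)) k r m x := by
  obtain ⟨C, hC, H⟩ := exists_local_polynomial hk r
  obtain ⟨C', hC', H'⟩ := exists_omegaK_rho_le hk
  refine ⟨C * 2 ^ k * C' * 2 ^ r, by positivity, fun f hf m hm a ha => ?_⟩
  have hm1 : 1 ≤ m := by omega
  obtain ⟨L, hL, hLb⟩ := H f hf a ha (rho m a) (rho_pos hm1 a) (rho_le_of_le hm a)
  refine ⟨L, hL, fun x hx => (hLb x hx).trans ?_⟩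
  have hu : UniqueDiffOn ℝ (Set.Icc (-1 : ℝ) 1) := uniqueDiffOn_Icc (by norm_num)
  have hω := H' _ (hf.continuousOn_iteratedDerivWithin le_rfl hu) m hm x a
  have hω0 := omegaK_nonneg (iteratedDerivWithin r f (Set.Icc (-1) 1)) k (rho m a)
  have hω0' := omegaK_nonneg (iteratedDerivWithin r f (Set.Icc (-1) 1)) k (rho m x)
  have hΘ := one_le_angleWeight m x a
  have h1 := abs_sub_le_mul_angleWeight_sq hm1 hx ha
  have h2 := abs_sub_le_mul_angleWeight_sq hm1 ha hx
  rw [abs_sub_comm, angleWeight_comm] at h2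
  have hρa := rho_pos hm1 a
  have hρx := rho_pos hm1 x
  have hrel := relDist_mul hm1 x a
  have hrel0 := relDist_nonneg hm1 x a
  rw [rate]
  set ω := omegaK (iteratedDerivWithin r f (Set.Icc (-1) 1)) k (rho m a) (-1) 1
  set ω' := omegaK (iteratedDerivWithin r f (Set.Icc (-1) 1)) k (rho m x) (-1) 1
  set Θ := angleWeight m x a
  have hΘ2 : 1 ≤ Θ ^ 2 := one_le_pow₀ hΘ
  have h3 : 1 + |x - a| / rho m a ≤ 2 * Θ ^ 2 := by
    have : |x - a| / rho m a ≤ Θ ^ 2 := by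
      rw [div_le_iff₀ hρa, mul_comm]
      exact h1
    linarith
  have h4 : |x - a| ≤ relDist m x a * (rho m x * (2 * Θ ^ 2)) := by
    refine hrel.symm.le.trans ?_
    gcongr
    nlinarith
  calc |x - a| ^ r * (C * (1 + |x - a| / rho m a) ^ k * ω)
      ≤ (relDist m x a * (rho m x * (2 * Θ ^ 2))) ^ r *
        (C * (2 * Θ ^ 2) ^ k * (C' * Θ ^ k * ω')) := by gcongr
    _ = _ := by ring

/-- Slowly varying weights are comparable to polynomials. -/
theorem exists_polynomial_weight {A : ℝ} (hA : 0 < A) (b : ℕ) : ∃ C : ℝ, 0 < C ∧ ∃ E : ℕ,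
    ∀ m : ℕ, 1 ≤ m → ∀ W : ℝ → ℝ, (∀ x ∈ Set.Icc (-1 : ℝ) 1, 0 ≤ W x) →
      (∀ x ∈ Set.Icc (-1 : ℝ) 1, ∀ a ∈ Set.Icc (-1 : ℝ) 1,
        W a ≤ A * angleWeight m x a ^ b * W x) →
      ∃ T : ℝ[X], T.natDegree ≤ E * m ∧
        ∀ x ∈ Set.Icc (-1 : ℝ) 1, W x ≤ T.eval x ∧ T.eval x ≤ C * W x := by
  obtain ⟨K, hK, E, H⟩ := exists_kernel b
  refine ⟨A * K ^ b * K * (A * K), by positivity, E, fun m hm W hW hWb => ?_⟩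
  obtain ⟨M, a, κ, ha, hκd, hκ⟩ := H m hm
  refine ⟨∑ j ∈ Finset.range M, C (A * K ^ b * K * W (a j)) * κ j,
    natDegree_sum_le_of_forall_le _ _ fun j _ => (natDegree_C_mul_le _ _).trans (hκd j),
    fun x hx => ?_⟩
  obtain ⟨hκ0, -, hκΘ, j, hj, hκj, hΘj⟩ := hκ x hx
  rw [eval_finsetSum]
  simp only [eval_mul, eval_C]
  constructor
  · refine le_trans ?_ (Finset.single_le_sum (f := fun j => A * K ^ b * K * W (a j) * (κ j).eval x)
      (fun j _ => ?_) hj)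
    · have h1 := hWb (a j) (ha j) x hx
      rw [angleWeight_comm] at h1
      have h2 := (angleWeight_pos m x (a j)).le
      have h3 := hW (a j) (ha j)
      calc W x ≤ A * K ^ b * W (a j) * 1 := by
            rw [mul_one]
            refine h1.trans ?_
            gcongr
        _ ≤ A * K ^ b * W (a j) * (K * (κ j).eval x) := by gcongr
        _ = _ := by ring
    · have := hκ0 j
      have := hW (a j) (ha j)
      positivity
  · calc _ ≤ ∑ j ∈ Finset.range M, A * K ^ b * K * (A * W x) *
          ((κ j).eval x * angleWeight m x (a j) ^ b) := by
          refine Finset.sum_le_sum fun j _ => ?_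
          have h1 := hκ0 j
          have h2 := hWb x hx (a j) (ha j)
          calc _ ≤ A * K ^ b * K * (A * angleWeight m x (a j) ^ b * W x) * (κ j).eval x := by gcongr
            _ = _ := by ring
      _ ≤ A * K ^ b * K * (A * W x) * K := by
          rw [← Finset.mul_sum]
          have := hW x hx
          gcongr
      _ = _ := by ring

/-- Jackson-type approximation without interpolation. -/
theorem exists_polynomial_approx {k : ℕ} (hk : 1 ≤ k) (r : ℕ) : ∃ C : ℝ, 0 < C ∧ ∃ E : ℕ,
    ∀ f : ℝ → ℝ, ContDiffOn ℝ r f (Set.Icc (-1) 1) → ∀ m : ℕ, 8 * (k + 1) ≤ m →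
      ∃ Q : ℝ[X], Q.natDegree ≤ E * m ∧ ∀ x ∈ Set.Icc (-1 : ℝ) 1,
        |f x - Q.eval x| ≤ C * rate (iteratedDerivWithin r f (Set.Icc (-1) 1)) k r m x := by
  obtain ⟨C, hC, H⟩ := exists_local_polynomial_rate hk r
  obtain ⟨K, hK, E, H'⟩ := exists_kernel (3 * k + 2 * r)
  refine ⟨C * K, by positivity, k + r + E, fun f hf m hm => ?_⟩
  have hm1 : 1 ≤ m := by omega
  obtain ⟨M, a, κ, ha, hκd, hκ⟩ := H' m hm1
  choose L hLd hL using fun j => H f hf m hm (a j) (ha j)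
  refine ⟨∑ j ∈ Finset.range M, L j * κ j, natDegree_sum_le_of_forall_le _ _ fun j _ => ?_,
    fun x hx => ?_⟩
  · refine natDegree_mul_le.trans ((add_le_add (hLd j) (hκd j)).trans ?_)
    rw [add_mul]
    have := Nat.le_mul_of_pos_right (k + r) hm1
    omega
  · obtain ⟨hκ0, hκ1, hκΘ, -⟩ := hκ x hx
    have h1 : f x - (∑ j ∈ Finset.range M, L j * κ j).eval x =
        ∑ j ∈ Finset.range M, (f x - (L j).eval x) * (κ j).eval x := by
      simp only [sub_mul, Finset.sum_sub_distrib, ← Finset.mul_sum, hκ1, eval_finsetSum, eval_mul,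
        mul_one]
    have hr := rate_nonneg (iteratedDerivWithin r f (Set.Icc (-1) 1)) k r hm1 x
    rw [h1]
    calc _ ≤ ∑ j ∈ Finset.range M, |(f x - (L j).eval x) * (κ j).eval x| :=
          Finset.abs_sum_le_sum_abs _ _
      _ ≤ ∑ j ∈ Finset.range M,
          C * rate (iteratedDerivWithin r f (Set.Icc (-1) 1)) k r m x *
          ((κ j).eval x * angleWeight m x (a j) ^ (3 * k + 2 * r)) := by
          refine Finset.sum_le_sum fun j _ => ?_
          rw [abs_mul, abs_of_nonneg (hκ0 j)]
          have h2 := hL j x hx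
          have h3 : relDist m x (a j) ^ r ≤ 1 :=
            pow_le_one₀ (relDist_nonneg hm1 _ _) (relDist_le_one hm1 _ _)
          have h4 := (angleWeight_pos m x (a j)).le
          have h5 := hκ0 j
          calc _ ≤ (C * angleWeight m x (a j) ^ (3 * k + 2 * r) * 1 *
                rate (iteratedDerivWithin r f (Set.Icc (-1) 1)) k r m x) * (κ j).eval x := by
                refine mul_le_mul_of_nonneg_right (h2.trans ?_) h5
                gcongr
            _ = _ := by ring
      _ ≤ C * rate (iteratedDerivWithin r f (Set.Icc (-1) 1)) k r m x * K := by
          rw [← Finset.mul_sum]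
          gcongr
      _ = _ := by ring

theorem abs_one_sub_one_sub_pow_le {w K : ℝ} (hK : |w| ≤ K) (r : ℕ) :
    |1 - (1 - w) ^ r| ≤ r * (1 + K) ^ r * |w| := by
  have h0 : 0 ≤ K := (abs_nonneg w).trans hK
  have h1 : |1 - w| ≤ 1 + K := by
    refine (abs_sub _ _).trans ?_
    rw [abs_one]
    linarith
  rw [← mul_neg_geom_sum, sub_sub_cancel, abs_mul, mul_comm]
  refine mul_le_mul_of_nonneg_right ((Finset.abs_sum_le_sum_abs _ _).trans ?_) (abs_nonneg _)
  calc ∑ i ∈ Finset.range r, |(1 - w) ^ i| ≤ ∑ i ∈ Finset.range r, (1 + K) ^ r := by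
        refine Finset.sum_le_sum fun i hi => ?_
        rw [abs_pow]
        exact (pow_le_pow_left₀ (abs_nonneg _) h1 i).trans
          (pow_le_pow_right₀ (by linarith) (Finset.mem_range.1 hi).le)
    _ = _ := by rw [Finset.sum_const, Finset.card_range, nsmul_eq_mul]

theorem abs_one_sub_prod_one_add_le {ι : Type*} (s : Finset ι) (e : ι → ℝ) {ε : ℝ}
    (hε0 : 0 ≤ ε) (hε : ε ≤ 1) (he : ∀ i ∈ s, |e i| ≤ ε) :
    |1 - ∏ i ∈ s, (1 + e i)| ≤ 2 ^ s.card * ε := by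
  classical
  induction s using Finset.induction_on with
  | empty => simpa using hε0
  | insert a s ha ih =>
    have h1 := ih fun i hi => he i (Finset.mem_insert_of_mem hi)
    have h2 := he a (Finset.mem_insert_self _ _)
    have h3 : |∏ i ∈ s, (1 + e i)| ≤ 2 ^ s.card := by
      rw [Finset.abs_prod, ← Finset.prod_const]
      refine Finset.prod_le_prod (fun _ _ => abs_nonneg _) fun i hi => ?_
      refine (abs_add_le _ _).trans ?_
      rw [abs_one]
      linarith [he i (Finset.mem_insert_of_mem hi)]
    rw [Finset.prod_insert ha, Finset.card_insert_of_notMem ha]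
    calc |1 - (1 + e a) * ∏ i ∈ s, (1 + e i)|
        = |(1 - ∏ i ∈ s, (1 + e i)) + -(e a * ∏ i ∈ s, (1 + e i))| := by
          congr 1
          ring
      _ ≤ 2 ^ s.card * ε + ε * 2 ^ s.card := by
          refine (abs_add_le _ _).trans (add_le_add h1 ?_)
          rw [abs_neg, abs_mul]
          gcongr
      _ = _ := by ring

/-- Bumps at the points of a separated set which vanish at the other points of the set. -/
theorem exists_cardinal_bump (B q : ℕ) : ∃ c : ℝ, 0 < c ∧ ∃ E : ℕ, ∀ m : ℕ, 1 ≤ m →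
    ∀ A : Finset ℝ, A.card ≤ q → (∀ a ∈ A, a ∈ Set.Icc (-1 : ℝ) 1) →
    (∀ a ∈ A, ∀ b ∈ A, a ≠ b → 4 / (m : ℝ) ≤ |a - b|) → ∀ a ∈ A,
    ∃ J : ℝ[X], J.natDegree ≤ E * m ∧ ∀ x ∈ Set.Icc (-1 : ℝ) 1,
      |J.eval x| * angleWeight m x a ^ B ≤ c ∧ |1 - J.eval x| ≤ c * relDist m x a ∧
      ∀ b ∈ A, b ≠ a → |J.eval x| * angleWeight m x a ^ B ≤ c * relDist m x b := by
  obtain ⟨c, hc, H⟩ := exists_bump (B + 2 * q)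
  refine ⟨c * 2 ^ q + (2 * (1 + c * 2 ^ q) + 2 * (c + c * 2 ^ q)), by positivity, B + 2 * q + q,
    fun m hm A hAq hAI hsep a ha => ?_⟩
  obtain ⟨D, hDd, hDa, hD⟩ := H m hm a (hAI a ha)
  have hm' : (0 : ℝ) < m := by exact_mod_cast hm
  set s := A.erase a with hs
  have hsq : s.card ≤ q := (Finset.card_erase_le).trans hAq
  set J : ℝ[X] := D * ∏ b ∈ s, (C (a - b)⁻¹ * (X - C b)) with hJ
  have hJe : ∀ x, J.eval x = D.eval x * ∏ b ∈ s, (x - b) / (a - b) := by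
    intro x
    rw [hJ, eval_mul, eval_prod]
    congr 1
    refine Finset.prod_congr rfl fun b _ => ?_
    rw [eval_mul, eval_C, eval_sub, eval_X, eval_C]
    ring
  refine ⟨J, ?_, fun x hx => ?_⟩
  · have h1 : (∏ b ∈ s, (C (a - b)⁻¹ * (X - C b))).natDegree ≤ q := by
      refine (natDegree_prod_le _ _).trans ((Finset.sum_le_card_nsmul _ _ 1 fun b _ => ?_).trans ?_)
      · exact (natDegree_C_mul_le _ _).trans (natDegree_X_sub_C_le b)
      · simpa using hsq
    refine natDegree_mul_le.trans ((add_le_add hDd h1).trans ?_)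
    rw [add_mul (B + 2 * q)]
    have := Nat.le_mul_of_pos_right q hm
    omega
  obtain ⟨hD1, hD2⟩ := hD x hx
  have hρ := rho_pos hm x
  have hΘ := one_le_angleWeight m x a
  have hxa := abs_sub_le_mul_angleWeight_sq hm hx (hAI a ha)
  have hρx := rho_le_two_div hm x
  have hρa := rho_le_two_div hm a
  set Θ := angleWeight m x a with hΘdef
  have hΘ2 : 1 ≤ Θ ^ 2 := one_le_pow₀ hΘ
  have hfac : ∀ b ∈ s, |(x - b) / (a - b)| ≤ 2 * Θ ^ 2 * relDist m x b := by
    intro b hb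
    have hab := hsep a ha b (Finset.mem_of_mem_erase hb) (Finset.ne_of_mem_erase hb).symm
    have h4 : 4 / (m : ℝ) = 2 * (2 / m) := by ring
    have h2m : 0 < 2 / (m : ℝ) := by positivity
    have hab0 : 0 < |a - b| := by linarith
    rw [abs_div, div_le_iff₀ hab0, ← relDist_mul hm x b]
    have h1 : |x - b| ≤ |x - a| + |a - b| := abs_sub_le _ _ _
    have h2 : |x - b| + rho m x ≤ 2 * Θ ^ 2 * |a - b| := by
      have h3 : |x - a| ≤ 2 / m * Θ ^ 2 := hxa.trans (by gcongr)
      nlinarith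
    calc relDist m x b * (|x - b| + rho m x) ≤ relDist m x b * (2 * Θ ^ 2 * |a - b|) := by
          have := relDist_nonneg hm x b
          gcongr
      _ = _ := by ring
  have hfac1 : ∀ b ∈ s, |(x - b) / (a - b)| ≤ 2 * Θ ^ 2 := fun b hb =>
    (hfac b hb).trans (mul_le_of_le_one_right (by positivity) (relDist_le_one hm x b))
  have hΘq : ∀ n ≤ q, (2 * Θ ^ 2) ^ n ≤ 2 ^ q * Θ ^ (2 * q) := by
    intro n hn
    rw [pow_mul, ← mul_pow]
    exact pow_le_pow_right₀ (by linarith) hn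
  have hprod : ∏ b ∈ s, |(x - b) / (a - b)| ≤ 2 ^ q * Θ ^ (2 * q) := by
    refine le_trans ?_ (hΘq s.card hsq)
    rw [← Finset.prod_const]
    exact Finset.prod_le_prod (fun _ _ => abs_nonneg _) hfac1
  have hD3 : |D.eval x| * Θ ^ B * (2 ^ q * Θ ^ (2 * q)) ≤ c * 2 ^ q := by
    calc _ = |D.eval x| * Θ ^ (B + 2 * q) * 2 ^ q := by ring
      _ ≤ _ := by gcongr
  have hJ1 : |J.eval x| * Θ ^ B ≤ c * 2 ^ q := by
    refine le_trans ?_ hD3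
    rw [hJe, abs_mul, Finset.abs_prod, mul_right_comm]
    gcongr
  have hbig : c * 2 ^ q ≤ c * 2 ^ q + (2 * (1 + c * 2 ^ q) + 2 * (c + c * 2 ^ q)) :=
    le_add_of_nonneg_right (by positivity)
  refine ⟨hJ1.trans hbig, ?_, fun b hb hba => ?_⟩
  · have hrel := relDist_nonneg hm x a
    have hB1 : 1 ≤ Θ ^ B := one_le_pow₀ hΘ
    rcases le_total (rho m x) |x - a| with h | h
    · have h1 := half_le_relDist hm x a h
      have h2 : |J.eval x| ≤ c * 2 ^ q := le_trans (le_mul_of_one_le_right (abs_nonneg _) hB1) hJ1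
      calc |1 - J.eval x| ≤ 1 + c * 2 ^ q := by
            refine (abs_sub _ _).trans ?_
            rw [abs_one]
            linarith
        _ ≤ 2 * (1 + c * 2 ^ q) * relDist m x a := by
            have : 0 < 1 + c * 2 ^ q := by positivity
            nlinarith
        _ ≤ _ := by
            gcongr
            have : 0 < c * 2 ^ q := by positivity
            linarith
    · have h1 := abs_sub_div_rho_le hm x a h
      set lam := |x - a| / rho m x with hlam
      have hl0 : 0 ≤ lam := by positivity
      have hl1 : lam ≤ 1 := div_le_one_of_le₀ h hρ.le
      have h2 : |1 - ∏ b ∈ s, (x - b) / (a - b)| ≤ 2 ^ q * lam := by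
        have h3 := abs_one_sub_prod_one_add_le s (fun b => (x - a) / (a - b)) (ε := lam) hl0 hl1 (by
          intro b hb
          have hab := hsep a ha b (Finset.mem_of_mem_erase hb) (Finset.ne_of_mem_erase hb).symm
          have h4 : 2 / (m : ℝ) ≤ 4 / m := by gcongr; norm_num
          rw [abs_div, hlam]
          gcongr
          linarith)
        rw [Finset.prod_congr rfl fun b hb => (show 1 + (x - a) / (a - b) = (x - b) / (a - b) by
          have : a - b ≠ 0 := sub_ne_zero.2 (Finset.ne_of_mem_erase hb).symm
          field_simp
          ring)] at h3
        refine h3.trans ?_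
        gcongr
        norm_num
      have hDc : |D.eval x| ≤ c :=
        le_trans (le_mul_of_one_le_right (abs_nonneg _) (one_le_pow₀ hΘ)) hD1
      have h5 : 1 - J.eval x = (1 - D.eval x) +
          D.eval x * (1 - ∏ b ∈ s, (x - b) / (a - b)) := by
        rw [hJe]
        ring
      calc |1 - J.eval x| ≤ c * lam + c * (2 ^ q * lam) := by
            rw [h5]
            refine (abs_add_le _ _).trans (add_le_add hD2 ?_)
            rw [abs_mul]
            gcongr
        _ = (c + c * 2 ^ q) * lam := by ring
        _ ≤ (c + c * 2 ^ q) * (2 * relDist m x a) := by gcongr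
        _ = 2 * (c + c * 2 ^ q) * relDist m x a := by ring
        _ ≤ _ := by
            gcongr
            have : 0 < c * 2 ^ q := by positivity
            linarith
  · have hbs : b ∈ s := Finset.mem_erase.2 ⟨hba, hb⟩
    have hrel := relDist_nonneg hm x b
    have h1 : ∏ b ∈ s, |(x - b) / (a - b)| ≤ 2 ^ q * Θ ^ (2 * q) * relDist m x b := by
      rw [← Finset.mul_prod_erase s _ hbs]
      calc _ ≤ 2 * Θ ^ 2 * relDist m x b * (2 * Θ ^ 2) ^ (s.erase b).card := by
            gcongr
            · exact hfac b hbs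
            · rw [← Finset.prod_const]
              exact Finset.prod_le_prod (fun _ _ => abs_nonneg _) fun d hd =>
                hfac1 d (Finset.mem_of_mem_erase hd)
        _ = (2 * Θ ^ 2) ^ ((s.erase b).card + 1) * relDist m x b := by ring
        _ ≤ _ := by
            gcongr
            refine hΘq _ ?_
            rw [Finset.card_erase_add_one hbs]
            exact hsq
    calc |J.eval x| * Θ ^ B ≤ |D.eval x| * Θ ^ B * (2 ^ q * Θ ^ (2 * q) * relDist m x b) := by
          rw [hJe, abs_mul, Finset.abs_prod, mul_right_comm]
          gcongr
      _ = |D.eval x| * Θ ^ B * (2 ^ q * Θ ^ (2 * q)) * relDist m x b := by ring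
      _ ≤ c * 2 ^ q * relDist m x b := by gcongr
      _ ≤ _ := by gcongr

/-- Bumps that reproduce and annihilate to order `r` at the points of a separated set. -/
theorem exists_cardinal_bump_pow (B q : ℕ) {r : ℕ} (hr : 1 ≤ r) : ∃ c : ℝ, 0 < c ∧ ∃ E : ℕ,
    ∀ m : ℕ, 1 ≤ m →
    ∀ A : Finset ℝ, A.card ≤ q → (∀ a ∈ A, a ∈ Set.Icc (-1 : ℝ) 1) →
    (∀ a ∈ A, ∀ b ∈ A, a ≠ b → 4 / (m : ℝ) ≤ |a - b|) → ∀ a ∈ A,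
    ∃ χ : ℝ[X], χ.natDegree ≤ E * m ∧ ∀ x ∈ Set.Icc (-1 : ℝ) 1,
      |χ.eval x| * angleWeight m x a ^ B ≤ c ∧ |1 - χ.eval x| ≤ c * relDist m x a ^ r ∧
      ∀ b ∈ A, b ≠ a → |χ.eval x| * angleWeight m x a ^ B ≤ c * relDist m x b ^ r := by
  obtain ⟨c, hc, E, H⟩ := exists_cardinal_bump B q
  refine ⟨(r * (1 + c) ^ r) ^ r * c ^ r + r * (1 + c ^ r) ^ r * c ^ r, by positivity, r * (r * E),
    fun m hm A hAq hAI hsep a ha => ?_⟩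
  obtain ⟨J, hJd, hJ⟩ := H m hm A hAq hAI hsep a ha
  refine ⟨(1 - (1 - J) ^ r) ^ r, ?_, fun x hx => ?_⟩
  · refine natDegree_pow_le.trans ?_
    rw [mul_assoc]
    refine Nat.mul_le_mul_left _ ((natDegree_sub_le _ _).trans ?_)
    rw [natDegree_one, Nat.zero_max]
    refine natDegree_pow_le.trans ?_
    rw [mul_assoc]
    refine Nat.mul_le_mul_left _ ((natDegree_sub_le _ _).trans ?_)
    rw [natDegree_one, Nat.zero_max]
    exact hJd
  obtain ⟨h1, h2, h3⟩ := hJ x hx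
  have hΘ := one_le_angleWeight m x a
  have hrel := relDist_nonneg hm x a
  have hB1 : 1 ≤ angleWeight m x a ^ B := one_le_pow₀ hΘ
  have hJc : |J.eval x| ≤ c := le_trans (le_mul_of_one_le_right (abs_nonneg _) hB1) h1
  have he : ((1 - (1 - J) ^ r) ^ r).eval x = (1 - (1 - J.eval x) ^ r) ^ r := by simp
  rw [he]
  have key : ∀ K, |J.eval x| * angleWeight m x a ^ B ≤ K →
      |(1 - (1 - J.eval x) ^ r) ^ r| * angleWeight m x a ^ B ≤ (r * (1 + c) ^ r) ^ r * K ^ r := by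
    intro K hK
    have h4 := abs_one_sub_one_sub_pow_le hJc r
    have h5 : angleWeight m x a ^ B ≤ (angleWeight m x a ^ B) ^ r := le_self_pow₀ hB1 (by omega)
    calc _ ≤ (r * (1 + c) ^ r * |J.eval x|) ^ r * (angleWeight m x a ^ B) ^ r := by
          rw [abs_pow]
          gcongr
      _ = (r * (1 + c) ^ r) ^ r * (|J.eval x| * angleWeight m x a ^ B) ^ r := by ring
      _ ≤ _ := by gcongr
  have hpos1 : 0 ≤ (r * (1 + c) ^ r) ^ r * c ^ r := by positivity
  have hpos2 : 0 ≤ r * (1 + c ^ r) ^ r * c ^ r := by positivity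
  refine ⟨(key c h1).trans (by linarith), ?_, fun b hb hba => (key _ (h3 b hb hba)).trans ?_⟩
  · have h4 : |(1 - J.eval x) ^ r| ≤ c ^ r * relDist m x a ^ r := by
      rw [abs_pow, ← mul_pow]
      gcongr
    have h5 : |(1 - J.eval x) ^ r| ≤ c ^ r := h4.trans
      (mul_le_of_le_one_right (by positivity) (pow_le_one₀ hrel (relDist_le_one hm x a)))
    calc _ ≤ r * (1 + c ^ r) ^ r * (c ^ r * relDist m x a ^ r) := by
          refine (abs_one_sub_one_sub_pow_le h5 r).trans ?_
          gcongr
      _ = r * (1 + c ^ r) ^ r * c ^ r * relDist m x a ^ r := by ring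
      _ ≤ _ := by
          gcongr
          linarith
  · have hrelb := relDist_nonneg hm x b
    rw [mul_pow c, ← mul_assoc]
    gcongr
    linarith

/-- Jackson-type approximation with Hermite interpolation, with a bound that vanishes to order `r`
at each of the interpolation points. -/
theorem exists_hermite_approx {k r : ℕ} (hk : 1 ≤ k) (hr : 1 ≤ r) (q : ℕ) : ∃ c : ℝ, 0 < c ∧
    ∃ E : ℕ, ∀ f : ℝ → ℝ, ContDiffOn ℝ r f (Set.Icc (-1) 1) → ∀ m : ℕ, 8 * (k + 1) ≤ m →
    ∀ A : Finset ℝ, A.card ≤ q → (∀ a ∈ A, a ∈ Set.Icc (-1 : ℝ) 1) →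
    (∀ a ∈ A, ∀ b ∈ A, a ≠ b → 4 / (m : ℝ) ≤ |a - b|) →
    ∃ Q : ℝ[X], Q.natDegree ≤ E * m ∧ ∀ x ∈ Set.Icc (-1 : ℝ) 1, ∀ a ∈ A,
      |f x - Q.eval x| ≤
        c * relDist m x a ^ r * rate (iteratedDerivWithin r f (Set.Icc (-1) 1)) k r m x := by
  obtain ⟨cL, hcL, HL⟩ := exists_local_polynomial_rate hk r
  obtain ⟨cχ, hcχ, Eχ, Hχ⟩ := exists_cardinal_bump_pow (3 * k + 2 * r) q hr
  obtain ⟨c₀, hc₀, E₀, H₀⟩ := exists_polynomial_approx hk r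
  refine ⟨q * (cχ * cL) + (cχ + q * cχ) * c₀, by positivity, Eχ + (k + r) + E₀,
    fun f hf m hm A hAq hAI hsep => ?_⟩
  have hm1 : 1 ≤ m := by omega
  obtain ⟨Q₀, hQ₀d, hQ₀⟩ := H₀ f hf m hm
  choose! χ hχd hχ using Hχ m hm1 A hAq hAI hsep
  choose! L hLd hL using fun a ha => HL f hf m hm a (hAI a ha)
  refine ⟨∑ b ∈ A, χ b * L b + (1 - ∑ b ∈ A, χ b) * Q₀, ?_, fun x hx a ha => ?_⟩
  · have h0 : k + r ≤ (k + r) * m := Nat.le_mul_of_pos_right _ hm1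
    have h1 : (∑ b ∈ A, χ b * L b).natDegree ≤ Eχ * m + (k + r) :=
      natDegree_sum_le_of_forall_le _ _ fun b hb =>
        natDegree_mul_le.trans (add_le_add (hχd b hb) (hLd b hb))
    have h2 : ((1 - ∑ b ∈ A, χ b) * Q₀).natDegree ≤ Eχ * m + E₀ * m := by
      refine natDegree_mul_le.trans (add_le_add ((natDegree_sub_le _ _).trans ?_) hQ₀d)
      rw [natDegree_one, Nat.zero_max]
      exact natDegree_sum_le_of_forall_le _ _ hχd
    refine (natDegree_add_le _ _).trans (max_le (h1.trans ?_) (h2.trans ?_))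
    · rw [add_mul, add_mul]
      omega
    · rw [add_mul, add_mul]
      omega
  have hR := rate_nonneg (iteratedDerivWithin r f (Set.Icc (-1) 1)) k r hm1 x
  set R := rate (iteratedDerivWithin r f (Set.Icc (-1) 1)) k r m x
  set B := 3 * k + 2 * r
  have hrel : ∀ b, 0 ≤ relDist m x b ^ r := fun b => pow_nonneg (relDist_nonneg hm1 x b) _
  have hrel1 : ∀ b, relDist m x b ^ r ≤ 1 := fun b =>
    pow_le_one₀ (relDist_nonneg hm1 x b) (relDist_le_one hm1 x b)
  have hΘ : ∀ b, 1 ≤ angleWeight m x b ^ B := fun b => one_le_pow₀ (one_le_angleWeight m x b)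
  set lam := relDist m x a ^ r with hlam
  have hχL : ∀ b ∈ A, |(χ b).eval x| * |f x - (L b).eval x| ≤ cχ * cL * lam * R := by
    intro b hb
    have h1 : |(χ b).eval x| * angleWeight m x b ^ B * relDist m x b ^ r ≤ cχ * lam := by
      rcases eq_or_ne a b with rfl | hab
      · exact mul_le_mul_of_nonneg_right (hχ a ha x hx).1 (hrel a)
      · exact (mul_le_of_le_one_right (mul_nonneg (abs_nonneg _) (zero_le_one.trans (hΘ b)))
          (hrel1 b)).trans ((hχ b hb x hx).2.2 a ha hab)
    calc |(χ b).eval x| * |f x - (L b).eval x|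
        ≤ |(χ b).eval x| * (cL * angleWeight m x b ^ B * relDist m x b ^ r * R) := by
          gcongr
          exact hL b hb x hx
      _ = cL * R * (|(χ b).eval x| * angleWeight m x b ^ B * relDist m x b ^ r) := by ring
      _ ≤ cL * R * (cχ * lam) := by gcongr
      _ = _ := by ring
  have hχ1 : |1 - ∑ b ∈ A, (χ b).eval x| ≤ (cχ + q * cχ) * lam := by
    have h1 : 1 - ∑ b ∈ A, (χ b).eval x = (1 - (χ a).eval x) - ∑ b ∈ A.erase a, (χ b).eval x := by
      rw [← Finset.add_sum_erase A _ ha]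
      ring
    have h2 : |∑ b ∈ A.erase a, (χ b).eval x| ≤ q * (cχ * lam) := by
      refine (Finset.abs_sum_le_sum_abs _ _).trans ((Finset.sum_le_card_nsmul _ _ (cχ * lam)
        fun b hb => ?_).trans ?_)
      · exact (le_mul_of_one_le_right (abs_nonneg _) (hΘ b)).trans
          ((hχ b (Finset.mem_of_mem_erase hb) x hx).2.2 a ha (Finset.ne_of_mem_erase hb).symm)
      · rw [nsmul_eq_mul]
        have : ((A.erase a).card : ℝ) ≤ q := by
          exact_mod_cast (Finset.card_erase_le).trans hAq
        have := hrel a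
        gcongr
    rw [h1]
    refine (abs_sub _ _).trans ((add_le_add (hχ a ha x hx).2.1 h2).trans_eq ?_)
    ring
  have he : f x - (∑ b ∈ A, χ b * L b + (1 - ∑ b ∈ A, χ b) * Q₀).eval x =
      ∑ b ∈ A, (χ b).eval x * (f x - (L b).eval x) +
        (1 - ∑ b ∈ A, (χ b).eval x) * (f x - Q₀.eval x) := by
    simp only [eval_add, eval_finsetSum, eval_mul, eval_sub, eval_one, mul_sub,
      Finset.sum_sub_distrib, ← Finset.sum_mul]
    ring
  have hAq' : (A.card : ℝ) ≤ q := by exact_mod_cast hAq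
  have hlam0 : 0 ≤ lam := hrel a
  calc _ ≤ ∑ b ∈ A, |(χ b).eval x| * |f x - (L b).eval x| +
        |1 - ∑ b ∈ A, (χ b).eval x| * |f x - Q₀.eval x| := by
        rw [he]
        refine (abs_add_le _ _).trans (add_le_add ?_ (abs_mul _ _).le)
        simpa only [abs_mul] using Finset.abs_sum_le_sum_abs (fun b => (χ b).eval x *
          (f x - (L b).eval x)) A
    _ ≤ q * (cχ * cL * lam * R) + (cχ + q * cχ) * lam * (c₀ * R) := by
        refine add_le_add ((Finset.sum_le_card_nsmul _ _ _ hχL).trans ?_) ?_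
        · rw [nsmul_eq_mul]
          gcongr
        · gcongr
          exact hQ₀ x hx
    _ = _ := by ring

theorem exists_relDist_pow_le_prod {m : ℕ} (hm : 1 ≤ m) (r : ℕ) {A : Finset ℝ} (hA : A.Nonempty)
    (hsep : ∀ a ∈ A, ∀ b ∈ A, a ≠ b → 4 / (m : ℝ) ≤ |a - b|) {μ : ℝ → ℕ}
    (hμ : ∀ a ∈ A, μ a ≤ r) (x : ℝ) :
    ∃ a ∈ A, relDist m x a ^ r ≤ 2 ^ (r * A.card) * ∏ b ∈ A, relDist m x b ^ μ b := by
  obtain ⟨a, ha, hmin⟩ := A.exists_min_image (fun a => |x - a|) hA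
  refine ⟨a, ha, ?_⟩
  have hρ := rho_le_two_div hm x
  have h1 : ∀ b ∈ A.erase a, 1 ≤ 2 ^ r * relDist m x b ^ μ b := by
    intro b hb
    have hbA := Finset.mem_of_mem_erase hb
    have h2 := hsep a ha b hbA (Finset.ne_of_mem_erase hb).symm
    have h3 : |a - b| ≤ |x - a| + |x - b| := by
      rw [abs_sub_comm x a]
      exact abs_sub_le _ _ _
    have h4 := hmin b hbA
    have h5 : 4 / (m : ℝ) = 2 * (2 / m) := by ring
    have h6 := half_le_relDist hm x b (by linarith)
    calc (1 : ℝ) = 2 ^ r * (1 / 2) ^ r := by rw [← mul_pow]; norm_num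
      _ ≤ 2 ^ r * (1 / 2) ^ μ b := by
        gcongr ?_ * ?_
        exact pow_le_pow_of_le_one (by norm_num) (by norm_num) (hμ b hbA)
      _ ≤ _ := by gcongr
  have h2 : 1 ≤ 2 ^ (r * (A.erase a).card) * ∏ b ∈ A.erase a, relDist m x b ^ μ b := by
    rw [pow_mul, ← Finset.prod_const, ← Finset.prod_mul_distrib]
    simpa using Finset.prod_le_prod (f := fun _ => (1 : ℝ)) (fun _ _ => zero_le_one) h1
  have h3 := relDist_nonneg hm x a
  have h4 : relDist m x a ^ r ≤ relDist m x a ^ μ a :=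
    pow_le_pow_of_le_one h3 (relDist_le_one hm x a) (hμ a ha)
  have h5 : 0 ≤ ∏ b ∈ A.erase a, relDist m x b ^ μ b :=
    Finset.prod_nonneg fun b _ => pow_nonneg (relDist_nonneg hm x b) _
  rw [← Finset.mul_prod_erase A _ ha]
  calc relDist m x a ^ r ≤ relDist m x a ^ μ a * 1 := by rwa [mul_one]
    _ ≤ relDist m x a ^ μ a *
        (2 ^ (r * (A.erase a).card) * ∏ b ∈ A.erase a, relDist m x b ^ μ b) := by gcongr
    _ ≤ relDist m x a ^ μ a *
        (2 ^ (r * A.card) * ∏ b ∈ A.erase a, relDist m x b ^ μ b) := by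
        gcongr
        · norm_num
        · exact Finset.erase_subset _ _
    _ = _ := by ring

/-- Approximation with an error controlled by a nonnegative polynomial vanishing to prescribed
orders at the points of a separated set. -/
theorem exists_majorized_approx {k r : ℕ} (hk : 1 ≤ k) (hr : 1 ≤ r) (q : ℕ) : ∃ c : ℝ, 0 < c ∧
    ∃ E : ℕ, ∀ f : ℝ → ℝ, ContDiffOn ℝ r f (Set.Icc (-1) 1) → ∀ m : ℕ, 8 * (k + 1) ≤ m →
    ∀ A : Finset ℝ, A.Nonempty → A.card ≤ q → (∀ a ∈ A, a ∈ Set.Icc (-1 : ℝ) 1) →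
    (∀ a ∈ A, ∀ b ∈ A, a ≠ b → 4 / (m : ℝ) ≤ |a - b|) →
    ∀ μ : ℝ → ℕ, (∀ a ∈ A, μ a ≤ r) →
    ∃ Q T : ℝ[X], Q.natDegree ≤ E * m ∧ T.natDegree ≤ E * m ∧ ∀ x ∈ Set.Icc (-1 : ℝ) 1,
      0 ≤ T.eval x ∧ |f x - Q.eval x| ≤ T.eval x * ∏ a ∈ A, |x - a| ^ μ a ∧
      T.eval x * ∏ a ∈ A, |x - a| ^ μ a ≤
        c * rate (iteratedDerivWithin r f (Set.Icc (-1) 1)) k r m x := by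
  obtain ⟨c₁, hc₁, E₁, H₁⟩ := exists_hermite_approx hk hr q
  obtain ⟨c₂, hc₂, H₂⟩ := exists_rate_le hk r
  obtain ⟨c₃, hc₃, E₃, H₃⟩ := exists_polynomial_weight (A := c₂ * 2 ^ (r * q)) (by positivity)
    (k + r + 2 * (r * q))
  refine ⟨c₃ * (c₁ * 2 ^ (r * q)), by positivity, E₁ + E₃,
    fun f hf m hm A hA hAq hAI hsep μ hμ => ?_⟩
  have hm1 : 1 ≤ m := by omega
  have hu : UniqueDiffOn ℝ (Set.Icc (-1 : ℝ) 1) := uniqueDiffOn_Icc (by norm_num)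
  set g := iteratedDerivWithin r f (Set.Icc (-1) 1)
  have hg : ContinuousOn g (Set.Icc (-1) 1) := hf.continuousOn_iteratedDerivWithin le_rfl hu
  obtain ⟨Q, hQd, hQ⟩ := H₁ f hf m hm A hAq hAI hsep
  have hpos : ∀ x a, 0 < |x - a| + rho m x := fun x a =>
    add_pos_of_nonneg_of_pos (abs_nonneg _) (rho_pos hm1 x)
  have hprod0 : ∀ x, 0 ≤ ∏ a ∈ A, ((|x - a| + rho m x) ^ μ a)⁻¹ := fun x =>
    Finset.prod_nonneg fun a _ => inv_nonneg.2 (pow_nonneg (hpos x a).le _)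
  have hR := fun x => rate_nonneg g k r hm1 x
  obtain ⟨T, hTd, hT⟩ := H₃ m hm1 (fun x => c₁ * 2 ^ (r * q) * (rate g k r m x *
    ∏ a ∈ A, ((|x - a| + rho m x) ^ μ a)⁻¹)) (fun x _ => by
      have := hprod0 x
      have := hR x
      positivity) (by
    intro x hx z hz
    have hΘ := one_le_angleWeight m x z
    have h1 := H₂ g hg m hm x z
    have h2 : ∏ a ∈ A, ((|z - a| + rho m z) ^ μ a)⁻¹ ≤
        2 ^ (r * q) * angleWeight m x z ^ (2 * (r * q)) *
        ∏ a ∈ A, ((|x - a| + rho m x) ^ μ a)⁻¹ := by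
      have h3 := abs_sub_le_mul_angleWeight_sq hm1 hx hz
      have h4 := rho_le_mul_angleWeight hm1 x z
      have h5 := rho_pos hm1 z
      set Θ := angleWeight m x z
      have hΘ2 : Θ ≤ Θ ^ 2 := le_self_pow₀ hΘ two_ne_zero
      have h6 : ∀ a ∈ A, ((|z - a| + rho m z) ^ μ a)⁻¹ ≤
          (2 * Θ ^ 2) ^ r * ((|x - a| + rho m x) ^ μ a)⁻¹ := by
        intro a ha
        have h7 : |x - a| + rho m x ≤ 2 * Θ ^ 2 * (|z - a| + rho m z) := by
          have := abs_sub_le x z a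
          have := abs_nonneg (z - a)
          nlinarith
        rw [← div_eq_mul_inv, le_div_iff₀ (pow_pos (hpos x a) _), inv_mul_le_iff₀
          (pow_pos (hpos z a) _)]
        calc _ ≤ (2 * Θ ^ 2 * (|z - a| + rho m z)) ^ μ a :=
              pow_le_pow_left₀ (hpos x a).le h7 _
          _ = (|z - a| + rho m z) ^ μ a * (2 * Θ ^ 2) ^ μ a := by rw [mul_pow, mul_comm]
          _ ≤ _ := by
            have := (hpos z a).le
            gcongr
            · nlinarith
            · exact hμ a ha
      calc _ ≤ ∏ a ∈ A, (2 * Θ ^ 2) ^ r * ((|x - a| + rho m x) ^ μ a)⁻¹ :=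
            Finset.prod_le_prod (fun a _ => inv_nonneg.2 (pow_nonneg (hpos z a).le _)) h6
        _ = (2 * Θ ^ 2) ^ (r * A.card) * ∏ a ∈ A, ((|x - a| + rho m x) ^ μ a)⁻¹ := by
            rw [Finset.prod_mul_distrib, Finset.prod_const, pow_mul]
        _ ≤ (2 * Θ ^ 2) ^ (r * q) * ∏ a ∈ A, ((|x - a| + rho m x) ^ μ a)⁻¹ := by
            have := hprod0 x
            gcongr
            nlinarith
        _ = _ := by
            rw [mul_pow, ← pow_mul]
    have h8 := hprod0 z
    have h9 := hR x
    calc _ ≤ c₁ * 2 ^ (r * q) * (c₂ * angleWeight m x z ^ (k + r) * rate g k r m x *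
          (2 ^ (r * q) * angleWeight m x z ^ (2 * (r * q)) *
            ∏ a ∈ A, ((|x - a| + rho m x) ^ μ a)⁻¹)) := by gcongr
      _ = _ := by
        rw [pow_add _ (k + r)]
        ring)
  have hTprod : ∀ x, (∏ a ∈ A, ((|x - a| + rho m x) ^ μ a)⁻¹) * ∏ a ∈ A, |x - a| ^ μ a =
      ∏ a ∈ A, relDist m x a ^ μ a := by
    intro x
    rw [← Finset.prod_mul_distrib]
    refine Finset.prod_congr rfl fun a _ => ?_
    rw [relDist, div_pow, div_eq_inv_mul]
  refine ⟨Q, T, hQd.trans (Nat.mul_le_mul_right _ (Nat.le_add_right _ _)),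
    hTd.trans (Nat.mul_le_mul_right _ (Nat.le_add_left _ _)), fun x hx => ?_⟩
  obtain ⟨hT1, hT2⟩ := hT x hx
  have hp0 : 0 ≤ ∏ a ∈ A, |x - a| ^ μ a :=
    Finset.prod_nonneg fun a _ => pow_nonneg (abs_nonneg _) _
  have hRx := hR x
  have hp0x := hprod0 x
  refine ⟨le_trans (by positivity) hT1, ?_, ?_⟩
  · obtain ⟨a, ha, hle⟩ := exists_relDist_pow_le_prod hm1 r hA hsep hμ x
    calc |f x - Q.eval x| ≤ c₁ * (2 ^ (r * q) * ∏ b ∈ A, relDist m x b ^ μ b) * rate g k r m x := by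
          refine (hQ x hx a ha).trans ?_
          gcongr
          refine hle.trans ?_
          have : 0 ≤ ∏ b ∈ A, relDist m x b ^ μ b :=
            Finset.prod_nonneg fun b _ => pow_nonneg (relDist_nonneg hm1 x b) _
          gcongr
          norm_num
      _ = c₁ * 2 ^ (r * q) * (rate g k r m x * ∏ a ∈ A, ((|x - a| + rho m x) ^ μ a)⁻¹) *
          ∏ a ∈ A, |x - a| ^ μ a := by
          rw [← hTprod]
          ring
      _ ≤ _ := by gcongr
  · calc _ ≤ c₃ * (c₁ * 2 ^ (r * q) * (rate g k r m x *
          ∏ a ∈ A, ((|x - a| + rho m x) ^ μ a)⁻¹)) * ∏ a ∈ A, |x - a| ^ μ a := by gcongr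
      _ = c₃ * (c₁ * 2 ^ (r * q)) * rate g k r m x * ∏ a ∈ A, relDist m x a ^ μ a := by
          rw [← hTprod]
          ring
      _ ≤ _ := by
          refine mul_le_of_le_one_right (by positivity) (Finset.prod_le_one (fun b _ =>
            pow_nonneg (relDist_nonneg hm1 x b) _) fun b _ =>
            pow_le_one₀ (relDist_nonneg hm1 x b) (relDist_le_one hm1 x b))

theorem rho_le_mul_rho {E m n : ℕ} (hn : 1 ≤ n) (h : n ≤ E * m) (x : ℝ) :
    rho m x ≤ E ^ 2 * rho n x := by
  have hE : 1 ≤ E := Nat.pos_of_ne_zero fun h0 => by subst h0; omega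
  have hm : 1 ≤ m := Nat.pos_of_ne_zero fun h0 => by subst h0; omega
  have hE' : (1 : ℝ) ≤ E := by exact_mod_cast hE
  have hm' : (0 : ℝ) < m := by exact_mod_cast hm
  have hn' : (0 : ℝ) < n := by exact_mod_cast hn
  have h' : (n : ℝ) ≤ E * m := by exact_mod_cast h
  have h1 : Real.sqrt (1 - x ^ 2) / m ≤ E ^ 2 * (Real.sqrt (1 - x ^ 2) / n) := by
    rw [mul_div_assoc', div_le_div_iff₀ hm' hn', mul_comm (_ ^ 2), mul_assoc]
    refine mul_le_mul_of_nonneg_left (h'.trans ?_) (Real.sqrt_nonneg _)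
    gcongr
    exact le_self_pow₀ hE' two_ne_zero
  have h2 : 1 / (m : ℝ) ^ 2 ≤ E ^ 2 * (1 / (n : ℝ) ^ 2) := by
    rw [mul_one_div, div_le_div_iff₀ (by positivity) (by positivity), one_mul, ← mul_pow]
    gcongr
  rw [rho, rho, mul_add]
  exact add_le_add h1 h2

theorem exists_rate_le_rate {k : ℕ} (hk : 1 ≤ k) (r E : ℕ) : ∃ c : ℝ, 0 < c ∧
    ∀ g : ℝ → ℝ, ContinuousOn g (Set.Icc (-1) 1) → ∀ m n : ℕ, 8 * (k + 1) ≤ n → n ≤ E * m →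
    ∀ x, rate g k r m x ≤ c * rate g k r n x := by
  obtain ⟨C, hC, H⟩ := omegaK_le_mul hk
  refine ⟨((E : ℝ) ^ 2 + 1) ^ r * (C * ((E : ℝ) ^ 2 + 1) ^ k), by positivity,
    fun g hg m n hn hnm x => ?_⟩
  have hn1 : 1 ≤ n := by omega
  have hm : 1 ≤ m := Nat.pos_of_ne_zero fun h0 => by subst h0; omega
  have hρm := rho_pos hm x
  have hρn := rho_pos hn1 x
  have hρ : rho m x ≤ ((E : ℝ) ^ 2 + 1) * rho n x := by
    linarith [rho_le_mul_rho hn1 hnm x]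
  have h1 := H g hg (rho n x) (rho m x) (E ^ 2 + 1) hρn (rho_le_of_le hn x)
    (by linarith [sq_nonneg (E : ℝ)]) hρ
  have h2 := omegaK_nonneg g k (rho m x)
  calc rate g k r m x ≤ (((E : ℝ) ^ 2 + 1) * rho n x) ^ r *
        (C * ((E : ℝ) ^ 2 + 1) ^ k * omegaK g k (rho n x) (-1) 1) := by
        rw [rate]
        gcongr
    _ = _ := by
        rw [rate, mul_pow]
        ring

theorem iteratedDerivWithin_polynomial {s : Set ℝ} (hs : UniqueDiffOn ℝ s) (P : ℝ[X]) (i : ℕ) :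
    ∀ x ∈ s, iteratedDerivWithin i (fun z => P.eval z) s x = (derivative^[i] P).eval x := by
  induction i generalizing P with
  | zero => simp
  | succ i ih =>
    intro x hx
    rw [iteratedDerivWithin_succ', Function.iterate_succ_apply, ← ih _ x hx]
    refine iteratedDerivWithin_congr (fun z hz => ?_) hx
    exact P.derivWithin (hs z hz)

/-- An error bound vanishing to order `μ` at `a` forces Hermite interpolation at `a`. -/
theorem eval_iterate_derivative_eq {r μ : ℕ} (hμ : μ ≤ r) {f : ℝ → ℝ}
    (hf : ContDiffOn ℝ r f (Set.Icc (-1) 1)) {P : ℝ[X]} {a K : ℝ} (ha : a ∈ Set.Icc (-1 : ℝ) 1)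
    (hK : ∀ x ∈ Set.Icc (-1 : ℝ) 1, |f x - P.eval x| ≤ K * |x - a| ^ μ) {i : ℕ} (hi : i < μ) :
    (derivative^[i] P).eval a = iteratedDerivWithin i f (Set.Icc (-1) 1) a := by
  have hu : UniqueDiffOn ℝ (Set.Icc (-1 : ℝ) 1) := uniqueDiffOn_Icc (by norm_num)
  have hP : ContDiffOn ℝ r (fun z => P.eval z) (Set.Icc (-1) 1) := by
    simpa using (P.contDiff_aeval (𝕜 := ℝ) r).contDiffOn (s := Set.Icc (-1) 1)
  have h1 := iteratedDerivWithin_eq_zero_of_abs_le hμ (hf.sub hP) ha hK i hi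
  have hir : (i : WithTop ℕ∞) ≤ r := by exact_mod_cast (hi.le.trans hμ)
  have h2 := iteratedDerivWithin_sub ha hu ((hf a ha).of_le hir) ((hP a ha).of_le hir)
  rw [← iteratedDerivWithin_polynomial hu P i a ha]
  have h3 : iteratedDerivWithin i (f - fun z => P.eval z) (Set.Icc (-1) 1) a = 0 := h1
  linarith

/-- The sign pattern of a product with odd exponents at the interior nodes. -/
theorem neg_one_pow_mul_prod_sub_pow {s : ℕ} {y : Fin (s + 2) → ℝ} (hy : StrictAnti y)
    {ν : Fin (s + 2) → ℕ} (hν : ∀ l, l ≠ 0 → l ≠ Fin.last (s + 1) → Odd (ν l)) (i : Fin (s + 1))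
    {x : ℝ} (hx : x ∈ Set.Icc (y i.succ) (y i.castSucc)) :
    (-1 : ℝ) ^ (i : ℕ) * ((-1) ^ ν 0 * ∏ l, (x - y l) ^ ν l) = ∏ l, |x - y l| ^ ν l := by
  have h1 : ∀ l, (x - y l) ^ ν l =
      (if l ≤ i.castSucc then (-1) ^ ν l else 1) * |x - y l| ^ ν l := by
    intro l
    split_ifs with h
    · rw [abs_of_nonpos (by linarith [hy.antitone h, hx.2]), ← mul_pow]
      ring
    · have : i.succ ≤ l := by
        rw [Fin.le_def, Fin.val_castSucc] at h
        rw [Fin.le_def, Fin.val_succ]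
        omega
      rw [abs_of_nonneg (by linarith [hy.antitone this, hx.1]), one_mul]
  have h2 : ∏ l, (if l ≤ i.castSucc then (-1 : ℝ) ^ ν l else 1) =
      (-1) ^ ν 0 * (-1) ^ (i : ℕ) := by
    rw [Fin.prod_univ_succ, if_pos (Fin.zero_le _)]
    congr 1
    have h3 : ∀ l : Fin (s + 1), (if l.succ ≤ i.castSucc then (-1 : ℝ) ^ ν l.succ else 1) =
        if l < i then -1 else 1 := by
      intro l
      have h4 : l.succ ≤ i.castSucc ↔ l < i := by
        rw [Fin.le_def, Fin.lt_def, Fin.val_castSucc, Fin.val_succ]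
        omega
      simp only [h4]
      split_ifs with h
      · refine (hν _ (Fin.succ_ne_zero l) fun h5 => ?_).neg_one_pow
        have := i.isLt
        rw [Fin.lt_def] at h
        rw [Fin.ext_iff, Fin.val_succ, Fin.val_last] at h5
        omega
      · rfl
    simp only [h3]
    rw [Finset.prod_ite, Finset.prod_const_one, mul_one, Finset.prod_const,
      Finset.filter_gt_eq_Iio, Fin.card_Iio]
  rw [Finset.prod_congr rfl fun l _ => h1 l, Finset.prod_mul_distrib, h2]
  have h5 : ∀ e : ℕ, (-1 : ℝ) ^ e * (-1) ^ e = 1 := fun e => by rw [← mul_pow]; norm_num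
  linear_combination (h5 i * (-1) ^ ν 0 * (-1) ^ ν 0 + h5 (ν 0)) * ∏ l, |x - y l| ^ ν l

/-- Intertwining approximation with Hermite interpolation, in terms of a lower bound `d` for the
distances between the nodes. -/
theorem exists_intertwining_approx {k r : ℕ} (hk : 1 ≤ k) (hr : 1 ≤ r) (s p : ℕ) {e t : ℕ}
    (he : Even e) (her : e ≤ r) (ht : Odd t) (htr : t ≤ r) : ∃ c : ℝ, 0 < c ∧ ∃ N : ℝ → ℕ,
    ∀ y : Fin (s + 2) → ℝ, StrictAnti y → y 0 = 1 → y (Fin.last (s + 1)) = -1 →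
    ∀ B : Finset ℝ, B.card ≤ p → (∀ b ∈ B, b ∈ Set.Icc (-1 : ℝ) 1) → (∀ l, y l ∉ B) →
    ∀ d, 0 < d → (∀ u ∈ Set.range y ∪ B, ∀ v ∈ Set.range y ∪ B, u ≠ v → d ≤ |u - v|) →
    ∀ f : ℝ → ℝ, ContDiffOn ℝ r f (Set.Icc (-1) 1) → ∀ n, N d ≤ n →
    ∃ P : ℝ[X], P.natDegree ≤ n ∧ Delta0 y (fun x => P.eval x - f x) ∧
      (∀ i < e, ∀ b ∈ B,
        (derivative^[i] P).eval b = iteratedDerivWithin i f (Set.Icc (-1) 1) b) ∧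
      (∀ i < t, ∀ l, l ≠ 0 → l ≠ Fin.last (s + 1) →
        (derivative^[i] P).eval (y l) = iteratedDerivWithin i f (Set.Icc (-1) 1) (y l)) ∧
      (∀ i < r, (derivative^[i] P).eval 1 = iteratedDerivWithin i f (Set.Icc (-1) 1) 1 ∧
        (derivative^[i] P).eval (-1) = iteratedDerivWithin i f (Set.Icc (-1) 1) (-1)) ∧
      ∀ x ∈ Set.Icc (-1 : ℝ) 1,
        |f x - P.eval x| ≤ c * rate (iteratedDerivWithin r f (Set.Icc (-1) 1)) k r n x := by
  classical
  obtain ⟨c₁, hc₁, E₁, H₁⟩ := exists_majorized_approx hk hr (s + 2 + p)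
  set E := E₁ + (s + 2 + p) * r with hE
  have hE1 : 1 ≤ E := by
    have : 1 * 1 ≤ (s + 2 + p) * r := Nat.mul_le_mul (by omega) hr
    omega
  obtain ⟨c₂, hc₂, H₂⟩ := exists_rate_le_rate hk r (2 * E)
  refine ⟨2 * (c₁ * c₂), by positivity, fun d => E * max (8 * (k + 1)) (⌈4 / d⌉₊ + 1),
    fun y hy hy0 hy1 B hBp hBI hyB d hd hdist f hf n hn => ?_⟩
  set m := n / E with hm
  have hmax : max (8 * (k + 1)) (⌈4 / d⌉₊ + 1) ≤ m := by
    rw [hm, Nat.le_div_iff_mul_le hE1, mul_comm]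
    exact hn
  have hm8 : 8 * (k + 1) ≤ m := (le_max_left _ _).trans hmax
  have hm1 : 1 ≤ m := by omega
  have hEm : E * m ≤ n := Nat.mul_div_le n E
  have hnm : n ≤ 2 * E * m := by
    have h1 : n < E * m + E := Nat.lt_mul_div_succ n hE1
    have h2 : E ≤ E * m := Nat.le_mul_of_pos_right _ hm1
    rw [mul_assoc]
    omega
  have hn8 : 8 * (k + 1) ≤ n := hm8.trans (Nat.div_le_self _ _)
  have hmd : 4 / (m : ℝ) ≤ d := by
    have h1 : (⌈4 / d⌉₊ : ℝ) ≤ m := by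
      exact_mod_cast (Nat.le_succ _).trans ((le_max_right _ _).trans hmax)
    have h2 : 4 / d ≤ m := (Nat.le_ceil _).trans h1
    rw [div_le_iff₀ hd] at h2
    rw [div_le_iff₀ (by exact_mod_cast hm1), mul_comm]
    exact h2
  have hyI : ∀ l, y l ∈ Set.Icc (-1 : ℝ) 1 := fun l =>
    ⟨hy1 ▸ hy.antitone (Fin.le_last l), hy0 ▸ hy.antitone (Fin.zero_le l)⟩
  set A := Finset.univ.image y ∪ B with hA
  have hyA : ∀ l, y l ∈ A := fun l =>
    Finset.mem_union_left _ (Finset.mem_image_of_mem _ (Finset.mem_univ l))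
  have hAI : ∀ a ∈ A, a ∈ Set.Icc (-1 : ℝ) 1 := by
    intro a ha
    rcases Finset.mem_union.1 ha with h | h
    · obtain ⟨l, -, rfl⟩ := Finset.mem_image.1 h
      exact hyI l
    · exact hBI a h
  have hAr : ∀ a ∈ A, a ∈ Set.range y ∪ B := by
    intro a ha
    rcases Finset.mem_union.1 ha with h | h
    · obtain ⟨l, -, rfl⟩ := Finset.mem_image.1 h
      exact Or.inl ⟨l, rfl⟩
    · exact Or.inr h
  have hAcard : A.card ≤ s + 2 + p := by
    refine (Finset.card_union_le _ _).trans (add_le_add (Finset.card_image_le.trans ?_) hBp)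
    simp
  set μ : ℝ → ℕ := fun a => if a ∈ B then e else if a = 1 ∨ a = -1 then r else t with hμ
  have hμr : ∀ a, μ a ≤ r := by
    intro a
    simp only [hμ]
    split_ifs
    exacts [her, le_rfl, htr]
  have hμB : ∀ b ∈ B, μ b = e := fun b hb => if_pos hb
  have hμ1 : ∀ a, a = 1 ∨ a = -1 → μ a = r := by
    intro a ha
    have : a ∉ B := by
      rcases ha with rfl | rfl
      · exact hy0 ▸ hyB 0
      · exact hy1 ▸ hyB _
    simp only [hμ, if_neg this, if_pos ha]
  have hμy : ∀ l, l ≠ 0 → l ≠ Fin.last (s + 1) → μ (y l) = t := by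
    intro l h0 h1
    have : ¬(y l = 1 ∨ y l = -1) := by
      rintro (h | h)
      · exact h0 (hy.injective (h.trans hy0.symm))
      · exact h1 (hy.injective (h.trans hy1.symm))
    simp only [hμ, if_neg (hyB l), if_neg this]
  obtain ⟨Q, T, hQd, hTd, hQT⟩ := H₁ f hf m hm8 A ⟨_, hyA 0⟩ hAcard hAI
    (fun a ha b hb hab => hmd.trans (hdist a (hAr a ha) b (hAr b hb) hab)) μ fun a _ => hμr a
  have hprod : ∀ x, ∏ a ∈ A, |x - a| ^ μ a =
      (∏ l, |x - y l| ^ μ (y l)) * ∏ b ∈ B, |x - b| ^ e := by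
    intro x
    rw [hA, Finset.prod_union, Finset.prod_image hy.injective.injOn]
    · congr 1
      exact Finset.prod_congr rfl fun b hb => by rw [hμB b hb]
    · rw [Finset.disjoint_left]
      intro a ha
      obtain ⟨l, -, rfl⟩ := Finset.mem_image.1 ha
      exact hyB l
  set W : ℝ[X] := C ((-1) ^ r) * (∏ l, (X - C (y l)) ^ μ (y l)) * ∏ b ∈ B, (X - C b) ^ e with hW
  have hWe : ∀ x, W.eval x =
      (-1) ^ r * (∏ l, (x - y l) ^ μ (y l)) * ∏ b ∈ B, (x - b) ^ e := by
    intro x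
    simp [hW, eval_prod]
  have hWabs : ∀ x, |W.eval x| = ∏ a ∈ A, |x - a| ^ μ a := by
    intro x
    rw [hWe, hprod]
    simp [abs_mul, Finset.abs_prod]
  have hWd : W.natDegree ≤ (s + 2 + p) * r := by
    have h1 : (∏ l, (X - C (y l)) ^ μ (y l)).natDegree ≤ (s + 2) * r := by
      refine (natDegree_prod_le _ _).trans ((Finset.sum_le_card_nsmul _ _ r fun l _ => ?_).trans ?_)
      · rw [natDegree_pow, natDegree_X_sub_C, mul_one]
        exact hμr _
      · simp
    have h2 : (∏ b ∈ B, (X - C b) ^ e).natDegree ≤ p * r := by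
      refine (natDegree_prod_le _ _).trans ((Finset.sum_le_card_nsmul _ _ r fun b _ => ?_).trans ?_)
      · rw [natDegree_pow, natDegree_X_sub_C, mul_one]
        exact her
      · rw [smul_eq_mul]
        exact Nat.mul_le_mul_right _ hBp
    rw [hW, add_mul]
    exact natDegree_mul_le.trans (add_le_add ((natDegree_C_mul_le _ _).trans h1) h2)
  have hfP : ∀ x ∈ Set.Icc (-1 : ℝ) 1, |f x - (Q + T * W).eval x| ≤
      2 * (T.eval x * ∏ a ∈ A, |x - a| ^ μ a) := by
    intro x hx
    obtain ⟨hT0, h1, -⟩ := hQT x hx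
    have h2 : f x - (Q + T * W).eval x = (f x - Q.eval x) - T.eval x * W.eval x := by
      rw [eval_add, eval_mul]
      ring
    rw [h2]
    refine (abs_sub _ _).trans ?_
    rw [abs_mul, abs_of_nonneg hT0, hWabs]
    linarith
  have hinterp : ∀ a ∈ A, ∀ i < μ a, (derivative^[i] (Q + T * W)).eval a =
      iteratedDerivWithin i f (Set.Icc (-1) 1) a := by
    intro a ha i hi
    obtain ⟨K, hK⟩ := (isCompact_Icc (a := (-1 : ℝ)) (b := 1)).exists_bound_of_continuousOn
      (f := fun x => 2 * (T.eval x * ∏ b ∈ A.erase a, |x - b| ^ μ b)) (by fun_prop)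
    refine eval_iterate_derivative_eq (hμr a) hf (hAI a ha) (K := K) (fun x hx => ?_) hi
    refine (hfP x hx).trans ?_
    rw [← Finset.prod_erase_mul A _ ha, ← mul_assoc, ← mul_assoc]
    refine mul_le_mul_of_nonneg_right ?_ (by positivity)
    rw [mul_assoc]
    exact (le_abs_self _).trans (hK x hx)
  refine ⟨Q + T * W, ?_, fun i x hx => ?_, fun i hi b hb => ?_, fun i hi l h0 h1 => ?_,
    fun i hi => ⟨?_, ?_⟩, fun x hx => (hfP x hx).trans ?_⟩
  · have h1 : (s + 2 + p) * r ≤ (s + 2 + p) * r * m := Nat.le_mul_of_pos_right _ hm1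
    have h2 : E * m = E₁ * m + (s + 2 + p) * r * m := by rw [hE, add_mul]
    refine (natDegree_add_le _ _).trans (max_le ?_ (natDegree_mul_le.trans ?_))
    · omega
    · omega
  · have hxI : x ∈ Set.Icc (-1 : ℝ) 1 := ⟨(hyI _).1.trans hx.1, hx.2.trans (hyI _).2⟩
    obtain ⟨-, h1, -⟩ := hQT x hxI
    have h2 := neg_one_pow_mul_prod_sub_pow hy (ν := fun l => μ (y l))
      (fun l h0 h1 => by rwa [hμy l h0 h1]) i hx
    rw [hμ1 _ (Or.inl hy0)] at h2
    have h3 : (-1 : ℝ) ^ (i : ℕ) * W.eval x = ∏ a ∈ A, |x - a| ^ μ a := by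
      rw [hWe, hprod, ← h2, Finset.prod_congr rfl fun b _ => he.pow_abs (x - b)]
      ring
    have h4 : |(-1 : ℝ) ^ (i : ℕ) * (f x - Q.eval x)| = |f x - Q.eval x| := by
      simp [abs_mul]
    have h5 := le_abs_self ((-1 : ℝ) ^ (i : ℕ) * (f x - Q.eval x))
    have h6 : (-1 : ℝ) ^ (i : ℕ) * ((Q + T * W).eval x - f x) =
        T.eval x * ((-1 : ℝ) ^ (i : ℕ) * W.eval x) - (-1 : ℝ) ^ (i : ℕ) * (f x - Q.eval x) := by
      rw [eval_add, eval_mul]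
      ring
    rw [h6, h3]
    linarith
  · exact hinterp b (Finset.mem_union_right _ hb) i (by rwa [hμB b hb])
  · exact hinterp _ (hyA l) i (by rwa [hμy l h0 h1])
  · exact hinterp 1 (hy0 ▸ hyA 0) i (by rwa [hμ1 1 (Or.inl rfl)])
  · exact hinterp (-1) (hy1 ▸ hyA _) i (by rwa [hμ1 (-1) (Or.inr rfl)])
  · obtain ⟨-, -, h1⟩ := hQT x hx
    have h2 := H₂ _ (hf.continuousOn_iteratedDerivWithin le_rfl (uniqueDiffOn_Icc (by norm_num)))
      m n hn8 hnm x
    calc _ ≤ 2 * (c₁ * (c₂ * rate (iteratedDerivWithin r f (Set.Icc (-1) 1)) k r n x)) := by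
          refine mul_le_mul_of_nonneg_left (h1.trans ?_) zero_le_two
          gcongr
      _ = _ := by ring

theorem finite_dist_set {S : Set ℝ} (hS : S.Finite) :
    {d : ℝ | ∃ u ∈ S, ∃ v ∈ S, u ≠ v ∧ d = |u - v|}.Finite := by
  refine ((hS.prod hS).image fun z : ℝ × ℝ => |z.1 - z.2|).subset ?_
  rintro d ⟨u, hu, v, hv, -, rfl⟩
  exact ⟨(u, v), ⟨hu, hv⟩, rfl⟩

theorem minGap_le {S : Set ℝ} (hS : S.Finite) {u v : ℝ} (hu : u ∈ S) (hv : v ∈ S) (huv : u ≠ v) :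
    minGap S ≤ |u - v| :=
  csInf_le (finite_dist_set hS).bddBelow ⟨u, hu, v, hv, huv, rfl⟩

theorem minGap_pos {S : Set ℝ} (hS : S.Finite) (hS' : S.Nontrivial) : 0 < minGap S := by
  obtain ⟨u, hu, v, hv, huv⟩ := hS'
  obtain ⟨a, -, b, -, hab, h⟩ : minGap S ∈ {d : ℝ | ∃ u ∈ S, ∃ v ∈ S, u ≠ v ∧ d = |u - v|} :=
    Set.Nonempty.csInf_mem ⟨_, u, hu, v, hv, huv, rfl⟩ (finite_dist_set hS)
  rw [h]
  exact abs_pos.2 (sub_ne_zero.2 hab)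

end

/-- Intertwining polynomial approximation with interpolatory constraints:
for `(r, m₁, m₂, m₃) ∈ {(2j, 2j-1, 2j-2, 2j-1) : j ≥ 1} ∪ {(2j+1, 2j-1, 2j, 2j) : j ≥ 0}`
there is `c = c(k,r,s,p) > 0` and, for every admissible `Y_s`, `A_p` with
`Y_s ∩ A_p = ∅`, a threshold `N` depending only on `d(Y_s, A_p)`, such that for every
`f ∈ C^r[-1,1]` and `n ≥ N` there is a polynomial `P_n` of degree ≤ n with
`P_n - f ∈ Δ^(0)(Y_s)`, Hermite interpolation of orders `m₁, m₂, m₃` at the points of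
`A_p`, `Y_s`, `{±1}` respectively, and
`|f(x) - P_n(x)| ≤ c ρ_n^r(x) ω_k(f^{(r)}, ρ_n(x))` on `[-1,1]`. -/
theorem statement1 (k p s : ℕ) (hk : 1 ≤ k) (hp : 1 ≤ p) (hs : 1 ≤ s)
    (r : ℕ) (m₁ : ℤ) (m₂ m₃ : ℕ)
    (hm : (∃ j : ℕ, 1 ≤ j ∧ r = 2 * j ∧ m₁ = 2 * (j : ℤ) - 1 ∧
            m₂ = 2 * j - 2 ∧ m₃ = 2 * j - 1)
        ∨ (∃ j : ℕ, r = 2 * j + 1 ∧ m₁ = 2 * (j : ℤ) - 1 ∧ m₂ = 2 * j ∧ m₃ = 2 * j)) :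
    ∃ c : ℝ, 0 < c ∧ ∃ Nf : ℝ → ℕ,
      ∀ (y : Fin (s + 2) → ℝ), StrictAnti y → y 0 = 1 → y (Fin.last (s + 1)) = -1 →
      ∀ (α : Fin p → ℝ), StrictAnti α → (∀ j, α j ∈ Set.Icc (-1 : ℝ) 1) →
      (∀ i : Fin (s + 2), i ≠ 0 → i ≠ Fin.last (s + 1) → ∀ j, y i ≠ α j) →
      ∀ f : ℝ → ℝ, ContDiffOn ℝ r f (Set.Icc (-1 : ℝ) 1) →
      ∀ n : ℕ, Nf (minGap (Set.range y ∪ Set.range α ∪ {-1, 1})) ≤ n →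
      ∃ P : Polynomial ℝ, P.natDegree ≤ n ∧
        Delta0 y (fun x => P.eval x - f x) ∧
        (∀ i : ℕ, (i : ℤ) ≤ m₁ → ∀ j : Fin p,
          (Polynomial.derivative^[i] P).eval (α j)
            = iteratedDerivWithin i f (Set.Icc (-1 : ℝ) 1) (α j)) ∧
        (∀ i : ℕ, i ≤ m₂ → ∀ jj : Fin (s + 2), jj ≠ 0 → jj ≠ Fin.last (s + 1) →
          (Polynomial.derivative^[i] P).eval (y jj)
            = iteratedDerivWithin i f (Set.Icc (-1 : ℝ) 1) (y jj)) ∧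
        (∀ i : ℕ, i ≤ m₃ →
          (Polynomial.derivative^[i] P).eval 1
            = iteratedDerivWithin i f (Set.Icc (-1 : ℝ) 1) 1 ∧
          (Polynomial.derivative^[i] P).eval (-1)
            = iteratedDerivWithin i f (Set.Icc (-1 : ℝ) 1) (-1)) ∧
        ∀ x ∈ Set.Icc (-1 : ℝ) 1,
          |f x - P.eval x| ≤ c * rho n x ^ r *
            omegaK (iteratedDerivWithin r f (Set.Icc (-1 : ℝ) 1)) k (rho n x) (-1) 1 := by
  classical
  obtain ⟨hr, hm₁, hm₁r, hodd, hm₂, hm₃⟩ : 1 ≤ r ∧ Even (m₁ + 1).toNat ∧ m₁ + 1 ≤ r ∧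
      Odd (m₂ + 1) ∧ m₂ + 1 ≤ r ∧ m₃ + 1 = r := by
    rcases hm with ⟨j, hj, rfl, rfl, rfl, rfl⟩ | ⟨j, rfl, rfl, rfl, rfl⟩
    · exact ⟨by omega, ⟨j, by omega⟩, by push_cast; omega, ⟨j - 1, by omega⟩, by omega, by omega⟩
    · exact ⟨by omega, ⟨j, by omega⟩, by push_cast; omega, ⟨j, by omega⟩, by omega, by omega⟩
  obtain ⟨c, hc, N, H⟩ := exists_intertwining_approx hk hr s p hm₁ (by omega) hodd hm₂
  refine ⟨c, hc, N, fun y hy hy0 hy1 α hα hαI hyα f hf n hn => ?_⟩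
  set S := Set.range y ∪ Set.range α ∪ {-1, 1} with hS
  have hSfin : S.Finite :=
    ((Set.finite_range y).union (Set.finite_range α)).union (Set.toFinite _)
  have hSnt : S.Nontrivial := ⟨-1, by simp [hS], 1, by simp [hS], by norm_num⟩
  set B := (Finset.univ.image α).filter fun a => a ∉ Set.range y with hB
  have hBα : ∀ b ∈ B, ∃ j, α j = b := fun b hb => by
    simpa using (Finset.mem_filter.1 hb).1
  have hsub : Set.range y ∪ B ⊆ S := by
    rintro u (h | h)
    · exact Or.inl (Or.inl h)
    · exact Or.inl (Or.inr (hBα u h))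
  obtain ⟨P, hPd, hPΔ, hPB, hPy, hP1, hP⟩ := H y hy hy0 hy1 B
    ((Finset.card_filter_le _ _).trans (Finset.card_image_le.trans (by simp)))
    (fun b hb => by
      obtain ⟨j, rfl⟩ := hBα b hb
      exact hαI j)
    (fun l hl => (Finset.mem_filter.1 hl).2 ⟨l, rfl⟩) (minGap S) (minGap_pos hSfin hSnt)
    (fun u hu v hv huv => minGap_le hSfin (hsub hu) (hsub hv) huv) f hf n hn
  refine ⟨P, hPd, hPΔ, fun i hi j => ?_, fun i hi => hPy i (by omega),
    fun i hi => hP1 i (by omega), fun x hx => ?_⟩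
  · by_cases h : α j ∈ Set.range y
    · obtain ⟨l, hl⟩ := h
      have hir : i < r := by omega
      by_cases h0 : l = 0
      · rw [← hl, h0, hy0]
        exact (hP1 i hir).1
      by_cases h1 : l = Fin.last (s + 1)
      · rw [← hl, h1, hy1]
        exact (hP1 i hir).2
      exact absurd hl (hyα l h0 h1 j)
    · exact hPB i (by omega) _ (Finset.mem_filter.2
        ⟨Finset.mem_image_of_mem _ (Finset.mem_univ j), h⟩)
  · rw [mul_assoc]
    exact hP x hx
end
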